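/- Let D be a disk in ℝ², q ∈ (2,∞), p ∈ [2,q], and p' = p/(p-1). Let a ∈ W^{1,p}(D) and b ∈ W^{1,p'}(D), and let φ solve Δφ = ∇^⊥a·∇b in D with φ = 0 on ∂D. Then ‖∇²φ‖_{L¹(D)} ≤ C_q ‖∇a‖_{L^p(D)} ‖∇b‖_{L^{p'}(D)}, where C_q depends only on q (not on p). -/

import Mathlib

open MeasureTheory Metric Real
open scoped ENNReal NNReal RealInnerProductSpace

noncomputable section

abbrev E2 := EuclideanSpace ℝ (Fin 2)
abbrev E3 := EuclideanSpace ℝ (Fin 3)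

/-- `i`-th partial derivative. -/
def pd {F : Type*} [NormedAddCommGroup F] [NormedSpace ℝ F]
    (i : Fin 2) (f : E2 → F) (x : E2) : F :=
  fderiv ℝ f x (EuclideanSpace.single i 1)

/-- Laplacian on `ℝ²`. -/
def lap {F : Type*} [NormedAddCommGroup F] [NormedSpace ℝ F]
    (f : E2 → F) (x : E2) : F :=
  pd 0 (pd 0 f) x + pd 1 (pd 1 f) x

/-- cross product in `ℝ³`. -/
def cross3 (u v : E3) : E3 :=
  (WithLp.equiv 2 (Fin 3 → ℝ)).symm
    (crossProduct (WithLp.equiv 2 (Fin 3 → ℝ) u) (WithLp.equiv 2 (Fin 3 → ℝ) v))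

/-- weak `L^p` (Marcinkiewicz) quasinorm of `f` on the set `s`. -/
def wnorm (p : ℝ) (f : E2 → ℝ) (s : Set E2) : ℝ≥0∞ :=
  ⨆ t : ℝ≥0, (t : ℝ≥0∞) * (volume {x ∈ s | (t : ℝ) < |f x|}) ^ (1 / p)

/-- Lorentz `L^{p,q}` quasinorm (with `q = ∞` giving weak `L^p`). -/
def lorentzNorm (p : ℝ) (q : ℝ≥0∞) (f : E2 → ℝ) (s : Set E2) : ℝ≥0∞ :=
  if q = ⊤ then wnorm p f s
  else (∫⁻ t in Set.Ioi (0 : ℝ),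
    (ENNReal.ofReal t * (volume {x ∈ s | t < |f x|}) ^ (1 / p)) ^ q.toReal
      / ENNReal.ofReal t) ^ (1 / q.toReal)


section

open Filter Set
open scoped Topology

/-- Uncentred Hardy–Littlewood maximal function over balls of radius at most `R`. -/
def maxFn (R : ℝ) (g : ℂ → ℝ≥0∞) (x : ℂ) : ℝ≥0∞ :=
  ⨆ (c : ℂ) (ρ : ℝ) (_ : 0 < ρ ∧ ρ ≤ R ∧ x ∈ ball c ρ),
    (volume (ball c ρ))⁻¹ * ∫⁻ y in ball c ρ, g y

theorem volume_ball_complex (c : ℂ) (ρ : ℝ) :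
    volume (ball c ρ) = ENNReal.ofReal ρ ^ 2 * NNReal.pi := by
  simp

theorem lt_maxFn_iff {R : ℝ} {g : ℂ → ℝ≥0∞} {x : ℂ} {m : ℝ≥0∞} :
    m < maxFn R g x ↔ ∃ (c : ℂ) (ρ : ℝ), (0 < ρ ∧ ρ ≤ R ∧ x ∈ ball c ρ) ∧
      m < (volume (ball c ρ))⁻¹ * ∫⁻ y in ball c ρ, g y := by
  simp only [maxFn, lt_iSup_iff, exists_prop]

theorem isOpen_lt_maxFn (R : ℝ) (g : ℂ → ℝ≥0∞) (m : ℝ≥0∞) : IsOpen {x | m < maxFn R g x} := by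
  rw [isOpen_iff_mem_nhds]
  intro x hx
  obtain ⟨c, ρ, ⟨h0, hR, hx⟩, h⟩ := lt_maxFn_iff.1 hx
  filter_upwards [isOpen_ball.mem_nhds hx] with y hy
  exact lt_maxFn_iff.2 ⟨c, ρ, ⟨h0, hR, hy⟩, h⟩

theorem measurable_maxFn (R : ℝ) (g : ℂ → ℝ≥0∞) : Measurable (maxFn R g) :=
  measurable_of_Ioi fun m => (isOpen_lt_maxFn R g m).measurableSet

theorem maxFn_weak_type (R : ℝ) (g : ℂ → ℝ≥0∞) (m : ℝ≥0∞) :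
    m * volume {x | m < maxFn R g x} ≤ 16 * ∫⁻ x, g x := by
  set t : Set (ℂ × ℝ) := {a | (0 < a.2 ∧ a.2 ≤ R) ∧
    m < (volume (ball a.1 a.2))⁻¹ * ∫⁻ y in ball a.1 a.2, g y} with ht
  obtain ⟨u, hut, hdisj, hcov⟩ := Vitali.exists_disjoint_subfamily_covering_enlargement_ball
    t (fun a => a.1) (fun a => a.2) R (fun a ha => ha.1.2) 4 (by norm_num)
  have hcount : u.Countable := by
    refine hdisj.countable_of_isOpen (fun _ _ => isOpen_ball) fun a ha => ?_
    exact ⟨a.1, mem_ball_self (hut ha).1.1⟩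
  have hsub : {x | m < maxFn R g x} ⊆ ⋃ a ∈ u, ball a.1 (4 * a.2) := by
    intro x hx
    obtain ⟨c, ρ, ⟨h0, hR, hx⟩, h⟩ := lt_maxFn_iff.1 hx
    obtain ⟨b, hb, hsub⟩ := hcov (c, ρ) ⟨⟨h0, hR⟩, h⟩
    exact mem_iUnion₂.2 ⟨b, hb, hsub hx⟩
  have hball : ∀ a ∈ u, m * volume (ball a.1 (4 * a.2)) ≤ 16 * ∫⁻ y in ball a.1 a.2, g y := by
    intro a ha
    obtain ⟨⟨h0, -⟩, h⟩ := hut ha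
    have hv : volume (ball a.1 a.2) ≠ 0 := (measure_ball_pos _ _ h0).ne'
    have hv' : volume (ball a.1 a.2) ≠ ∞ := measure_ball_lt_top.ne
    have h1 : volume (ball a.1 (4 * a.2)) = 16 * volume (ball a.1 a.2) := by
      rw [volume_ball_complex, volume_ball_complex, ENNReal.ofReal_mul (by norm_num), mul_pow,
        mul_assoc]
      congr 1
      norm_num
    rw [h1, mul_left_comm]
    gcongr
    calc m * volume (ball a.1 a.2)
        ≤ ((volume (ball a.1 a.2))⁻¹ * ∫⁻ y in ball a.1 a.2, g y) * volume (ball a.1 a.2) := by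
          gcongr
      _ = ∫⁻ y in ball a.1 a.2, g y := by
          rw [mul_comm, ← mul_assoc, ENNReal.mul_inv_cancel hv hv', one_mul]
  have := hcount.to_subtype
  calc m * volume {x | m < maxFn R g x}
      ≤ m * ∑' a : u, volume (ball a.1.1 (4 * a.1.2)) := by
        gcongr
        refine (measure_mono hsub).trans ?_
        rw [biUnion_eq_iUnion]
        exact measure_iUnion_le _
    _ = ∑' a : u, m * volume (ball a.1.1 (4 * a.1.2)) := ENNReal.tsum_mul_left.symm
    _ ≤ ∑' a : u, 16 * ∫⁻ y in ball a.1.1 a.1.2, g y :=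
        ENNReal.tsum_le_tsum fun a => hball a.1 a.2
    _ = 16 * ∑' a : u, ∫⁻ y in ball a.1.1 a.1.2, g y := ENNReal.tsum_mul_left
    _ = 16 * ∫⁻ y in ⋃ a : u, ball a.1.1 a.1.2, g y := by
        rw [lintegral_iUnion (fun _ => measurableSet_ball)]
        exact fun a b hab => hdisj a.2 b.2 fun h => hab (Subtype.ext h)
    _ ≤ 16 * ∫⁻ y, g y := by gcongr; exact Measure.restrict_le_self

theorem lintegral_layer {α : Type*} [MeasurableSpace α] {μ : Measure α} [SFinite μ]
    {w : ℝ → ℝ≥0∞} (hw : Measurable w) {h : α → ℝ≥0∞} (hh : Measurable h) {k : α → ℝ≥0∞}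
    (hk : Measurable k) :
    ∫⁻ x, k x * (∫⁻ t in Ioi (0 : ℝ), {t | ENNReal.ofReal t < h x}.indicator w t) ∂μ =
      ∫⁻ t in Ioi (0 : ℝ), w t * (∫⁻ x in {x | ENNReal.ofReal t < h x}, k x ∂μ) := by
  have hS : MeasurableSet {q : α × ℝ | ENNReal.ofReal q.2 < h q.1} :=
    measurableSet_lt (by fun_prop) (by fun_prop)
  have h1 : ∀ x, k x * ∫⁻ t in Ioi (0 : ℝ), {t | ENNReal.ofReal t < h x}.indicator w t =
      ∫⁻ t in Ioi (0 : ℝ), {q : α × ℝ | ENNReal.ofReal q.2 < h q.1}.indicator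
        (fun q => k q.1 * w q.2) (x, t) := by
    intro x
    rw [← lintegral_const_mul]
    · congr 1 with t
      by_cases ht : ENNReal.ofReal t < h x <;> simp [indicator, ht]
    · exact hw.indicator (measurableSet_lt (by fun_prop) (by fun_prop))
  simp_rw [h1]
  rw [lintegral_lintegral_swap]
  · congr 1 with t
    rw [← lintegral_const_mul _ hk, ← lintegral_indicator (measurableSet_lt (by fun_prop) hh)]
    congr 1 with x
    by_cases ht : ENNReal.ofReal t < h x <;> simp [indicator, ht, mul_comm]
  · refine Measurable.aemeasurable ?_
    exact Measurable.indicator (by fun_prop) hS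

theorem lintegral_Ioi_indicator_rpow {P : ℝ} (hP : 0 < P) {r : ℝ} (hr : 0 ≤ r) :
    ∫⁻ t in Ioi (0 : ℝ), {t | ENNReal.ofReal t < ENNReal.ofReal r}.indicator
      (fun t => ENNReal.ofReal (P * t ^ (P - 1))) t = ENNReal.ofReal (r ^ P) := by
  have hS : MeasurableSet {t | ENNReal.ofReal t < ENNReal.ofReal r} :=
    measurableSet_lt (by fun_prop) (by fun_prop)
  rw [lintegral_indicator hS, Measure.restrict_restrict hS]
  have : {t | ENNReal.ofReal t < ENNReal.ofReal r} ∩ Ioi 0 = Ioo 0 r := by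
    ext t
    simp only [mem_inter_iff, mem_ofPred_eq, mem_Ioi, mem_Ioo]
    constructor
    · rintro ⟨h1, h2⟩
      exact ⟨h2, (ENNReal.ofReal_lt_ofReal_iff_of_nonneg h2.le).1 h1⟩
    · rintro ⟨h1, h2⟩
      exact ⟨(ENNReal.ofReal_lt_ofReal_iff_of_nonneg h1.le).2 h2, h1⟩
  rw [this, setLIntegral_congr Ioo_ae_eq_Ioc]
  have hinteg : IntervalIntegrable (fun t : ℝ => P * t ^ (P - 1)) volume 0 r :=
    (intervalIntegral.intervalIntegrable_rpow' (by linarith)).const_mul P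
  rw [intervalIntegrable_iff_integrableOn_Ioc_of_le hr] at hinteg
  rw [← ofReal_integral_eq_lintegral_ofReal hinteg, ← intervalIntegral.integral_of_le hr]
  · congr 1
    rw [intervalIntegral.integral_const_mul, integral_rpow (Or.inl (by linarith))]
    simp [hP.ne']
    field_simp
  · filter_upwards [ae_restrict_mem measurableSet_Ioc] with t ht
    have := ht.1.le
    simp only [Pi.zero_apply]
    positivity

theorem rpow_eq_layer {P : ℝ} (hP : 0 < P) (x : ℝ≥0∞) :
    x ^ P = ∫⁻ t in Ioi (0 : ℝ), {t | ENNReal.ofReal t < x}.indicator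
      (fun t => ENNReal.ofReal (P * t ^ (P - 1))) t := by
  rcases eq_or_ne x ∞ with rfl | hx
  · rw [ENNReal.top_rpow_of_pos hP]
    refine (ENNReal.eq_top_of_forall_nnreal_le fun r => ?_).symm
    have h := lintegral_Ioi_indicator_rpow hP (r := (r : ℝ) ^ (P⁻¹)) (by positivity)
    rw [Real.rpow_inv_rpow r.coe_nonneg hP.ne', ENNReal.ofReal_coe_nnreal] at h
    rw [← h]
    refine lintegral_mono fun t => indicator_le_indicator_of_subset ?_ (fun _ => zero_le) t
    intro t _
    simp
  · rw [← ENNReal.ofReal_toReal hx, lintegral_Ioi_indicator_rpow hP ENNReal.toReal_nonneg,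
      ENNReal.ofReal_rpow_of_nonneg ENNReal.toReal_nonneg hP.le]

theorem maxFn_le_add (R : ℝ) (g : ℂ → ℝ≥0∞) (m : ℝ≥0∞) (x : ℂ) :
    maxFn R g x ≤ maxFn R ({y | m < g y}.indicator g) x + m := by
  refine iSup_le fun c => iSup_le fun ρ => iSup_le fun h => ?_
  have hv : volume (ball c ρ) ≠ 0 := (measure_ball_pos _ _ h.1).ne'
  have hv' : volume (ball c ρ) ≠ ∞ := measure_ball_lt_top.ne
  calc (volume (ball c ρ))⁻¹ * ∫⁻ y in ball c ρ, g y
      ≤ (volume (ball c ρ))⁻¹ * ∫⁻ y in ball c ρ, ({y | m < g y}.indicator g y + m) := by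
        gcongr with y
        by_cases hy : m < g y
        · simp [indicator, hy]
        · simp only [indicator, mem_ofPred_eq, hy, if_false, zero_add]
          exact not_lt.1 hy
    _ = (volume (ball c ρ))⁻¹ * (∫⁻ y in ball c ρ, {y | m < g y}.indicator g y) + m := by
        rw [lintegral_add_right _ measurable_const, mul_add, lintegral_const,
          Measure.restrict_apply_univ, mul_comm m, ← mul_assoc, ENNReal.inv_mul_cancel hv hv',
          one_mul]
    _ ≤ _ := by
        gcongr
        exact le_iSup_of_le c (le_iSup_of_le ρ (le_iSup_of_le h le_rfl))

theorem maxFn_strong_type (R : ℝ) {g : ℂ → ℝ≥0∞} (hg : Measurable g) {P : ℝ} (hP : 1 < P) :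
    ∫⁻ x, maxFn R g x ^ P ≤ ENNReal.ofReal (32 * P * 2 ^ (P - 1) / (P - 1)) * ∫⁻ x, g x ^ P := by
  have hP0 : 0 < P := by linarith
  have hP1 : 0 < P - 1 := by linarith
  have hlev : ∀ t ∈ Ioi (0 : ℝ), volume {x | ENNReal.ofReal t < maxFn R g x} ≤
      ENNReal.ofReal (32 / t) * ∫⁻ x in {x | ENNReal.ofReal t < 2 * g x}, g x := by
    intro t ht
    have ht : 0 < t := ht
    set m := ENNReal.ofReal (t / 2) with hm
    have hsub : {x | ENNReal.ofReal t < maxFn R g x} ⊆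
        {x | m < maxFn R ({y | m < g y}.indicator g) x} := by
      intro x hx
      have h1 := lt_of_lt_of_le (show ENNReal.ofReal t < maxFn R g x from hx)
        (maxFn_le_add R g m x)
      have h2 : ENNReal.ofReal t = m + m := by
        rw [hm, ← ENNReal.ofReal_add (by positivity) (by positivity)]
        congr 1
        ring
      rw [h2] at h1
      exact lt_of_add_lt_add_right h1
    have hset : {x | ENNReal.ofReal t < 2 * g x} = {y | m < g y} := by
      ext x
      simp only [mem_ofPred_eq]
      have h2 : ENNReal.ofReal t = 2 * m := by
        rw [hm, show (2 : ℝ≥0∞) = ENNReal.ofReal 2 by simp,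
          ← ENNReal.ofReal_mul (by norm_num)]
        congr 1
        ring
      rw [h2, ENNReal.mul_lt_mul_iff_right (by norm_num) (by norm_num)]
    have hw := maxFn_weak_type R ({y | m < g y}.indicator g) m
    rw [lintegral_indicator (measurableSet_lt measurable_const hg)] at hw
    have hm0 : m ≠ 0 := by
      simp only [hm, ne_eq, ENNReal.ofReal_eq_zero, not_le]
      positivity
    rw [hset]
    calc volume {x | ENNReal.ofReal t < maxFn R g x}
        ≤ volume {x | m < maxFn R ({y | m < g y}.indicator g) x} := measure_mono hsub
      _ = m⁻¹ * (m * volume {x | m < maxFn R ({y | m < g y}.indicator g) x}) := by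
          rw [← mul_assoc, ENNReal.inv_mul_cancel hm0 (by simp [hm]), one_mul]
      _ ≤ m⁻¹ * (16 * ∫⁻ x in {y | m < g y}, g x) := by gcongr
      _ = ENNReal.ofReal (32 / t) * ∫⁻ x in {y | m < g y}, g x := by
          rw [← mul_assoc]
          congr 1
          rw [hm, ← ENNReal.ofReal_inv_of_pos (by positivity),
            show (16 : ℝ≥0∞) = ENNReal.ofReal 16 by simp, ← ENNReal.ofReal_mul (by positivity)]
          congr 1
          field_simp
          norm_num
  have hmeasw : Measurable fun t : ℝ => ENNReal.ofReal (P * t ^ (P - 1)) := by fun_prop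
  calc ∫⁻ x, maxFn R g x ^ P
      = ∫⁻ t in Ioi (0 : ℝ), ENNReal.ofReal (P * t ^ (P - 1)) *
          ∫⁻ x in {x | ENNReal.ofReal t < maxFn R g x}, 1 := by
        rw [← lintegral_layer hmeasw (measurable_maxFn R g) measurable_const]
        simp_rw [one_mul, ← rpow_eq_layer hP0]
    _ ≤ ∫⁻ t in Ioi (0 : ℝ), ENNReal.ofReal (32 * P / (P - 1)) *
          (ENNReal.ofReal ((P - 1) * t ^ (P - 1 - 1)) *
            ∫⁻ x in {x | ENNReal.ofReal t < 2 * g x}, g x) := by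
        refine setLIntegral_mono' measurableSet_Ioi fun t ht => ?_
        have ht0 : 0 < t := ht
        rw [setLIntegral_one]
        refine (mul_le_mul_right (hlev t ht) _).trans (le_of_eq ?_)
        rw [← mul_assoc, ← mul_assoc, ← ENNReal.ofReal_mul (by positivity),
          ← ENNReal.ofReal_mul (by positivity)]
        congr 2
        rw [Real.rpow_sub_one ht0.ne' (P - 1)]
        field_simp
    _ = ENNReal.ofReal (32 * P / (P - 1)) * ∫⁻ x, g x * (2 * g x) ^ (P - 1) := by
        rw [lintegral_const_mul', ← lintegral_layer (by fun_prop) (by fun_prop) hg]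
        · simp_rw [← rpow_eq_layer hP1]
        · simp
    _ = _ := by
        rw [show 32 * P * 2 ^ (P - 1) / (P - 1) = 32 * P / (P - 1) * 2 ^ (P - 1) by ring,
          ENNReal.ofReal_mul (by positivity), mul_assoc,
          ← lintegral_const_mul' (ENNReal.ofReal (2 ^ (P - 1))) _ (by simp)]
        congr 1
        refine lintegral_congr fun x => ?_
        rw [ENNReal.mul_rpow_of_nonneg _ _ hP1.le, mul_left_comm]
        congr 1
        · rw [← ENNReal.ofReal_rpow_of_pos (by norm_num)]
          simp
        · nth_rw 1 [← ENNReal.rpow_one (g x)]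
          rw [← ENNReal.rpow_add_of_nonneg _ _ zero_le_one hP1.le]
          congr 1
          ring

theorem exists_lt_one_subset_ball {K : Set ℂ} (hK : IsCompact K) (hKD : K ⊆ ball 0 1) :
    ∃ r : ℝ, 0 < r ∧ r < 1 ∧ K ⊆ ball 0 r := by
  rcases K.eq_empty_or_nonempty with rfl | hne
  · exact ⟨1 / 2, by norm_num, by norm_num, empty_subset _⟩
  obtain ⟨x, hx, hmax⟩ := hK.exists_isMaxOn hne continuous_norm.continuousOn
  have hx1 : ‖x‖ < 1 := by simpa using hKD hx
  refine ⟨(1 + ‖x‖) / 2, by positivity, by linarith, fun y hy => ?_⟩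
  have : ‖y‖ ≤ ‖x‖ := hmax hy
  rw [mem_ball_zero_iff]
  linarith

theorem exists_smooth_extension {F : Type*} [NormedAddCommGroup F] [NormedSpace ℝ F] {f : ℂ → F}
    (hf : ContDiffOn ℝ (⊤ : ℕ∞) f (ball 0 1)) {r : ℝ} (hr0 : 0 < r) (hr1 : r < 1) :
    ∃ g : ℂ → F, ContDiff ℝ (⊤ : ℕ∞) g ∧ HasCompactSupport g ∧ EqOn g f (ball 0 r) := by
  let χ : ContDiffBump (0 : ℂ) := ⟨r, (1 + r) / 2, hr0, by linarith⟩
  have hsupp : tsupport χ ⊆ ball 0 1 := by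
    rw [χ.tsupport_eq]
    exact closedBall_subset_ball (show (1 + r) / 2 < 1 by linarith)
  refine ⟨fun x => χ x • f x, ?_, χ.hasCompactSupport.smul_right, fun x hx => ?_⟩
  · rw [contDiff_iff_contDiffAt]
    intro x
    by_cases hx : x ∈ tsupport χ
    · exact χ.contDiff.contDiffAt.smul (hf.contDiffAt (isOpen_ball.mem_nhds (hsupp hx)))
    · refine (contDiffAt_const (c := (0 : F))).congr_of_eventuallyEq ?_
      filter_upwards [(isClosed_tsupport χ).isOpen_compl.mem_nhds hx] with y hy
      simp [image_eq_zero_of_notMem_tsupport hy]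
  · simp only [χ.one_of_mem_closedBall (ball_subset_closedBall hx), one_smul]

/-- The Jacobian determinant of the pair `(a, b)`. -/
def jac (a b : ℂ → ℝ) (z : ℂ) : ℝ :=
  fderiv ℝ a z 1 * fderiv ℝ b z Complex.I - fderiv ℝ a z Complex.I * fderiv ℝ b z 1

theorem norm_jac_le (a b : ℂ → ℝ) (z : ℂ) :
    ‖jac a b z‖ ≤ 2 * (‖fderiv ℝ a z‖ * ‖fderiv ℝ b z‖) := by
  have h1 (g : ℂ → ℝ) : ‖fderiv ℝ g z 1‖ ≤ ‖fderiv ℝ g z‖ := by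
    simpa using (fderiv ℝ g z).le_opNorm 1
  have h2 (g : ℂ → ℝ) : ‖fderiv ℝ g z Complex.I‖ ≤ ‖fderiv ℝ g z‖ := by
    simpa using (fderiv ℝ g z).le_opNorm Complex.I
  calc ‖jac a b z‖ ≤ ‖fderiv ℝ a z 1 * fderiv ℝ b z Complex.I‖
        + ‖fderiv ℝ a z Complex.I * fderiv ℝ b z 1‖ := norm_sub_le _ _
    _ ≤ ‖fderiv ℝ a z‖ * ‖fderiv ℝ b z‖ + ‖fderiv ℝ a z‖ * ‖fderiv ℝ b z‖ := by
        rw [norm_mul, norm_mul]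
        gcongr <;> first | exact h1 _ | exact h2 _
    _ = _ := by ring

theorem contDiff_fderiv_apply {F : Type*} [NormedAddCommGroup F] [NormedSpace ℝ F] {f : ℂ → F}
    (hf : ContDiff ℝ (⊤ : ℕ∞) f) (v : ℂ) : ContDiff ℝ (⊤ : ℕ∞) fun z => fderiv ℝ f z v :=
  (hf.fderiv_right (m := (⊤ : ℕ∞)) (by simp)).clm_apply contDiff_const

theorem fderiv_fderiv_apply_comm {F : Type*} [NormedAddCommGroup F] [NormedSpace ℝ F] {f : ℂ → F}
    {z : ℂ} (hf : ContDiffAt ℝ (⊤ : ℕ∞) f z) (v w : ℂ) :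
    fderiv ℝ (fun z => fderiv ℝ f z v) z w = fderiv ℝ (fun z => fderiv ℝ f z w) z v := by
  have hd : DifferentiableAt ℝ (fderiv ℝ f) z :=
    (hf.fderiv_right (m := (⊤ : ℕ∞)) (by simp)).differentiableAt (by simp)
  have hs : IsSymmSndFDerivAt ℝ f z :=
    hf.isSymmSndFDerivAt (by simpa using WithTop.coe_le_coe.2 (le_top (a := (2 : ℕ∞))))
  rw [fderiv_clm_apply hd (differentiableAt_const v),
    fderiv_clm_apply hd (differentiableAt_const w)]
  simpa using hs.eq w v

/-- Integration by parts for the Jacobian against a Lipschitz test function. -/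
theorem integral_mul_jac_of_compactSupport {Ψ : ℂ → ℝ} {L : ℝ≥0} (hΨ : LipschitzWith L Ψ)
    {a b : ℂ → ℝ} (ha : ContDiff ℝ (⊤ : ℕ∞) a) (ha' : HasCompactSupport a)
    (hb : ContDiff ℝ (⊤ : ℕ∞) b) :
    ∫ z, Ψ z * jac a b z = ∫ z, a z *
      (lineDeriv ℝ Ψ z Complex.I * fderiv ℝ b z 1 -
        lineDeriv ℝ Ψ z 1 * fderiv ℝ b z Complex.I) := by
  have hdb (v : ℂ) := contDiff_fderiv_apply hb v
  have hda (v : ℂ) := contDiff_fderiv_apply ha v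
  have hg (v : ℂ) : ContDiff ℝ (⊤ : ℕ∞) fun z => a z * fderiv ℝ b z v := ha.mul (hdb v)
  have hgc (v : ℂ) : HasCompactSupport fun z => a z * fderiv ℝ b z v := ha'.mul_right
  have key (v w : ℂ) : ∫ z, lineDeriv ℝ Ψ z v * (a z * fderiv ℝ b z w) =
      - ∫ z, Ψ z * fderiv ℝ (fun z => a z * fderiv ℝ b z w) z v := by
    obtain ⟨M, hM⟩ := (hg w).lipschitzWith_of_hasCompactSupport (hgc w) (by simp)
    rw [hΨ.integral_lineDeriv_mul_eq hM (hgc w) v, ← integral_neg]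
    congr 1 with z
    rw [((hg w).differentiable (by simp) z).lineDeriv_eq_fderiv, map_neg]
    ring
  have hprod (v w z : ℂ) : fderiv ℝ (fun z => a z * fderiv ℝ b z w) z v =
      fderiv ℝ a z v * fderiv ℝ b z w + a z * fderiv ℝ (fun z => fderiv ℝ b z w) z v := by
    rw [fderiv_fun_mul (ha.differentiable (by simp) z) ((hdb w).differentiable (by simp) z)]
    simp
    ring
  have hinteg (v w : ℂ) : Integrable fun z => Ψ z * fderiv ℝ (fun z => a z * fderiv ℝ b z w) z v :=
    (hΨ.continuous.mul (contDiff_fderiv_apply (hg w) v).continuous).integrable_of_hasCompactSupport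
      (((hgc w).fderiv_apply ℝ v).mul_left)
  have hinteg2 (v w : ℂ) : Integrable fun z => lineDeriv ℝ Ψ z v * (a z * fderiv ℝ b z w) := by
    have hi := (hg w).continuous.integrable_of_hasCompactSupport (μ := volume) (hgc w)
    refine hi.bdd_mul (c := L * ‖v‖) (aestronglyMeasurable_lineDeriv hΨ.continuous volume) ?_
    exact Eventually.of_forall fun z => norm_lineDeriv_le_of_lipschitz ℝ hΨ
  have h1 : ∀ z, Ψ z * jac a b z = Ψ z * fderiv ℝ (fun z => a z * fderiv ℝ b z Complex.I) z 1 -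
      Ψ z * fderiv ℝ (fun z => a z * fderiv ℝ b z 1) z Complex.I := by
    intro z
    rw [hprod, hprod, fderiv_fderiv_apply_comm hb.contDiffAt 1 Complex.I, jac]
    ring
  simp_rw [h1]
  rw [integral_sub (hinteg _ _) (hinteg _ _)]
  have h2 : ∀ z, a z * (lineDeriv ℝ Ψ z Complex.I * fderiv ℝ b z 1 -
      lineDeriv ℝ Ψ z 1 * fderiv ℝ b z Complex.I) =
      lineDeriv ℝ Ψ z Complex.I * (a z * fderiv ℝ b z 1) -
        lineDeriv ℝ Ψ z 1 * (a z * fderiv ℝ b z Complex.I) := fun z => by ring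
  simp_rw [h2]
  rw [integral_sub (hinteg2 _ _) (hinteg2 _ _), key, key]
  ring

theorem lineDeriv_eq_zero_of_notMem_tsupport {Ψ : ℂ → ℝ} {z : ℂ} (hz : z ∉ tsupport Ψ) (v : ℂ) :
    lineDeriv ℝ Ψ z v = 0 := by
  have h : Ψ =ᶠ[𝓝 z] fun _ => (0 : ℝ) := by
    filter_upwards [(isClosed_tsupport Ψ).isOpen_compl.mem_nhds hz] with y hy
    exact image_eq_zero_of_notMem_tsupport hy
  rw [h.lineDeriv_eq]
  simp [lineDeriv]

theorem enorm_integral_mul_jac_le {Ψ : ℂ → ℝ} {L : ℝ≥0} (hΨ : LipschitzWith L Ψ)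
    {a b : ℂ → ℝ} (ha : ContDiffOn ℝ (⊤ : ℕ∞) a (ball 0 1))
    (hb : ContDiffOn ℝ (⊤ : ℕ∞) b (ball 0 1)) (hK : HasCompactSupport Ψ)
    (hKD : tsupport Ψ ⊆ ball 0 1) (c : ℝ) :
    ‖∫ z, Ψ z * jac a b z‖ₑ ≤ 2 * L * ∫⁻ z in tsupport Ψ, ‖a z - c‖ₑ * ‖fderiv ℝ b z‖ₑ := by
  obtain ⟨r, hr0, hr1, hr⟩ := exists_lt_one_subset_ball hK hKD
  obtain ⟨a', ha', hac, hae⟩ := exists_smooth_extension (ha.sub (contDiffOn_const (c := c))) hr0 hr1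
  obtain ⟨b', hb', -, hbe⟩ := exists_smooth_extension hb hr0 hr1
  have hnh {z : ℂ} (hz : z ∈ tsupport Ψ) : ball (0 : ℂ) r ∈ 𝓝 z := isOpen_ball.mem_nhds (hr hz)
  have hbz {z : ℂ} (hz : z ∈ tsupport Ψ) : fderiv ℝ b' z = fderiv ℝ b z :=
    Filter.EventuallyEq.fderiv_eq (hbe.eventuallyEq_of_mem (hnh hz))
  have haz {z : ℂ} (hz : z ∈ tsupport Ψ) : fderiv ℝ a' z = fderiv ℝ a z := by
    rw [Filter.EventuallyEq.fderiv_eq (hae.eventuallyEq_of_mem (hnh hz)), fderiv_sub_const]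
  have h1 : ∫ z, Ψ z * jac a b z = ∫ z, Ψ z * jac a' b' z := by
    congr 1 with z
    by_cases hz : z ∈ tsupport Ψ
    · rw [jac, jac, haz hz, hbz hz]
    · simp [image_eq_zero_of_notMem_tsupport hz]
  rw [h1, integral_mul_jac_of_compactSupport hΨ ha' hac hb']
  have hsupp : Function.support (fun z => a' z * (lineDeriv ℝ Ψ z Complex.I * fderiv ℝ b' z 1 -
      lineDeriv ℝ Ψ z 1 * fderiv ℝ b' z Complex.I)) ⊆ tsupport Ψ := by
    intro z hz
    by_contra h
    exact hz (by simp [lineDeriv_eq_zero_of_notMem_tsupport h])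
  rw [← setIntegral_eq_integral_of_forall_compl_eq_zero
    (fun z hz => Function.notMem_support.1 fun h => hz (hsupp h))]
  refine (enorm_integral_le_lintegral_enorm _).trans ?_
  rw [← lintegral_const_mul' _ _ (by finiteness)]
  refine setLIntegral_mono' (isClosed_tsupport Ψ).measurableSet fun z hz => ?_
  have e1 (w : ℂ) (hw : ‖w‖ = 1) : ‖lineDeriv ℝ Ψ z w‖ ≤ L := by
    simpa [hw] using norm_lineDeriv_le_of_lipschitz ℝ hΨ (x₀ := z) (v := w)
  have e2 (w : ℂ) (hw : ‖w‖ = 1) : ‖fderiv ℝ b' z w‖ ≤ ‖fderiv ℝ b z‖ := by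
    rw [hbz hz]; simpa [hw] using (fderiv ℝ b z).le_opNorm w
  have e3 : ‖a' z * (lineDeriv ℝ Ψ z Complex.I * fderiv ℝ b' z 1 -
      lineDeriv ℝ Ψ z 1 * fderiv ℝ b' z Complex.I)‖ ≤ 2 * L * (‖a z - c‖ * ‖fderiv ℝ b z‖) := by
    rw [norm_mul, hae (hr hz)]
    calc _ ≤ ‖a z - c‖ * (L * ‖fderiv ℝ b z‖ + L * ‖fderiv ℝ b z‖) := by
          gcongr
          refine (norm_sub_le _ _).trans ?_
          rw [norm_mul, norm_mul]
          gcongr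
          · exact e1 _ (by simp)
          · exact e2 _ (by simp)
          · exact e1 _ (by simp)
          · exact e2 _ (by simp)
      _ = _ := by ring
  calc _ = ENNReal.ofReal _ := (ofReal_norm _).symm
    _ ≤ ENNReal.ofReal (2 * L * (‖a z - c‖ * ‖fderiv ℝ b z‖)) := ENNReal.ofReal_le_ofReal e3
    _ = _ := by
        rw [ENNReal.ofReal_mul (by positivity), ENNReal.ofReal_mul (by positivity),
          ENNReal.ofReal_mul (by positivity), ofReal_norm, ofReal_norm]
        simp

theorem lintegral_comp_add_smul {G : ℂ → ℝ≥0∞} (hG : Measurable G) (w : ℂ) {t : ℝ} (ht : t ≠ 0) :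
    ∫⁻ y, G (w + t • y) = ENNReal.ofReal |(t ^ 2)⁻¹| * ∫⁻ y, G y := by
  have h := Measure.map_addHaar_smul (volume : Measure ℂ) ht
  rw [Complex.finrank_real_complex] at h
  calc ∫⁻ y, G (w + t • y) = ∫⁻ u, G (w + u) ∂(Measure.map (t • ·) (volume : Measure ℂ)) := by
        rw [lintegral_map (by fun_prop) (by fun_prop)]
    _ = _ := by rw [h, lintegral_smul_measure, lintegral_add_left_eq_self, smul_eq_mul]

theorem setLIntegral_comp_segment_le {S : Set ℂ} (hS : Convex ℝ S) (hSm : MeasurableSet S)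
    {g : ℂ → ℝ≥0∞} (hg : Measurable g) {x : ℂ} (hx : x ∈ S) {t : ℝ} (ht : t ∈ Ioc (0 : ℝ) 1) :
    ∫⁻ y in S, g (x + t • (y - x)) ≤ ENNReal.ofReal (t ^ 2)⁻¹ * ∫⁻ y in S, g y := by
  have h := lintegral_comp_add_smul (hg.indicator hSm) (x - t • x) ht.1.ne'
  rw [lintegral_indicator hSm, abs_of_nonneg (by positivity)] at h
  rw [← h]
  refine (setLIntegral_mono' hSm fun y hy => ?_).trans
    (lintegral_mono' (Measure.restrict_le_self (s := S)) le_rfl)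
  have e : x + t • (y - x) = x - t • x + t • y := by rw [smul_sub]; ring
  have hmem : x + t • (y - x) ∈ S := hS.add_smul_sub_mem hx hy ⟨ht.1.le, ht.2⟩
  rw [← e, indicator_of_mem hmem]

/-- Hölder bound for the double integral of `A` along a segment against `B`. -/
theorem lintegral_segment_le {S : Set ℂ} (hS : Convex ℝ S) (hSm : MeasurableSet S)
    {A B : ℂ → ℝ≥0∞} (hA : Measurable A) (hB : Measurable B) {s σ θ : ℝ}
    (hs : 0 < s) (hσ : 0 < σ) (hθ : 0 ≤ θ) (hsum : 1 / s + 1 / σ = 1 + θ) (hθs : θ ≤ 1 / s)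
    (hθσ : θ ≤ 1 / σ) {t : ℝ} (ht : t ∈ Ioo (0 : ℝ) 1) :
    ∫⁻ x in S, ∫⁻ y in S, A (x + t • (y - x)) * B x ≤
      ENNReal.ofReal (4 * t ^ (-(2 * θ))) * (volume S ^ (1 - θ) *
        ((∫⁻ y in S, A y ^ s) ^ (1 / s) * (∫⁻ y in S, B y ^ σ) ^ (1 / σ))) := by
  set IA := ∫⁻ y in S, A y ^ s with hIA
  set IB := ∫⁻ y in S, B y ^ σ with hIB
  set μ := (volume.restrict S : Measure ℂ) with hμ
  have hAs : Measurable fun y => A y ^ s := by fun_prop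
  have hBs : Measurable fun y => B y ^ σ := by fun_prop
  have hseg : Measurable fun z : ℂ × ℂ => z.1 + t • (z.2 - z.1) := by fun_prop
  have m2 : Measurable fun z : ℂ × ℂ => A (z.1 + t • (z.2 - z.1)) ^ s := hAs.comp hseg
  have m3 : Measurable fun z : ℂ × ℂ => B z.1 ^ σ := hBs.comp measurable_fst
  have m1 : Measurable fun z : ℂ × ℂ => A (z.1 + t • (z.2 - z.1)) ^ s * B z.1 ^ σ := m2.mul m3
  have h1 : ∫⁻ z, A (z.1 + t • (z.2 - z.1)) ^ s * B z.1 ^ σ ∂(μ.prod μ) ≤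
      ENNReal.ofReal (t ^ 2)⁻¹ * (IA * IB) := by
    rw [lintegral_prod _ m1.aemeasurable]
    calc _ ≤ ∫⁻ x in S, (ENNReal.ofReal (t ^ 2)⁻¹ * IA) * B x ^ σ := by
          refine setLIntegral_mono' hSm fun x hx => ?_
          simp only
          rw [lintegral_mul_const _ (by fun_prop)]
          gcongr
          exact setLIntegral_comp_segment_le hS hSm hAs hx ⟨ht.1, ht.2.le⟩
      _ = _ := by rw [lintegral_const_mul _ hBs, mul_assoc]
  have h2 : ∫⁻ z, A (z.1 + t • (z.2 - z.1)) ^ s ∂(μ.prod μ) ≤ 4 * (volume S * IA) := by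
    have hloc : ∀ {τ : ℝ}, 1 / 2 ≤ τ → ENNReal.ofReal (τ ^ 2)⁻¹ ≤ 4 := by
      intro τ hτ
      rw [show (4 : ℝ≥0∞) = ENNReal.ofReal 4 by simp]
      refine ENNReal.ofReal_le_ofReal ?_
      rw [inv_le_comm₀ (by positivity) (by norm_num)]
      nlinarith
    rcases le_total (1 / 2) t with h | h
    · rw [lintegral_prod _ m2.aemeasurable]
      calc _ ≤ ∫⁻ x in S, (4 * IA) := by
            refine setLIntegral_mono' hSm fun x hx => ?_
            refine (setLIntegral_comp_segment_le hS hSm hAs hx ⟨ht.1, ht.2.le⟩).trans ?_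
            gcongr
            exact hloc h
        _ = _ := by rw [lintegral_const, Measure.restrict_apply_univ]; ring
    · rw [lintegral_prod_symm _ m2.aemeasurable]
      calc _ ≤ ∫⁻ x in S, (4 * IA) := by
            refine setLIntegral_mono' hSm fun x hx => ?_
            have := setLIntegral_comp_segment_le hS hSm hAs hx (t := 1 - t)
              ⟨by linarith [ht.2], by linarith [ht.1]⟩
            refine le_trans (le_of_eq ?_) (this.trans (by gcongr; exact hloc (by linarith)))
            refine lintegral_congr fun y => ?_
            congr 2
            simp only [Complex.real_smul]
            push_cast
            ring
        _ = _ := by rw [lintegral_const, Measure.restrict_apply_univ]; ring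
  have h3 : ∫⁻ z, B z.1 ^ σ ∂(μ.prod μ) = volume S * IB := by
    rw [lintegral_prod _ m3.aemeasurable]
    simp only [lintegral_const, hμ, Measure.restrict_apply_univ]
    rw [lintegral_mul_const _ hBs, mul_comm]
  have hhold := ENNReal.lintegral_prod_norm_pow_le (μ := μ.prod μ) (Finset.univ : Finset (Fin 3))
    (f := ![fun z => A (z.1 + t • (z.2 - z.1)) ^ s * B z.1 ^ σ,
      fun z => A (z.1 + t • (z.2 - z.1)) ^ s, fun z => B z.1 ^ σ])
    (p := ![θ, 1 / s - θ, 1 / σ - θ])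
    (by
      intro i _
      fin_cases i
      · exact m1.aemeasurable
      · exact m2.aemeasurable
      · exact m3.aemeasurable)
    (by simp [Fin.sum_univ_three]; linarith [hsum, one_div s, one_div σ])
    (by
      intro i _
      fin_cases i
      · exact hθ
      · exact sub_nonneg.2 hθs
      · exact sub_nonneg.2 hθσ)
  simp only [Fin.prod_univ_three, Matrix.cons_val_zero, Matrix.cons_val_one, Matrix.cons_val_two,
    Matrix.tail_cons, Matrix.head_cons] at hhold
  have hpt : ∀ z : ℂ × ℂ, A (z.1 + t • (z.2 - z.1)) * B z.1 =
      (A (z.1 + t • (z.2 - z.1)) ^ s * B z.1 ^ σ) ^ θ *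
        (A (z.1 + t • (z.2 - z.1)) ^ s) ^ (1 / s - θ) * (B z.1 ^ σ) ^ (1 / σ - θ) := by
    intro z
    have e (X : ℝ≥0∞) {r : ℝ} (hr : 0 < r) (hθr : θ ≤ 1 / r) :
        (X ^ r) ^ θ * (X ^ r) ^ (1 / r - θ) = X := by
      rw [← ENNReal.rpow_add_of_nonneg _ _ hθ (sub_nonneg.2 hθr), add_sub_cancel,
        ← ENNReal.rpow_mul, mul_one_div_cancel hr.ne', ENNReal.rpow_one]
    rw [ENNReal.mul_rpow_of_nonneg _ _ hθ]
    conv_lhs => rw [← e (A (z.1 + t • (z.2 - z.1))) hs hθs, ← e (B z.1) hσ hθσ]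
    ring
  calc ∫⁻ x in S, ∫⁻ y in S, A (x + t • (y - x)) * B x
      = ∫⁻ z, A (z.1 + t • (z.2 - z.1)) * B z.1 ∂(μ.prod μ) := by
        rw [lintegral_prod]
        exact ((hA.comp hseg).mul (hB.comp measurable_fst)).aemeasurable
    _ ≤ (ENNReal.ofReal (t ^ 2)⁻¹ * (IA * IB)) ^ θ * (4 * (volume S * IA)) ^ (1 / s - θ) *
          (volume S * IB) ^ (1 / σ - θ) := by
        simp_rw [hpt]
        refine hhold.trans ?_
        rw [h3]
        gcongr
    _ = (ENNReal.ofReal (t ^ (-(2 * θ))) * 4 ^ (1 / s - θ)) * (volume S ^ (1 - θ) *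
          (IA ^ (1 / s) * IB ^ (1 / σ))) := by
        have e1 : 0 ≤ 1 / s - θ := sub_nonneg.2 hθs
        have e2 : 0 ≤ 1 / σ - θ := sub_nonneg.2 hθσ
        have ea : IA ^ (1 / s) = IA ^ θ * IA ^ (1 / s - θ) := by
          rw [← ENNReal.rpow_add_of_nonneg _ _ hθ e1, add_sub_cancel]
        have eb : IB ^ (1 / σ) = IB ^ θ * IB ^ (1 / σ - θ) := by
          rw [← ENNReal.rpow_add_of_nonneg _ _ hθ e2, add_sub_cancel]
        have ev : volume S ^ (1 - θ) = volume S ^ (1 / s - θ) * volume S ^ (1 / σ - θ) := by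
          rw [← ENNReal.rpow_add_of_nonneg _ _ e1 e2]
          congr 1
          linarith
        have et : ENNReal.ofReal (t ^ (-(2 * θ))) = ENNReal.ofReal (t ^ 2)⁻¹ ^ θ := by
          have := ht.1
          rw [ENNReal.ofReal_rpow_of_pos (by positivity), Real.inv_rpow (by positivity),
            Real.rpow_neg this.le, Real.rpow_mul this.le]
          norm_num
        rw [ea, eb, ev, et, ENNReal.mul_rpow_of_nonneg _ _ hθ, ENNReal.mul_rpow_of_nonneg _ _ hθ,
          ENNReal.mul_rpow_of_nonneg _ _ e1, ENNReal.mul_rpow_of_nonneg _ _ e1,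
          ENNReal.mul_rpow_of_nonneg _ _ e2]
        ring
    _ ≤ _ := by
        gcongr
        rw [mul_comm 4, ENNReal.ofReal_mul (by have := ht.1; positivity)]
        gcongr
        calc (4 : ℝ≥0∞) ^ (1 / s - θ) ≤ 4 ^ (1 : ℝ) :=
              ENNReal.rpow_le_rpow_of_exponent_le (by norm_num) (by linarith)
          _ = _ := by simp

/-- Joint maximal function of two densities over balls of radius at most `6`. -/
def bimax (s σ : ℝ) (A B : ℂ → ℝ≥0∞) (x : ℂ) : ℝ≥0∞ :=
  ⨆ (c : ℂ) (ρ : ℝ) (_ : 0 < ρ ∧ ρ ≤ 6 ∧ x ∈ ball c ρ),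
    ((volume (ball c ρ))⁻¹ * ∫⁻ y in ball c ρ, A y ^ s) ^ (1 / s) *
      ((volume (ball c ρ))⁻¹ * ∫⁻ y in ball c ρ, B y ^ σ) ^ (1 / σ)

theorem lt_bimax_iff {s σ : ℝ} {A B : ℂ → ℝ≥0∞} {x : ℂ} {m : ℝ≥0∞} :
    m < bimax s σ A B x ↔ ∃ (c : ℂ) (ρ : ℝ), (0 < ρ ∧ ρ ≤ 6 ∧ x ∈ ball c ρ) ∧
      m < ((volume (ball c ρ))⁻¹ * ∫⁻ y in ball c ρ, A y ^ s) ^ (1 / s) *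
      ((volume (ball c ρ))⁻¹ * ∫⁻ y in ball c ρ, B y ^ σ) ^ (1 / σ) := by
  simp only [bimax, lt_iSup_iff, exists_prop]

theorem isOpen_lt_bimax (s σ : ℝ) (A B : ℂ → ℝ≥0∞) (m : ℝ≥0∞) :
    IsOpen {x | m < bimax s σ A B x} := by
  rw [isOpen_iff_mem_nhds]
  intro x hx
  obtain ⟨c, ρ, ⟨h0, hR, hx⟩, h⟩ := lt_bimax_iff.1 hx
  filter_upwards [isOpen_ball.mem_nhds hx] with y hy
  exact lt_bimax_iff.2 ⟨c, ρ, ⟨h0, hR, hy⟩, h⟩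

theorem bimax_le_maxFn {s σ : ℝ} (hs : 0 < s) (hσ : 0 < σ) (A B : ℂ → ℝ≥0∞) (x : ℂ) :
    bimax s σ A B x ≤
      maxFn 6 (fun y => A y ^ s) x ^ (1 / s) * maxFn 6 (fun y => B y ^ σ) x ^ (1 / σ) := by
  refine iSup_le fun c => iSup_le fun ρ => iSup_le fun h => ?_
  gcongr <;> exact le_iSup_of_le c (le_iSup_of_le ρ (le_iSup_of_le h le_rfl))

/-- The extension by zero of the size of the gradient from the unit disk. -/
def gradAbs (a : ℂ → ℝ) : ℂ → ℝ≥0∞ := (ball (0 : ℂ) 1).indicator fun z => ‖fderiv ℝ a z‖ₑ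

theorem measurable_gradAbs (a : ℂ → ℝ) : Measurable (gradAbs a) :=
  (measurable_fderiv ℝ a).enorm.indicator measurableSet_ball

theorem gradAbs_of_mem {a : ℂ → ℝ} {z : ℂ} (hz : z ∈ ball (0 : ℂ) 1) :
    gradAbs a z = ‖fderiv ℝ a z‖ₑ := indicator_of_mem hz _

theorem enorm_sub_le_segment {a : ℂ → ℝ} (ha : ContDiffOn ℝ (⊤ : ℕ∞) a (ball 0 1)) {x y : ℂ}
    (hx : x ∈ ball (0 : ℂ) 1) (hy : y ∈ ball (0 : ℂ) 1) :
    ‖a x - a y‖ₑ ≤ ‖y - x‖ₑ * ∫⁻ t in Ioo (0 : ℝ) 1, gradAbs a (x + t • (y - x)) := by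
  have hmem : ∀ t ∈ Icc (0 : ℝ) 1, x + t • (y - x) ∈ ball (0 : ℂ) 1 := fun t ht =>
    (convex_ball (0 : ℂ) 1).add_smul_sub_mem hx hy ht
  have hline : ∀ t : ℝ, HasDerivAt (fun t : ℝ => x + t • (y - x)) (y - x) t := fun t => by
    simpa using ((hasDerivAt_id t).smul_const (y - x)).const_add x
  have hder : ∀ t ∈ uIcc (0 : ℝ) 1, HasDerivAt (fun t : ℝ => a (x + t • (y - x)))
      (fderiv ℝ a (x + t • (y - x)) (y - x)) t := by
    intro t ht
    rw [uIcc_of_le zero_le_one] at ht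
    have h1 : DifferentiableAt ℝ a (x + t • (y - x)) :=
      (ha.contDiffAt (isOpen_ball.mem_nhds (hmem t ht))).differentiableAt (by simp)
    exact h1.hasFDerivAt.comp_hasDerivAt t (hline t)
  have hcont : ContinuousOn (fun t : ℝ => fderiv ℝ a (x + t • (y - x)) (y - x)) (uIcc 0 1) := by
    rw [uIcc_of_le zero_le_one]
    refine ContinuousOn.clm_apply ?_ continuousOn_const
    exact (ha.continuousOn_fderiv_of_isOpen isOpen_ball (by simp)).comp
      (Continuous.continuousOn (by fun_prop)) hmem
  have hftc := intervalIntegral.integral_eq_sub_of_hasDerivAt hder hcont.intervalIntegrable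
  simp only [one_smul, zero_smul, add_zero, add_sub_cancel] at hftc
  rw [← enorm_neg, neg_sub, ← hftc, intervalIntegral.integral_of_le zero_le_one]
  refine (enorm_integral_le_lintegral_enorm _).trans ?_
  rw [setLIntegral_congr Ioo_ae_eq_Ioc.symm, ← lintegral_const_mul' _ _ (by finiteness)]
  refine setLIntegral_mono' measurableSet_Ioo fun t ht => ?_
  rw [gradAbs_of_mem (hmem t (Ioo_subset_Icc_self ht)), mul_comm]
  exact (fderiv ℝ a (x + t • (y - x))).le_opENorm (y - x)


theorem volume_ball_le_inter {x₀ : ℂ} (hx₀ : x₀ ∈ ball (0 : ℂ) 1) {ρ : ℝ} (hρ : 0 < ρ)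
    (hρ6 : ρ ≤ 6) : volume (ball x₀ ρ) ≤ 144 * volume (ball x₀ ρ ∩ ball 0 1) := by
  have hx : ‖x₀‖ < 1 := by simpa using hx₀
  set τ := ρ / 12 with hτ
  have hτ0 : 0 < τ := by positivity
  have hsub : ball ((1 - τ) • x₀) τ ⊆ ball x₀ ρ ∩ ball 0 1 := by
    intro z hz
    rw [mem_ball, dist_eq_norm] at hz
    constructor
    · rw [mem_ball, dist_eq_norm]
      have h1 : ‖(1 - τ) • x₀ - x₀‖ ≤ τ := by
        rw [show (1 - τ) • x₀ - x₀ = -(τ • x₀) by rw [sub_smul, one_smul]; ring, norm_neg,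
          norm_smul, Real.norm_of_nonneg hτ0.le]
        nlinarith
      calc ‖z - x₀‖ = ‖(z - (1 - τ) • x₀) + ((1 - τ) • x₀ - x₀)‖ := by congr 1; ring
        _ ≤ ‖z - (1 - τ) • x₀‖ + ‖(1 - τ) • x₀ - x₀‖ := norm_add_le _ _
        _ < ρ := by linarith
    · rw [mem_ball_zero_iff]
      have h1 : ‖(1 - τ) • x₀‖ ≤ 1 - τ := by
        rw [norm_smul, Real.norm_of_nonneg (by linarith)]
        nlinarith
      calc ‖z‖ = ‖(z - (1 - τ) • x₀) + ((1 - τ) • x₀)‖ := by congr 1; ring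
        _ ≤ ‖z - (1 - τ) • x₀‖ + ‖(1 - τ) • x₀‖ := norm_add_le _ _
        _ < 1 := by linarith
  calc volume (ball x₀ ρ) = 144 * volume (ball ((1 - τ) • x₀) τ) := by
        rw [volume_ball_complex, volume_ball_complex, show ρ = 12 * τ by rw [hτ]; ring,
          ENNReal.ofReal_mul (by norm_num), mul_pow, mul_assoc]
        congr 1
        norm_num
    _ ≤ _ := by gcongr

theorem lintegral_Ioo_rpow {θ : ℝ} (hθ : θ < 1 / 2) :
    ∫⁻ t in Ioo (0 : ℝ) 1, ENNReal.ofReal (4 * t ^ (-(2 * θ))) =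
      ENNReal.ofReal (4 / (1 - 2 * θ)) := by
  have hinteg : IntervalIntegrable (fun t : ℝ => 4 * t ^ (-(2 * θ))) volume 0 1 :=
    (intervalIntegral.intervalIntegrable_rpow' (by linarith)).const_mul 4
  rw [intervalIntegrable_iff_integrableOn_Ioc_of_le zero_le_one] at hinteg
  rw [setLIntegral_congr Ioo_ae_eq_Ioc, ← ofReal_integral_eq_lintegral_ofReal hinteg,
    ← intervalIntegral.integral_of_le zero_le_one]
  · congr 1
    rw [intervalIntegral.integral_const_mul, integral_rpow (Or.inl (by linarith)), Real.one_rpow,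
      Real.zero_rpow (by linarith), show -(2 * θ) + 1 = 1 - 2 * θ by ring]
    ring
  · filter_upwards [ae_restrict_mem measurableSet_Ioc] with t ht
    have := ht.1.le
    simp only [Pi.zero_apply]
    positivity

/-- The div-curl estimate against a compactly supported Lipschitz test function. -/
theorem enorm_integral_mul_jac_le_bimax {s σ θ : ℝ} (hs : 0 < s) (hσ : 0 < σ) (hθ : 0 ≤ θ)
    (hsum : 1 / s + 1 / σ = 1 + θ) (hθs : θ ≤ 1 / s) (hθσ : θ ≤ 1 / σ) (hθ2 : θ < 1 / 2)
    {a b : ℂ → ℝ} (ha : ContDiffOn ℝ (⊤ : ℕ∞) a (ball 0 1))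
    (hb : ContDiffOn ℝ (⊤ : ℕ∞) b (ball 0 1)) {x₀ : ℂ} (hx₀ : x₀ ∈ ball (0 : ℂ) 1) {ρ : ℝ}
    (hρ : 0 < ρ) (hρ6 : ρ ≤ 6) {Ψ : ℂ → ℝ} {L : ℝ≥0} (hΨ : LipschitzWith L Ψ)
    (hK : HasCompactSupport Ψ) (hKS : tsupport Ψ ⊆ ball x₀ ρ ∩ ball 0 1) :
    ‖∫ z, Ψ z * jac a b z‖ₑ ≤ 48 * NNReal.pi * ENNReal.ofReal (4 / (1 - 2 * θ)) * L *
      ENNReal.ofReal ρ ^ 3 * bimax s σ (gradAbs a) (gradAbs b) x₀ := by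
  set S := ball x₀ ρ ∩ ball (0 : ℂ) 1 with hSdef
  set A := gradAbs a
  set B := gradAbs b
  set F := bimax s σ A B x₀ with hF
  set V := volume (ball x₀ ρ) with hV
  set I := ‖∫ z, Ψ z * jac a b z‖ₑ with hI
  have hA : Measurable A := measurable_gradAbs a
  have hB : Measurable B := measurable_gradAbs b
  have hSm : MeasurableSet S := measurableSet_ball.inter measurableSet_ball
  have hSc : Convex ℝ S := (convex_ball _ _).inter (convex_ball _ _)
  have hVf : V ≠ ∞ := measure_ball_lt_top.ne
  have hV0 : V ≠ 0 := (measure_ball_pos _ _ hρ).ne'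
  have hSV : volume S ≤ V := measure_mono inter_subset_left
  have hVS : V ≤ 144 * volume S := volume_ball_le_inter hx₀ hρ hρ6
  have hSf : volume S ≠ ∞ := ne_top_of_le_ne_top hVf hSV
  have hS0 : volume S ≠ 0 := by
    intro h
    rw [h, mul_zero] at hVS
    exact hV0 (le_antisymm hVS zero_le)
  have hptw : ∀ y ∈ S, I ≤ 2 * L * ∫⁻ x in S, ‖a x - a y‖ₑ * B x := by
    intro y hy
    refine (enorm_integral_mul_jac_le hΨ ha hb hK (hKS.trans inter_subset_right) (a y)).trans ?_
    gcongr 2 * L * ?_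
    refine (lintegral_mono_set hKS).trans (setLIntegral_mono' hSm fun x hx => ?_)
    rw [show B x = ‖fderiv ℝ b x‖ₑ from gradAbs_of_mem hx.2]
  have hseg : ∀ x ∈ S, ∀ y ∈ S, ‖a x - a y‖ₑ * B x ≤
      ENNReal.ofReal (2 * ρ) * ∫⁻ t in Ioo (0 : ℝ) 1, A (x + t • (y - x)) * B x := by
    intro x hx y hy
    have hm : Measurable fun t : ℝ => A (x + t • (y - x)) := hA.comp (by fun_prop)
    rw [lintegral_mul_const _ hm, ← mul_assoc]
    gcongr
    refine (enorm_sub_le_segment ha hx.2 hy.2).trans ?_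
    gcongr
    rw [← ofReal_norm, ← dist_eq_norm]
    refine ENNReal.ofReal_le_ofReal ?_
    linarith [dist_triangle_right y x x₀, mem_ball.1 hx.1, mem_ball.1 hy.1]
  set M := volume S ^ (1 - θ) *
        ((∫⁻ y in S, A y ^ s) ^ (1 / s) * (∫⁻ y in S, B y ^ σ) ^ (1 / σ)) with hM
  set μ := (volume.restrict S : Measure ℂ) with hμ
  have hmeas3 : Measurable fun q : (ℂ × ℂ) × ℝ => A (q.1.1 + q.2 • (q.1.2 - q.1.1)) * B q.1.1 :=
    (hA.comp (by fun_prop)).mul (hB.comp (by fun_prop))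
  have hmain : I * volume S ≤ 2 * L * (ENNReal.ofReal (2 * ρ) *
      (ENNReal.ofReal (4 / (1 - 2 * θ)) * M)) := by
    calc I * volume S = ∫⁻ _ in S, I := by rw [lintegral_const, Measure.restrict_apply_univ]
      _ ≤ ∫⁻ y in S, 2 * L * ∫⁻ x in S, ENNReal.ofReal (2 * ρ) *
            ∫⁻ t in Ioo (0 : ℝ) 1, A (x + t • (y - x)) * B x := by
          refine setLIntegral_mono' hSm fun y hy => (hptw y hy).trans ?_
          gcongr 2 * L * ?_
          exact setLIntegral_mono' hSm fun x hx => hseg x hx y hy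
      _ = 2 * L * (ENNReal.ofReal (2 * ρ) * ∫⁻ y in S, ∫⁻ x in S,
            ∫⁻ t in Ioo (0 : ℝ) 1, A (x + t • (y - x)) * B x) := by
          simp_rw [lintegral_const_mul' (ENNReal.ofReal (2 * ρ)) _ ENNReal.ofReal_ne_top]
          rw [lintegral_const_mul' _ _ (by finiteness), lintegral_const_mul' _ _ (by finiteness)]
      _ = 2 * L * (ENNReal.ofReal (2 * ρ) * ∫⁻ t in Ioo (0 : ℝ) 1, ∫⁻ x in S, ∫⁻ y in S,
            A (x + t • (y - x)) * B x) := by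
          congr 2
          rw [← lintegral_prod_symm (μ := μ) (ν := μ) (fun q : ℂ × ℂ =>
            ∫⁻ t in Ioo (0 : ℝ) 1, A (q.1 + t • (q.2 - q.1)) * B q.1)
            (Measurable.lintegral_prod_right hmeas3).aemeasurable,
            lintegral_lintegral_swap hmeas3.aemeasurable]
          refine lintegral_congr fun t => ?_
          rw [lintegral_prod]
          exact (hmeas3.comp (measurable_id.prodMk measurable_const)).aemeasurable
      _ ≤ 2 * L * (ENNReal.ofReal (2 * ρ) *
            ∫⁻ t in Ioo (0 : ℝ) 1, ENNReal.ofReal (4 * t ^ (-(2 * θ))) * M) := by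
          gcongr 2 * L * (_ * ?_)
          exact setLIntegral_mono' measurableSet_Ioo fun t ht =>
            lintegral_segment_le hSc hSm hA hB hs hσ hθ hsum hθs hθσ ht
      _ = _ := by
          rw [lintegral_mul_const _ (by fun_prop), lintegral_Ioo_rpow hθ2]
  have havg {G : ℂ → ℝ≥0∞} {e : ℝ} (he : 0 < e) : (∫⁻ y in S, G y ^ e) ^ (1 / e) ≤
      V ^ (1 / e) * (V⁻¹ * ∫⁻ y in ball x₀ ρ, G y ^ e) ^ (1 / e) := by
    rw [← ENNReal.mul_rpow_of_nonneg _ _ (by positivity), ← mul_assoc,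
      ENNReal.mul_inv_cancel hV0 hVf, one_mul]
    exact ENNReal.rpow_le_rpow (lintegral_mono_set inter_subset_left) (by positivity)
  have hMF : M ≤ 12 * volume S * V * F := by
    calc M ≤ volume S ^ (1 - θ) * ((V ^ (1 / s) * (V⁻¹ * ∫⁻ y in ball x₀ ρ, A y ^ s) ^ (1 / s)) *
          (V ^ (1 / σ) * (V⁻¹ * ∫⁻ y in ball x₀ ρ, B y ^ σ) ^ (1 / σ))) := by
          exact mul_le_mul_right (mul_le_mul' (havg hs) (havg hσ)) _
      _ = volume S ^ (1 - θ) * (V ^ (1 / s) * V ^ (1 / σ)) *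
          ((V⁻¹ * ∫⁻ y in ball x₀ ρ, A y ^ s) ^ (1 / s) *
          (V⁻¹ * ∫⁻ y in ball x₀ ρ, B y ^ σ) ^ (1 / σ)) := by ring
      _ ≤ volume S ^ (1 - θ) * (V ^ θ * V) * F := by
          gcongr ?_ * ?_
          · gcongr _ * ?_
            rw [← ENNReal.rpow_add _ _ hV0 hVf, hsum, add_comm,
              ENNReal.rpow_add _ _ hV0 hVf, ENNReal.rpow_one]
          · exact le_iSup_of_le x₀ (le_iSup_of_le ρ (le_iSup_of_le
              ⟨hρ, hρ6, mem_ball_self hρ⟩ le_rfl))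
      _ ≤ volume S ^ (1 - θ) * ((12 * volume S ^ θ) * V) * F := by
          gcongr
          calc V ^ θ ≤ (144 * volume S) ^ θ := by gcongr
            _ = 144 ^ θ * volume S ^ θ := ENNReal.mul_rpow_of_nonneg _ _ hθ
            _ ≤ 144 ^ (1 / 2 : ℝ) * volume S ^ θ := by
                gcongr ?_ * _
                exact ENNReal.rpow_le_rpow_of_exponent_le (by norm_num) hθ2.le
            _ = 12 * volume S ^ θ := by
                congr 1
                rw [show (144 : ℝ≥0∞) = 12 ^ (2 : ℝ) by norm_num, ← ENNReal.rpow_mul]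
                norm_num
      _ = 12 * (volume S ^ (1 - θ) * volume S ^ θ) * V * F := by ring
      _ = _ := by
          rw [← ENNReal.rpow_add _ _ hS0 hSf, sub_add_cancel, ENNReal.rpow_one]
  rw [← ENNReal.mul_le_mul_iff_left hS0 hSf]
  refine hmain.trans ?_
  calc _ ≤ 2 * L * (ENNReal.ofReal (2 * ρ) *
      (ENNReal.ofReal (4 / (1 - 2 * θ)) * (12 * volume S * V * F))) := by gcongr
    _ = _ := by
        rw [hV, volume_ball_complex, ENNReal.ofReal_mul (by norm_num),
          show ENNReal.ofReal 2 = 2 by simp]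
        ring

/-- Removing the values of `Ψ` of size at most `ε`. -/
def softThreshold (ε : ℝ) (Ψ : ℂ → ℝ) (z : ℂ) : ℝ := max (Ψ z - ε) 0 - max (-Ψ z - ε) 0

theorem softThreshold_lipschitz {L : ℝ≥0} {Ψ : ℂ → ℝ} (hΨ : LipschitzWith L Ψ) (ε : ℝ) :
    LipschitzWith (2 * L) (softThreshold ε Ψ) := by
  have h1 : LipschitzWith L fun z => max (Ψ z - ε) 0 := by
    have : LipschitzWith L fun z => Ψ z - ε := by
      simpa using hΨ.sub (LipschitzWith.const ε)
    exact this.max_const 0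
  have h2 : LipschitzWith L fun z => max (-Ψ z - ε) 0 := by
    have : LipschitzWith L fun z => -Ψ z - ε := by
      simpa using hΨ.neg.sub (LipschitzWith.const ε)
    exact this.max_const 0
  have := h1.sub h2
  rwa [← two_mul] at this

theorem abs_sub_softThreshold_le {ε : ℝ} (hε : 0 < ε) (Ψ : ℂ → ℝ) (z : ℂ) :
    |Ψ z - softThreshold ε Ψ z| ≤ ε := by
  unfold softThreshold
  rcases max_cases (Ψ z - ε) 0 with ⟨h1, h1'⟩ | ⟨h1, h1'⟩ <;>
  rcases max_cases (-Ψ z - ε) 0 with ⟨h2, h2'⟩ | ⟨h2, h2'⟩ <;>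
  rw [h1, h2, abs_le] <;> constructor <;> linarith

theorem tsupport_softThreshold_subset {ε : ℝ} {Ψ : ℂ → ℝ} (hΨ : Continuous Ψ) :
    tsupport (softThreshold ε Ψ) ⊆ {z | ε ≤ |Ψ z|} := by
  refine closure_minimal (fun z hz => ?_) (isClosed_le continuous_const hΨ.abs)
  by_contra h
  rw [mem_ofPred_eq, not_le, abs_lt] at h
  refine hz ?_
  rw [softThreshold, max_eq_right (by linarith), max_eq_right (by linarith), sub_zero]

/-- The div-curl estimate against a Lipschitz test function vanishing off `ball x₀ ρ ∩ ball 0 1`. -/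
theorem enorm_setIntegral_mul_jac_le {s σ θ : ℝ} (hs : 0 < s) (hσ : 0 < σ) (hθ : 0 ≤ θ)
    (hsum : 1 / s + 1 / σ = 1 + θ) (hθs : θ ≤ 1 / s) (hθσ : θ ≤ 1 / σ) (hθ2 : θ < 1 / 2)
    {a b : ℂ → ℝ} (ha : ContDiffOn ℝ (⊤ : ℕ∞) a (ball 0 1))
    (hb : ContDiffOn ℝ (⊤ : ℕ∞) b (ball 0 1)) (hinteg : IntegrableOn (jac a b) (ball 0 1))
    {x₀ : ℂ} (hx₀ : x₀ ∈ ball (0 : ℂ) 1) {ρ : ℝ}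
    (hρ : 0 < ρ) (hρ6 : ρ ≤ 6) {Ψ : ℂ → ℝ} {L : ℝ≥0} (hΨ : LipschitzWith L Ψ)
    (h0 : ∀ z ∉ ball x₀ ρ ∩ ball 0 1, Ψ z = 0) :
    ‖∫ z in ball 0 1, Ψ z * jac a b z‖ₑ ≤ 96 * NNReal.pi * ENNReal.ofReal (4 / (1 - 2 * θ)) * L *
      ENNReal.ofReal ρ ^ 3 * bimax s σ (gradAbs a) (gradAbs b) x₀ := by
  set Y := 96 * NNReal.pi * ENNReal.ofReal (4 / (1 - 2 * θ)) * L *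
      ENNReal.ofReal ρ ^ 3 * bimax s σ (gradAbs a) (gradAbs b) x₀ with hY
  set K := ∫⁻ z in ball (0 : ℂ) 1, ‖jac a b z‖ₑ with hKdef
  have hKf : K ≠ ∞ := hinteg.2.ne
  have hsuppS {ε : ℝ} (hε : 0 < ε) : {z | ε ≤ |Ψ z|} ⊆ ball x₀ ρ ∩ ball 0 1 := by
    intro z hz
    by_contra h
    have hz' : ε ≤ |Ψ z| := hz
    rw [h0 z h, abs_zero] at hz'
    linarith
  have hbd : ∃ M, ∀ z, |Ψ z| ≤ M := by
    have hc : HasCompactSupport Ψ := by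
      refine HasCompactSupport.of_support_subset_isCompact (isCompact_closedBall x₀ ρ) ?_
      intro z hz
      by_contra h
      exact hz (h0 z fun h' => h (ball_subset_closedBall h'.1))
    obtain ⟨M, hM⟩ := hc.exists_bound_of_continuous hΨ.continuous
    exact ⟨M, hM⟩
  obtain ⟨M, hM⟩ := hbd
  have hstep : ∀ ε : ℝ, 0 < ε →
      ‖∫ z in ball 0 1, Ψ z * jac a b z‖ₑ ≤ Y + ENNReal.ofReal ε * K := by
    intro ε hε
    have hlip := softThreshold_lipschitz hΨ ε
    have hts := (tsupport_softThreshold_subset (ε := ε) hΨ.continuous).trans (hsuppS hε)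
    have hcs : HasCompactSupport (softThreshold ε Ψ) :=
      HasCompactSupport.of_support_subset_isCompact (isCompact_closedBall x₀ ρ)
        ((subset_tsupport _).trans (hts.trans (inter_subset_left.trans ball_subset_closedBall)))
    have h1 := enorm_integral_mul_jac_le_bimax hs hσ hθ hsum hθs hθσ hθ2 ha hb hx₀ hρ hρ6 hlip
      hcs hts
    rw [← setIntegral_eq_integral_of_forall_compl_eq_zero (s := ball (0 : ℂ) 1)
      (fun z hz => by
        rw [image_eq_zero_of_notMem_tsupport fun h => hz (hts h).2, zero_mul])] at h1
    have i1 : IntegrableOn (fun z => Ψ z * jac a b z) (ball 0 1) :=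
      hinteg.bdd_mul (c := M) hΨ.continuous.aestronglyMeasurable (Eventually.of_forall hM)
    have i2 : IntegrableOn (fun z => softThreshold ε Ψ z * jac a b z) (ball 0 1) := by
      refine hinteg.bdd_mul (c := M + ε) hlip.continuous.aestronglyMeasurable
        (Eventually.of_forall fun z => ?_)
      have := abs_sub_softThreshold_le hε Ψ z
      have := hM z
      rw [Real.norm_eq_abs]
      calc |softThreshold ε Ψ z| = |Ψ z - (Ψ z - softThreshold ε Ψ z)| := by congr 1; ring
        _ ≤ |Ψ z| + |Ψ z - softThreshold ε Ψ z| := abs_sub _ _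
        _ ≤ _ := by linarith
    have h2 : ‖∫ z in ball 0 1, (Ψ z * jac a b z - softThreshold ε Ψ z * jac a b z)‖ₑ ≤
        ENNReal.ofReal ε * K := by
      refine (enorm_integral_le_lintegral_enorm _).trans ?_
      rw [hKdef, ← lintegral_const_mul' _ _ (by finiteness)]
      refine lintegral_mono fun z => ?_
      rw [← sub_mul, enorm_mul]
      gcongr
      rw [← ofReal_norm]
      exact ENNReal.ofReal_le_ofReal (abs_sub_softThreshold_le hε Ψ z)
    rw [integral_sub i1 i2] at h2
    have h3 : ‖∫ z in ball 0 1, softThreshold ε Ψ z * jac a b z‖ₑ ≤ Y := by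
      refine h1.trans (le_of_eq ?_)
      rw [hY]
      push_cast
      ring
    calc _ = ‖(∫ z in ball 0 1, softThreshold ε Ψ z * jac a b z) + ((∫ z in ball 0 1,
          Ψ z * jac a b z) - ∫ z in ball 0 1, softThreshold ε Ψ z * jac a b z)‖ₑ := by
          congr 1; ring
      _ ≤ _ := (enorm_add_le _ _).trans (add_le_add h3 h2)
  have hlim : Tendsto (fun ε : ℝ => Y + ENNReal.ofReal ε * K) (𝓝[>] 0) (𝓝 (Y + 0 * K)) := by
    refine Tendsto.const_add _ (ENNReal.Tendsto.mul_const ?_ (Or.inr hKf))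
    have : Tendsto ENNReal.ofReal (𝓝 0) (𝓝 (ENNReal.ofReal 0)) := ENNReal.tendsto_ofReal tendsto_id
    rw [ENNReal.ofReal_zero] at this
    exact this.mono_left nhdsWithin_le_nhds
  rw [zero_mul, add_zero] at hlim
  refine ge_of_tendsto hlim ?_
  filter_upwards [self_mem_nhdsWithin] with ε hε using hstep ε hε

theorem continuousOn_gradAbs {a : ℂ → ℝ} (ha : ContDiffOn ℝ (⊤ : ℕ∞) a (ball 0 1)) :
    ContinuousOn (gradAbs a) (ball 0 1) :=
  (ha.continuousOn_fderiv_of_isOpen isOpen_ball (by simp)).enorm.congr fun _ hz => gradAbs_of_mem hz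

theorem le_avg_rpow {A : ℂ → ℝ≥0∞} {s : ℝ} (hs : 0 < s) {α : ℝ≥0∞} {x : ℂ} {ρ : ℝ} (hρ : 0 < ρ)
    (h : ∀ y ∈ ball x ρ, α ≤ A y) :
    α ≤ ((volume (ball x ρ))⁻¹ * ∫⁻ y in ball x ρ, A y ^ s) ^ (1 / s) := by
  have hV0 : volume (ball x ρ) ≠ 0 := (measure_ball_pos _ _ hρ).ne'
  have hVf : volume (ball x ρ) ≠ ∞ := measure_ball_lt_top.ne
  calc α = ((volume (ball x ρ))⁻¹ * ∫⁻ _ in ball x ρ, α ^ s) ^ (1 / s) := by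
        rw [lintegral_const, Measure.restrict_apply_univ, mul_comm (α ^ s), ← mul_assoc,
          ENNReal.inv_mul_cancel hV0 hVf, one_mul, ← ENNReal.rpow_mul, mul_one_div_cancel hs.ne',
          ENNReal.rpow_one]
    _ ≤ _ := by
        refine ENNReal.rpow_le_rpow ?_ (by positivity)
        gcongr 1
        exact setLIntegral_mono' measurableSet_ball fun y hy =>
          ENNReal.rpow_le_rpow (h y hy) hs.le

theorem gradAbs_mul_le_bimax {s σ : ℝ} (hs : 0 < s) (hσ : 0 < σ) {a b : ℂ → ℝ}
    (ha : ContDiffOn ℝ (⊤ : ℕ∞) a (ball 0 1)) (hb : ContDiffOn ℝ (⊤ : ℕ∞) b (ball 0 1)) {x : ℂ}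
    (hx : x ∈ ball (0 : ℂ) 1) :
    gradAbs a x * gradAbs b x ≤ bimax s σ (gradAbs a) (gradAbs b) x := by
  refine ENNReal.mul_le_of_forall_lt fun α hα β hβ => ?_
  have hn : ball (0 : ℂ) 1 ∈ 𝓝 x := isOpen_ball.mem_nhds hx
  have h1 : ∀ᶠ y in 𝓝 x, α < gradAbs a y :=
    ((continuousOn_gradAbs ha).continuousAt hn).eventually_const_lt hα
  have h2 : ∀ᶠ y in 𝓝 x, β < gradAbs b y :=
    ((continuousOn_gradAbs hb).continuousAt hn).eventually_const_lt hβ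
  obtain ⟨ε, hε, hball⟩ := Metric.mem_nhds_iff.1 (h1.and h2)
  have hρ : 0 < min ε 6 := lt_min hε (by norm_num)
  have hsub : ball x (min ε 6) ⊆ ball x ε := ball_subset_ball (min_le_left _ _)
  calc α * β ≤ _ * _ := mul_le_mul' (le_avg_rpow hs hρ fun y hy => (hball (hsub hy)).1.le)
        (le_avg_rpow hσ hρ fun y hy => (hball (hsub hy)).2.le)
    _ ≤ _ := by
        have hmem : 0 < min ε 6 ∧ min ε 6 ≤ 6 ∧ x ∈ ball x (min ε 6) :=
          ⟨hρ, min_le_right _ _, mem_ball_self hρ⟩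
        exact le_iSup_of_le x (le_iSup_of_le (min ε 6) (le_iSup_of_le hmem le_rfl))

theorem enorm_jac_le_gradAbs (a b : ℂ → ℝ) {x : ℂ} (hx : x ∈ ball (0 : ℂ) 1) :
    ‖jac a b x‖ₑ ≤ 2 * (gradAbs a x * gradAbs b x) := by
  rw [gradAbs_of_mem hx, gradAbs_of_mem hx, ← ofReal_norm, ← ofReal_norm, ← ofReal_norm,
    ← ENNReal.ofReal_mul (by positivity), show (2 : ℝ≥0∞) = ENNReal.ofReal 2 by simp,
    ← ENNReal.ofReal_mul (by positivity)]
  exact ENNReal.ofReal_le_ofReal (norm_jac_le a b x)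

theorem lintegral_maxFn_rpow_le {A : ℂ → ℝ≥0∞} (hA : Measurable A) {s p ε N : ℝ} (hs : 0 < s)
    (hε : 0 < ε) (h1 : 1 + ε ≤ p / s) (h2 : p / s ≤ N) :
    ∫⁻ x, (maxFn 6 (fun y => A y ^ s) x ^ (1 / s)) ^ p ≤
      ENNReal.ofReal (32 * N * 2 ^ N / ε) * ∫⁻ x, A x ^ p := by
  have hm := maxFn_strong_type 6 (g := fun y => A y ^ s) (by fun_prop) (P := p / s) (by linarith)
  simp_rw [← ENNReal.rpow_mul] at hm ⊢
  rw [mul_div_cancel₀ p hs.ne', ← one_div_mul_eq_div] at hm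
  refine hm.trans ?_
  rw [one_div_mul_eq_div]
  have hN : 0 < N := by linarith
  gcongr <;> first | positivity | linarith

theorem lintegral_bimax_le {A B : ℂ → ℝ≥0∞} (hA : Measurable A) (hB : Measurable B)
    {s σ p p' ε N : ℝ} (hs : 0 < s) (hσ : 0 < σ) (hε : 0 < ε) (hpp : p.HolderConjugate p')
    (h1 : 1 + ε ≤ p / s) (h2 : p / s ≤ N) (h1' : 1 + ε ≤ p' / σ) (h2' : p' / σ ≤ N) :
    ∫⁻ x, bimax s σ A B x ≤ ENNReal.ofReal (32 * N * 2 ^ N / ε) *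
      ((∫⁻ x, A x ^ p) ^ (1 / p) * (∫⁻ x, B x ^ p') ^ (1 / p')) := by
  set c := ENNReal.ofReal (32 * N * 2 ^ N / ε)
  have hp := hpp.pos
  have hp' := hpp.symm.pos
  calc ∫⁻ x, bimax s σ A B x ≤ ∫⁻ x, (fun x => maxFn 6 (fun y => A y ^ s) x ^ (1 / s)) x *
          (fun x => maxFn 6 (fun y => B y ^ σ) x ^ (1 / σ)) x :=
        lintegral_mono fun x => bimax_le_maxFn hs hσ A B x
    _ ≤ (∫⁻ x, (maxFn 6 (fun y => A y ^ s) x ^ (1 / s)) ^ p) ^ (1 / p) *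
          (∫⁻ x, (maxFn 6 (fun y => B y ^ σ) x ^ (1 / σ)) ^ p') ^ (1 / p') :=
        ENNReal.lintegral_mul_le_Lp_mul_Lq _ hpp
          ((measurable_maxFn _ _).pow_const _).aemeasurable
          ((measurable_maxFn _ _).pow_const _).aemeasurable
    _ ≤ (c * ∫⁻ x, A x ^ p) ^ (1 / p) * (c * ∫⁻ x, B x ^ p') ^ (1 / p') := by
        refine mul_le_mul' ?_ ?_
        · exact ENNReal.rpow_le_rpow (lintegral_maxFn_rpow_le hA hs hε h1 h2) (by positivity)
        · exact ENNReal.rpow_le_rpow (lintegral_maxFn_rpow_le hB hσ hε h1' h2') (by positivity)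
    _ = (c ^ (1 / p) * c ^ (1 / p')) *
          ((∫⁻ x, A x ^ p) ^ (1 / p) * (∫⁻ x, B x ^ p') ^ (1 / p')) := by
        rw [ENNReal.mul_rpow_of_nonneg _ _ (by positivity),
          ENNReal.mul_rpow_of_nonneg _ _ (by positivity)]
        ring
    _ = _ := by
        rw [← ENNReal.rpow_add_of_nonneg _ _ (by positivity) (by positivity), one_div, one_div,
          hpp.inv_add_inv_eq_one, ENNReal.rpow_one]

/-- The Wirtinger derivative `∂`. -/
def dz (ψ : ℂ → ℂ) (z : ℂ) : ℂ := (fderiv ℝ ψ z 1 - Complex.I * fderiv ℝ ψ z Complex.I) / 2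

/-- The Wirtinger derivative `∂̄`. -/
def dzbar (ψ : ℂ → ℂ) (z : ℂ) : ℂ := (fderiv ℝ ψ z 1 + Complex.I * fderiv ℝ ψ z Complex.I) / 2

theorem contDiff_dz {ψ : ℂ → ℂ} (hψ : ContDiff ℝ (⊤ : ℕ∞) ψ) : ContDiff ℝ (⊤ : ℕ∞) (dz ψ) :=
  ((contDiff_fderiv_apply hψ 1).sub
    (contDiff_const.mul (contDiff_fderiv_apply hψ Complex.I))).div_const 2

theorem contDiff_dzbar {ψ : ℂ → ℂ} (hψ : ContDiff ℝ (⊤ : ℕ∞) ψ) :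
    ContDiff ℝ (⊤ : ℕ∞) (dzbar ψ) :=
  ((contDiff_fderiv_apply hψ 1).add
    (contDiff_const.mul (contDiff_fderiv_apply hψ Complex.I))).div_const 2

theorem fderiv_apply_eq_dz (ψ : ℂ → ℂ) (z v : ℂ) :
    fderiv ℝ ψ z v = dz ψ z * v + dzbar ψ z * (starRingEnd ℂ) v := by
  have hv : v = v.re • (1 : ℂ) + v.im • Complex.I := by
    simp [Complex.re_add_im]
  have hc : (starRingEnd ℂ) v = v.re - v.im * Complex.I := by
    apply Complex.ext <;> simp
  rw [hc]
  conv_lhs => rw [hv]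
  conv_rhs => rw [hv]
  rw [map_add, map_smul, map_smul, dz, dzbar]
  simp only [Complex.real_smul, mul_one, Complex.add_re, Complex.ofReal_re, Complex.mul_re,
    Complex.I_re, mul_zero, Complex.I_im, Complex.ofReal_im, sub_zero, add_zero, Complex.add_im,
    Complex.mul_im, zero_add]
  linear_combination ((v.im : ℂ) * fderiv ℝ ψ z Complex.I) * Complex.I_mul_I

theorem dz_congr {ψ χ : ℂ → ℂ} {z : ℂ} (h : ψ =ᶠ[𝓝 z] χ) : dz ψ z = dz χ z := by
  rw [dz, dz, h.fderiv_eq]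

theorem dzbar_congr {ψ χ : ℂ → ℂ} {z : ℂ} (h : ψ =ᶠ[𝓝 z] χ) : dzbar ψ z = dzbar χ z := by
  rw [dzbar, dzbar, h.fderiv_eq]

theorem tsupport_dz_subset (ψ : ℂ → ℂ) : tsupport (dz ψ) ⊆ tsupport ψ := by
  refine closure_minimal (fun z hz => ?_) (isClosed_tsupport ψ)
  by_contra h
  have h0 : fderiv ℝ ψ z = 0 := by
    by_contra h1
    exact h (support_fderiv_subset ℝ h1)
  exact hz (by simp [dz, h0])

theorem tsupport_dzbar_subset (ψ : ℂ → ℂ) : tsupport (dzbar ψ) ⊆ tsupport ψ := by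
  refine closure_minimal (fun z hz => ?_) (isClosed_tsupport ψ)
  by_contra h
  have h0 : fderiv ℝ ψ z = 0 := by
    by_contra h1
    exact h (support_fderiv_subset ℝ h1)
  exact hz (by simp [dzbar, h0])

theorem HasCompactSupport.dz {ψ : ℂ → ℂ} (h : HasCompactSupport ψ) : HasCompactSupport (dz ψ) :=
  h.of_isClosed_subset (isClosed_tsupport _) (tsupport_dz_subset ψ)

theorem HasCompactSupport.dzbar {ψ : ℂ → ℂ} (h : HasCompactSupport ψ) :
    HasCompactSupport (dzbar ψ) :=
  h.of_isClosed_subset (isClosed_tsupport _) (tsupport_dzbar_subset ψ)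

theorem dz_mul {ψ χ : ℂ → ℂ} {z : ℂ} (hψ : DifferentiableAt ℝ ψ z) (hχ : DifferentiableAt ℝ χ z) :
    dz (fun w => ψ w * χ w) z = dz ψ z * χ z + ψ z * dz χ z := by
  rw [dz, dz, dz, fderiv_fun_mul hψ hχ]
  simp
  ring

theorem dzbar_mul {ψ χ : ℂ → ℂ} {z : ℂ} (hψ : DifferentiableAt ℝ ψ z)
    (hχ : DifferentiableAt ℝ χ z) :
    dzbar (fun w => ψ w * χ w) z = dzbar ψ z * χ z + ψ z * dzbar χ z := by
  rw [dzbar, dzbar, dzbar, fderiv_fun_mul hψ hχ]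
  simp
  ring

theorem integral_fderiv_eq_zero {ψ : ℂ → ℂ} (hψ : ContDiff ℝ (⊤ : ℕ∞) ψ)
    (hc : HasCompactSupport ψ) (v : ℂ) : ∫ z, fderiv ℝ ψ z v = 0 := by
  have hi : Integrable fun z => fderiv ℝ ψ z v :=
    (contDiff_fderiv_apply hψ v).continuous.integrable_of_hasCompactSupport (hc.fderiv_apply ℝ v)
  have hi' : Integrable ψ := hψ.continuous.integrable_of_hasCompactSupport hc
  have h := integral_mul_fderiv_eq_neg_fderiv_mul_of_integrable (μ := (volume : Measure ℂ))
    (f := ψ) (g := fun _ => (1 : ℂ)) (v := v)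
    (by simpa using hi) (by simp) (by simpa using hi')
    (fun x _ => hψ.differentiable (by simp) x) (fun x _ => differentiableAt_const _)
  simpa using h.symm

theorem integral_dz_eq_zero {ψ : ℂ → ℂ} (hψ : ContDiff ℝ (⊤ : ℕ∞) ψ)
    (hc : HasCompactSupport ψ) : ∫ z, dz ψ z = 0 := by
  have hi (v : ℂ) : Integrable fun z => fderiv ℝ ψ z v :=
    (contDiff_fderiv_apply hψ v).continuous.integrable_of_hasCompactSupport (hc.fderiv_apply ℝ v)
  simp only [dz]
  rw [integral_div, integral_sub (hi 1) ((hi Complex.I).const_mul _), integral_const_mul,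
    integral_fderiv_eq_zero hψ hc, integral_fderiv_eq_zero hψ hc]
  simp

theorem integral_jac_eq_zero {a b : ℂ → ℝ} (ha : ContDiff ℝ (⊤ : ℕ∞) a)
    (hac : HasCompactSupport a) (hb : ContDiff ℝ (⊤ : ℕ∞) b) : ∫ z, jac a b z = 0 := by
  have h := integral_mul_jac_of_compactSupport (LipschitzWith.const (1 : ℝ)) ha hac hb
  simpa [lineDeriv] using h

theorem normSq_dz_sub {ψ : ℂ → ℂ} {z : ℂ} (hψ : DifferentiableAt ℝ ψ z) :
    ‖dz ψ z‖ ^ 2 - ‖dzbar ψ z‖ ^ 2 = jac (fun w => (ψ w).re) (fun w => (ψ w).im) z := by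
  have hre : fderiv ℝ (fun w => (ψ w).re) z = Complex.reCLM ∘L fderiv ℝ ψ z :=
    (Complex.reCLM.hasFDerivAt.comp z hψ.hasFDerivAt).fderiv
  have him : fderiv ℝ (fun w => (ψ w).im) z = Complex.imCLM ∘L fderiv ℝ ψ z :=
    (Complex.imCLM.hasFDerivAt.comp z hψ.hasFDerivAt).fderiv
  rw [jac, hre, him, dz, dzbar, ← Complex.normSq_eq_norm_sq, ← Complex.normSq_eq_norm_sq]
  simp [Complex.normSq_apply]
  ring

theorem integral_normSq_dz {ψ : ℂ → ℂ} (hψ : ContDiff ℝ (⊤ : ℕ∞) ψ) (hc : HasCompactSupport ψ) :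
    ∫ z, ‖dz ψ z‖ ^ 2 = ∫ z, ‖dzbar ψ z‖ ^ 2 := by
  have hi : Integrable fun z => ‖dz ψ z‖ ^ 2 :=
    Continuous.integrable_of_hasCompactSupport ((contDiff_dz hψ).continuous.norm.pow 2)
      (hc.dz.mono fun z hz h => hz (by simp [h]))
  have hi' : Integrable fun z => ‖dzbar ψ z‖ ^ 2 :=
    Continuous.integrable_of_hasCompactSupport ((contDiff_dzbar hψ).continuous.norm.pow 2)
      (hc.dzbar.mono fun z hz h => hz (by simp [h]))
  have hre : ContDiff ℝ (⊤ : ℕ∞) fun w => (ψ w).re := Complex.reCLM.contDiff.comp hψ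
  have him : ContDiff ℝ (⊤ : ℕ∞) fun w => (ψ w).im := Complex.imCLM.contDiff.comp hψ
  have h := integral_jac_eq_zero hre (hc.comp_left (g := Complex.re) rfl) him
  rw [← sub_eq_zero, ← integral_sub hi hi', ← h]
  congr 1 with z
  exact normSq_dz_sub (hψ.differentiable (by simp) z)

theorem locallyIntegrable_inv : LocallyIntegrable fun t : ℂ => t⁻¹ := by
  rw [locallyIntegrable_iff]
  intro k hk
  obtain ⟨r, hr⟩ := hk.isBounded.subset_ball (0 : ℂ)
  refine IntegrableOn.mono_set ?_ hr
  refine integrableOn_ball_of_norm_le_rpow (C := 1) (α := 1) (by simp) (by simp) ?_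
    (measurable_inv).aestronglyMeasurable
  exact Eventually.of_forall fun x => by simp [Real.rpow_neg_one]

open scoped Convolution in
/-- The (unnormalised) Cauchy transform. -/
def cauchyT (ψ : ℂ → ℂ) : ℂ → ℂ :=
  (fun t : ℂ => t⁻¹) ⋆[ContinuousLinearMap.mul ℝ ℂ] ψ

theorem cauchyT_apply (ψ : ℂ → ℂ) (y : ℂ) : cauchyT ψ y = ∫ t : ℂ, t⁻¹ * ψ (y - t) := rfl

theorem integrable_cauchyT {ψ : ℂ → ℂ} (hψ : Continuous ψ) (hc : HasCompactSupport ψ) (y : ℂ) :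
    Integrable fun t : ℂ => t⁻¹ * ψ (y - t) :=
  hc.convolutionExists_right (ContinuousLinearMap.mul ℝ ℂ) locallyIntegrable_inv hψ y

theorem contDiff_cauchyT {ψ : ℂ → ℂ} (hψ : ContDiff ℝ (⊤ : ℕ∞) ψ) (hc : HasCompactSupport ψ) :
    ContDiff ℝ (⊤ : ℕ∞) (cauchyT ψ) :=
  hc.contDiff_convolution_right _ locallyIntegrable_inv hψ

theorem fderiv_cauchyT {ψ : ℂ → ℂ} (hψ : ContDiff ℝ (⊤ : ℕ∞) ψ) (hc : HasCompactSupport ψ)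
    (y v : ℂ) : fderiv ℝ (cauchyT ψ) y v = cauchyT (fun z => fderiv ℝ ψ z v) y := by
  have h := hc.hasFDerivAt_convolution_right (ContinuousLinearMap.mul ℝ ℂ) locallyIntegrable_inv
    (hψ.of_le (by simp)) y
  rw [cauchyT, h.fderiv]
  exact convolution_precompR_apply _ locallyIntegrable_inv (hc.fderiv ℝ)
    (hψ.continuous_fderiv (by simp)) y v

theorem dz_cauchyT {ψ : ℂ → ℂ} (hψ : ContDiff ℝ (⊤ : ℕ∞) ψ) (hc : HasCompactSupport ψ) (y : ℂ) :
    dz (cauchyT ψ) y = cauchyT (dz ψ) y := by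
  have hi (v : ℂ) := integrable_cauchyT (contDiff_fderiv_apply hψ v).continuous
    (hc.fderiv_apply ℝ v) y
  rw [dz, fderiv_cauchyT hψ hc, fderiv_cauchyT hψ hc, cauchyT_apply, cauchyT_apply, cauchyT_apply,
    ← integral_const_mul, ← integral_sub (hi 1) ((hi _).const_mul _), ← integral_div]
  congr 1 with t
  rw [dz]
  ring

theorem dzbar_cauchyT' {ψ : ℂ → ℂ} (hψ : ContDiff ℝ (⊤ : ℕ∞) ψ) (hc : HasCompactSupport ψ) (y : ℂ) :
    dzbar (cauchyT ψ) y = cauchyT (dzbar ψ) y := by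
  have hi (v : ℂ) := integrable_cauchyT (contDiff_fderiv_apply hψ v).continuous
    (hc.fderiv_apply ℝ v) y
  rw [dzbar, fderiv_cauchyT hψ hc, fderiv_cauchyT hψ hc, cauchyT_apply, cauchyT_apply,
    cauchyT_apply, ← integral_const_mul, ← integral_add (hi 1) ((hi _).const_mul _),
    ← integral_div]
  congr 1 with t
  rw [dzbar]
  ring

theorem two_mul_dzbar (ψ : ℂ → ℂ) (w e : ℂ) :
    dzbar ψ w * (starRingEnd ℂ) e =
      (fderiv ℝ ψ w e + Complex.I * fderiv ℝ ψ w (Complex.I * e)) / 2 := by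
  rw [fderiv_apply_eq_dz ψ w e, fderiv_apply_eq_dz ψ w (Complex.I * e), map_mul, Complex.conj_I]
  linear_combination (dzbar ψ w * (starRingEnd ℂ) e / 2 - dz ψ w * e / 2) * Complex.I_mul_I

theorem integral_radial_fderiv {ψ : ℂ → ℂ} (hψ : ContDiff ℝ (⊤ : ℕ∞) ψ)
    (hc : HasCompactSupport ψ) (y : ℂ) {e : ℂ} (he : ‖e‖ = 1) :
    ∫ r in Ioi (0 : ℝ), fderiv ℝ ψ (y - r * e) e = ψ y := by
  have hd (r : ℝ) : HasDerivAt (fun r : ℝ => -ψ (y - r * e)) (fderiv ℝ ψ (y - r * e) e) r := by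
    have h1 : HasDerivAt (fun r : ℝ => y - (r : ℂ) * e) (-e) r := by
      simpa using ((Complex.ofRealCLM.hasDerivAt (x := r)).mul_const e).const_sub y
    have h2 := ((hψ.differentiable (by simp) (y - r * e)).hasFDerivAt.comp_hasDerivAt r h1).neg
    exact h2.congr_deriv (by simp)
  obtain ⟨R, hR⟩ := hc.isBounded.subset_closedBall (0 : ℂ)
  have hz (r : ℝ) (hr : R + ‖y‖ < r) : y - r * e ∉ tsupport ψ := by
    intro h
    have h1 := hR h
    rw [mem_closedBall_zero_iff] at h1
    have h2 : ‖(r : ℂ) * e‖ ≤ ‖y‖ + ‖y - r * e‖ := by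
      calc ‖(r : ℂ) * e‖ = ‖y - (y - r * e)‖ := by congr 1; ring
        _ ≤ _ := norm_sub_le _ _
    rw [norm_mul, he, mul_one, Complex.norm_real] at h2
    have := le_abs_self r
    rw [Real.norm_eq_abs] at h2
    linarith
  have hcont : Continuous fun r : ℝ => fderiv ℝ ψ (y - r * e) e :=
    (contDiff_fderiv_apply hψ e).continuous.comp (by fun_prop)
  have hinteg : IntegrableOn (fun r : ℝ => fderiv ℝ ψ (y - r * e) e) (Ioi 0) := by
    have h1 : IntegrableOn (fun r : ℝ => fderiv ℝ ψ (y - r * e) e) (Icc 0 (R + ‖y‖)) :=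
      hcont.continuousOn.integrableOn_Icc
    refine h1.of_forall_sdiff_eq_zero measurableSet_Ioi fun r hr => ?_
    have hr' : R + ‖y‖ < r := by
      by_contra h
      exact hr.2 ⟨le_of_lt hr.1, not_lt.1 h⟩
    have h0 : fderiv ℝ ψ (y - r * e) = 0 := by
      by_contra h2
      exact hz r hr' (support_fderiv_subset ℝ h2)
    simp [h0]
  have hlim : Tendsto (fun r : ℝ => -ψ (y - r * e)) atTop (𝓝 0) := by
    refine tendsto_const_nhds.congr' ?_
    filter_upwards [eventually_gt_atTop (R + ‖y‖)] with r hr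
    rw [image_eq_zero_of_notMem_tsupport (hz r hr), neg_zero]
  have h := integral_Ioi_of_hasDerivAt_of_tendsto (hd 0).continuousAt.continuousWithinAt
    (fun r _ => hd r) hinteg hlim
  simpa using h

theorem integral_angular_fderiv {ψ : ℂ → ℂ} (hψ : ContDiff ℝ (⊤ : ℕ∞) ψ) (y : ℂ) {r : ℝ}
    (hr : 0 < r) :
    ∫ α in Ioo (-π) π, fderiv ℝ ψ (y - r * Complex.exp (α * Complex.I))
      (Complex.I * Complex.exp (α * Complex.I)) = 0 := by
  have hd (α : ℝ) : HasDerivAt (fun α : ℝ => -((r : ℂ)⁻¹ * ψ (y - r * Complex.exp (α * Complex.I))))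
      (fderiv ℝ ψ (y - r * Complex.exp (α * Complex.I))
        (Complex.I * Complex.exp (α * Complex.I))) α := by
    have h0 : HasDerivAt (fun α : ℝ => Complex.exp (α * Complex.I))
        (Complex.I * Complex.exp (α * Complex.I)) α := by
      have := ((Complex.ofRealCLM.hasDerivAt (x := α)).mul_const Complex.I).cexp
      simpa [mul_comm] using this
    have h1 : HasDerivAt (fun α : ℝ => y - (r : ℂ) * Complex.exp (α * Complex.I))
        (-(r * (Complex.I * Complex.exp (α * Complex.I)))) α :=
      (h0.const_mul (r : ℂ)).const_sub y
    have h2 := (((hψ.differentiable (by simp) _).hasFDerivAt.comp_hasDerivAt α h1).const_mul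
      (r : ℂ)⁻¹).neg
    refine h2.congr_deriv ?_
    rw [map_neg, ← Complex.real_smul (z := Complex.I * _), map_smul, Complex.real_smul]
    have : (r : ℂ) ≠ 0 := by exact_mod_cast hr.ne'
    field_simp
  have hcont : Continuous fun α : ℝ => fderiv ℝ ψ (y - r * Complex.exp (α * Complex.I))
        (Complex.I * Complex.exp (α * Complex.I)) :=
    ((hψ.continuous_fderiv (by simp)).comp (by fun_prop)).clm_apply (by fun_prop)
  rw [← integral_Ioc_eq_integral_Ioo, ← intervalIntegral.integral_of_le (by linarith [pi_pos]),
    intervalIntegral.integral_eq_sub_of_hasDerivAt (fun α _ => hd α)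
      (hcont.intervalIntegrable _ _)]
  simp [Complex.exp_neg, Complex.exp_pi_mul_I]

theorem cauchyT_dzbar {ψ : ℂ → ℂ} (hψ : ContDiff ℝ (⊤ : ℕ∞) ψ) (hc : HasCompactSupport ψ) (y : ℂ) :
    cauchyT (dzbar ψ) y = π * ψ y := by
  set P : ℝ × ℝ → ℂ := fun p => fderiv ℝ ψ (y - p.1 * Complex.exp (p.2 * Complex.I))
    (Complex.exp (p.2 * Complex.I)) with hP
  set S : ℝ × ℝ → ℂ := fun p => fderiv ℝ ψ (y - p.1 * Complex.exp (p.2 * Complex.I))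
    (Complex.I * Complex.exp (p.2 * Complex.I)) with hS
  have hPc : Continuous P :=
    ((hψ.continuous_fderiv (by simp)).comp (by fun_prop)).clm_apply (by fun_prop)
  have hSc : Continuous S :=
    ((hψ.continuous_fderiv (by simp)).comp (by fun_prop)).clm_apply (by fun_prop)
  have hn (α : ℝ) : ‖Complex.exp (α * Complex.I)‖ = 1 := Complex.norm_exp_ofReal_mul_I α
  obtain ⟨R, hR⟩ := hc.isBounded.subset_closedBall (0 : ℂ)
  have hz (p : ℝ × ℝ) (hr : R + ‖y‖ < p.1) :
      fderiv ℝ ψ (y - p.1 * Complex.exp (p.2 * Complex.I)) = 0 := by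
    by_contra h0
    have h1 := hR (support_fderiv_subset ℝ h0)
    rw [mem_closedBall_zero_iff] at h1
    have h2 : ‖(p.1 : ℂ) * Complex.exp (p.2 * Complex.I)‖ ≤
        ‖y‖ + ‖y - p.1 * Complex.exp (p.2 * Complex.I)‖ := by
      calc ‖(p.1 : ℂ) * Complex.exp (p.2 * Complex.I)‖
          = ‖y - (y - p.1 * Complex.exp (p.2 * Complex.I))‖ := by congr 1; ring
        _ ≤ _ := norm_sub_le _ _
    rw [norm_mul, hn, mul_one, Complex.norm_real, Real.norm_eq_abs] at h2
    have := le_abs_self p.1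
    linarith
  have hinteg {G : ℝ × ℝ → ℂ} (hG : Continuous G) (hG0 : ∀ p : ℝ × ℝ, R + ‖y‖ < p.1 → G p = 0) :
      IntegrableOn G (Ioi (0 : ℝ) ×ˢ Ioo (-π) π) := by
    have h1 : IntegrableOn G (Icc 0 (R + ‖y‖) ×ˢ Icc (-π) π) :=
      hG.continuousOn.integrableOn_compact (isCompact_Icc.prod isCompact_Icc)
    refine h1.of_forall_sdiff_eq_zero (measurableSet_Ioi.prod measurableSet_Ioo) fun p hp => ?_
    refine hG0 p ?_
    by_contra h
    exact hp.2 ⟨⟨le_of_lt hp.1.1, not_lt.1 h⟩, ⟨hp.1.2.1.le, hp.1.2.2.le⟩⟩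
  have hPi := hinteg hPc fun p hp => by simp [hP, hz p hp]
  have hSi := hinteg hSc fun p hp => by simp [hS, hz p hp]
  rw [cauchyT_apply, ← Complex.integral_comp_polarCoord_symm]
  have hcongr : ∀ p ∈ polarCoord.target, p.1 • ((Complex.polarCoord.symm p)⁻¹ *
      dzbar ψ (y - Complex.polarCoord.symm p)) = (P p + Complex.I * S p) / 2 := by
    intro p hp
    have hp1 : (p.1 : ℂ) ≠ 0 := by
      have : 0 < p.1 := hp.1
      exact_mod_cast this.ne'
    have he : Complex.polarCoord.symm p = p.1 * Complex.exp (p.2 * Complex.I) := by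
      rw [Complex.polarCoord_symm_apply, Complex.exp_mul_I]
      simp
    have hinv : (Complex.exp (p.2 * Complex.I))⁻¹ =
        (starRingEnd ℂ) (Complex.exp (p.2 * Complex.I)) := by
      rw [Complex.inv_def, Complex.normSq_eq_norm_sq, hn]
      simp
    rw [hP, hS, ← two_mul_dzbar, he, ← hinv, Complex.real_smul, mul_inv]
    field_simp
  have hmeas : MeasurableSet polarCoord.target :=
    measurableSet_Ioi.prod measurableSet_Ioo
  rw [setIntegral_congr_fun hmeas hcongr]
  have ht : polarCoord.target = Ioi (0 : ℝ) ×ˢ Ioo (-π) π := rfl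
  rw [ht, integral_div, integral_add hPi (hSi.const_mul _), integral_const_mul]
  have h1 : ∫ p in Ioi (0 : ℝ) ×ˢ Ioo (-π) π, P p = 2 * π * ψ y := by
    rw [Measure.volume_eq_prod, ← setIntegral_prod_swap,
      setIntegral_prod (fun z : ℝ × ℝ => P z.swap) (by
        have := hPi.swap
        rwa [← Measure.volume_eq_prod] at *)]
    simp only [hP, Prod.swap_prod_mk, integral_radial_fderiv hψ hc y (hn _)]
    rw [setIntegral_const, Real.volume_real_Ioo_of_le (by linarith [pi_pos]), Complex.real_smul]
    push_cast
    ring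
  have h2 : ∫ p in Ioi (0 : ℝ) ×ˢ Ioo (-π) π, S p = 0 := by
    rw [Measure.volume_eq_prod, setIntegral_prod _ (by rwa [← Measure.volume_eq_prod])]
    refine (setIntegral_congr_fun measurableSet_Ioi fun r hr => ?_).trans (integral_zero' _ _)
    exact integral_angular_fderiv hψ y hr
  rw [h1, h2]
  ring

theorem dzbar_cauchyT {ψ : ℂ → ℂ} (hψ : ContDiff ℝ (⊤ : ℕ∞) ψ) (hc : HasCompactSupport ψ)
    (y : ℂ) : dzbar (cauchyT ψ) y = π * ψ y := by
  rw [dzbar_cauchyT', cauchyT_dzbar hψ hc] <;> assumption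

open scoped ComplexConjugate in
/-- The reflected part of the kernel of the unit disk. -/
def kerRefl (x y : ℂ) : ℂ := conj y / (1 - x * conj y)

/-- The kernel representing `∂∂` of the Dirichlet solution in the unit disk. -/
def kerV (x y : ℂ) : ℂ := kerRefl x y ^ 2 - ((x - y)⁻¹) ^ 2

section kernel

open scoped ComplexConjugate

variable {x y y' : ℂ}

theorem norm_sub_le_norm_one_sub (hx : ‖x‖ ≤ 1) (hy : ‖y‖ ≤ 1) : ‖x - y‖ ≤ ‖1 - x * conj y‖ := by
  rw [← sq_le_sq₀ (norm_nonneg _) (norm_nonneg _), ← Complex.normSq_eq_norm_sq,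
    ← Complex.normSq_eq_norm_sq]
  have h1 : Complex.normSq x ≤ 1 := by
    rw [Complex.normSq_eq_norm_sq]; exact pow_le_one₀ (norm_nonneg _) hx
  have h2 : Complex.normSq y ≤ 1 := by
    rw [Complex.normSq_eq_norm_sq]; exact pow_le_one₀ (norm_nonneg _) hy
  rw [Complex.normSq_apply] at *
  simp only [Complex.normSq_apply, Complex.sub_re, Complex.sub_im, Complex.mul_re, Complex.mul_im,
    Complex.one_re, Complex.one_im, Complex.conj_re, Complex.conj_im] at *
  nlinarith [mul_nonneg (sub_nonneg.2 h1) (sub_nonneg.2 h2)]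

theorem one_sub_norm_le (hx : ‖x‖ ≤ 1) (y : ℂ) : 1 - ‖y‖ ≤ ‖1 - x * conj y‖ := by
  have h := norm_sub_norm_le 1 (x * conj y)
  rw [norm_one, norm_mul, RCLike.norm_conj] at h
  nlinarith [norm_nonneg y]

theorem norm_kerRefl_le {m : ℝ} (hm : 0 < m) (hx : ‖x‖ ≤ 1) (hy : ‖y‖ ≤ 1) (h : m ≤ ‖x - y‖) :
    ‖kerRefl x y‖ ≤ m⁻¹ := by
  rw [kerRefl, norm_div, RCLike.norm_conj, ← one_div]
  exact div_le_div₀ zero_le_one hy hm (h.trans (norm_sub_le_norm_one_sub hx hy))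

theorem norm_kerV_le {m : ℝ} (hm : 0 < m) (hx : ‖x‖ ≤ 1) (hy : ‖y‖ ≤ 1) (h : m ≤ ‖x - y‖) :
    ‖kerV x y‖ ≤ 2 / m ^ 2 := by
  have h1 := norm_kerRefl_le hm hx hy h
  have h2 : ‖(x - y)⁻¹‖ ≤ m⁻¹ := by
    rw [norm_inv]; exact inv_anti₀ hm h
  calc ‖kerV x y‖ ≤ ‖kerRefl x y ^ 2‖ + ‖((x - y)⁻¹) ^ 2‖ := norm_sub_le _ _
    _ ≤ (m⁻¹) ^ 2 + (m⁻¹) ^ 2 := by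
        rw [norm_pow, norm_pow]
        gcongr
    _ = 2 / m ^ 2 := by rw [inv_pow]; ring

theorem norm_kerV_le_boundary {m : ℝ} (hm : 0 < m) (hx : ‖x‖ ≤ 1) (hy : ‖y‖ < 1)
    (h : m ≤ ‖x - y‖) : ‖kerV x y‖ ≤ 8 * (1 - ‖y‖) / m ^ 3 := by
  have hd : 0 < ‖x - y‖ := hm.trans_le h
  have hd1 := norm_sub_le_norm_one_sub hx hy.le
  have hd2 := one_sub_norm_le hx y
  have hxy : x - y ≠ 0 := norm_pos_iff.1 hd
  have h1 : 1 - x * conj y ≠ 0 := norm_pos_iff.1 (hd.trans_le hd1)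
  have hyy : y * conj y = ((‖y‖ ^ 2 : ℝ) : ℂ) := by
    rw [Complex.mul_conj, Complex.normSq_eq_norm_sq]
  have key : kerV x y = -((2 * (1 - x * conj y) - (1 - y * conj y)) * (1 - y * conj y)) /
      ((x - y) ^ 2 * (1 - x * conj y) ^ 2) := by
    rw [kerV, kerRefl]
    clear hyy hd1 hd2
    generalize conj y = w at *
    rw [div_pow, inv_pow, ← one_div, div_sub_div _ _ (pow_ne_zero 2 h1) (pow_ne_zero 2 hxy)]
    congr 1 <;> ring
  have hn : ‖(1 : ℂ) - y * conj y‖ = 1 - ‖y‖ ^ 2 := by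
    rw [hyy, ← Complex.ofReal_one, ← Complex.ofReal_sub, Complex.norm_real, Real.norm_eq_abs,
      abs_of_nonneg]
    nlinarith [norm_nonneg y]
  have hn2 : 1 - ‖y‖ ^ 2 ≤ 2 * (1 - ‖y‖) := by nlinarith [norm_nonneg y]
  have hn0 : 0 ≤ 1 - ‖y‖ ^ 2 := by nlinarith [norm_nonneg y]
  set T := ‖1 - x * conj y‖ with hT
  have h3 : ‖2 * (1 - x * conj y) - (1 - y * conj y)‖ ≤ 4 * T := by
    refine (norm_sub_le _ _).trans ?_
    rw [norm_mul, hn, ← hT]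
    norm_num
    linarith
  rw [key, norm_div, norm_neg, norm_mul, norm_mul, norm_pow, norm_pow, hn, ← hT,
    div_le_div_iff₀ (by positivity) (by positivity)]
  have hmT : m ≤ T := h.trans hd1
  have hT0 : 0 < T := hm.trans_le hmT
  have h4 : m ^ 3 ≤ ‖x - y‖ ^ 2 * T := by
    calc m ^ 3 = m ^ 2 * m := by ring
      _ ≤ ‖x - y‖ ^ 2 * T := by gcongr
  calc ‖2 * (1 - x * conj y) - (1 - y * conj y)‖ * (1 - ‖y‖ ^ 2) * m ^ 3
      ≤ (4 * T) * (2 * (1 - ‖y‖)) * (‖x - y‖ ^ 2 * T) := by gcongr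
    _ = _ := by ring

theorem norm_kerV_sub_le {m : ℝ} (hm : 0 < m) (hx : ‖x‖ ≤ 1) (hy : ‖y‖ ≤ 1) (hy' : ‖y'‖ ≤ 1)
    (h : m ≤ ‖x - y‖) (h' : m ≤ ‖x - y'‖) : ‖kerV x y - kerV x y'‖ ≤ 4 * ‖y - y'‖ / m ^ 3 := by
  have hT : m ≤ ‖1 - x * conj y‖ := h.trans (norm_sub_le_norm_one_sub hx hy)
  have hT' : m ≤ ‖1 - x * conj y'‖ := h'.trans (norm_sub_le_norm_one_sub hx hy')
  have h0 : x - y ≠ 0 := norm_pos_iff.1 (hm.trans_le h)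
  have h0' : x - y' ≠ 0 := norm_pos_iff.1 (hm.trans_le h')
  have h1 : 1 - x * conj y ≠ 0 := norm_pos_iff.1 (hm.trans_le hT)
  have h1' : 1 - x * conj y' ≠ 0 := norm_pos_iff.1 (hm.trans_le hT')
  have e1 : ‖kerRefl x y - kerRefl x y'‖ ≤ ‖y - y'‖ / m ^ 2 := by
    have : kerRefl x y - kerRefl x y' =
        conj (y - y') / ((1 - x * conj y) * (1 - x * conj y')) := by
      rw [kerRefl, kerRefl, map_sub]
      clear hT hT'
      generalize conj y = w at *
      generalize conj y' = w' at *
      rw [div_sub_div _ _ h1 h1']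
      congr 1
      ring
    rw [this, norm_div, RCLike.norm_conj, norm_mul, sq]
    gcongr
  have e2 : ‖(x - y)⁻¹ - (x - y')⁻¹‖ ≤ ‖y - y'‖ / m ^ 2 := by
    have : (x - y)⁻¹ - (x - y')⁻¹ = (y - y') / ((x - y) * (x - y')) := by
      field_simp
      ring
    rw [this, norm_div, norm_mul, sq]
    gcongr
  have sqd (s t : ℂ) (hs : ‖s‖ ≤ m⁻¹) (ht : ‖t‖ ≤ m⁻¹) (hst : ‖s - t‖ ≤ ‖y - y'‖ / m ^ 2) :
      ‖s ^ 2 - t ^ 2‖ ≤ 2 * ‖y - y'‖ / m ^ 3 := by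
    calc ‖s ^ 2 - t ^ 2‖ = ‖s + t‖ * ‖s - t‖ := by rw [← norm_mul]; congr 1; ring
      _ ≤ (m⁻¹ + m⁻¹) * (‖y - y'‖ / m ^ 2) := by
          gcongr
          exact (norm_add_le _ _).trans (add_le_add hs ht)
      _ = _ := by field_simp; ring
  have hinv (w : ℂ) (hw : m ≤ ‖x - w‖) : ‖(x - w)⁻¹‖ ≤ m⁻¹ := by
    rw [norm_inv]; exact inv_anti₀ hm hw
  have a1 := sqd _ _ (norm_kerRefl_le hm hx hy h) (norm_kerRefl_le hm hx hy' h') e1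
  have a2 := sqd _ _ (hinv y h) (hinv y' h') e2
  calc ‖kerV x y - kerV x y'‖ = ‖(kerRefl x y ^ 2 - kerRefl x y' ^ 2) -
        (((x - y)⁻¹) ^ 2 - ((x - y')⁻¹) ^ 2)‖ := by rw [kerV, kerV]; congr 1; ring
    _ ≤ _ := norm_sub_le _ _
    _ ≤ 2 * ‖y - y'‖ / m ^ 3 + 2 * ‖y - y'‖ / m ^ 3 := add_le_add a1 a2
    _ = _ := by ring

end kernel

theorem measurable_kerRefl : Measurable fun p : ℂ × ℂ => kerRefl p.1 p.2 := by
  have h : Measurable fun p : ℂ × ℂ => (starRingEnd ℂ) p.2 :=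
    Complex.continuous_conj.measurable.comp measurable_snd
  have h2 : Measurable fun p : ℂ × ℂ => 1 - p.1 * (starRingEnd ℂ) p.2 :=
    (measurable_fst.mul h).const_sub 1
  exact h.div h2

theorem measurable_kerV : Measurable fun p : ℂ × ℂ => kerV p.1 p.2 := by
  have h : Measurable fun p : ℂ × ℂ => (p.1 - p.2)⁻¹ := (measurable_fst.sub measurable_snd).inv
  simp only [kerV, sq]
  exact (measurable_kerRefl.mul measurable_kerRefl).sub (h.mul h)

theorem measurable_kerV_left (y : ℂ) : Measurable fun x => kerV x y :=
  measurable_kerV.of_uncurry_right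

theorem dz_of_hasDerivAt {f : ℂ → ℂ} {f' z : ℂ} (h : HasDerivAt f f' z) : dz f z = f' := by
  have h1 : fderiv ℝ f z = _ := (h.hasFDerivAt.restrictScalars ℝ).fderiv
  rw [dz, h1]
  simp
  linear_combination (-f' / 2) * Complex.I_mul_I

theorem dz_comp_conj {f : ℂ → ℂ} {f' z : ℂ} (h : HasDerivAt f f' ((starRingEnd ℂ) z)) :
    dz (fun w => f ((starRingEnd ℂ) w)) z = 0 := by
  have h1 : HasFDerivAt (fun w => f ((starRingEnd ℂ) w)) _ z :=
    (h.hasFDerivAt.restrictScalars ℝ).comp z (Complex.conjCLE.hasFDerivAt (x := z))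
  rw [dz, h1.fderiv]
  simp
  linear_combination f' * Complex.I_mul_I

theorem dz_add {f g : ℂ → ℂ} {z : ℂ} (hf : DifferentiableAt ℝ f z) (hg : DifferentiableAt ℝ g z) :
    dz (fun w => f w + g w) z = dz f z + dz g z := by
  rw [dz, dz, dz, fderiv_fun_add hf hg]
  simp
  ring

theorem dzbar_add {f g : ℂ → ℂ} {z : ℂ} (hf : DifferentiableAt ℝ f z)
    (hg : DifferentiableAt ℝ g z) :
    dzbar (fun w => f w + g w) z = dzbar f z + dzbar g z := by
  rw [dzbar, dzbar, dzbar, fderiv_fun_add hf hg]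
  simp
  ring

/-- The Cauchy transform of `∂h` away from the support of `h`. -/
theorem cauchyT_dz_eq {h : ℂ → ℂ} (hh : ContDiff ℝ (⊤ : ℕ∞) h) (hc : HasCompactSupport h) {y : ℂ}
    (hy : y ∉ tsupport h) : cauchyT (dz h) y = -∫ x, h x * ((x - y)⁻¹) ^ 2 := by
  have hnear {x : ℂ} (hx : x ∉ tsupport h) : ∀ᶠ w in 𝓝 x, h w = 0 :=
    (notMem_tsupport_iff_eventuallyEq.1 hx)
  have hinv {x : ℂ} (hx : x ≠ y) : HasDerivAt (fun w : ℂ => (y - w)⁻¹) (((x - y)⁻¹) ^ 2) x := by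
    have h1 : HasDerivAt (fun w : ℂ => y - w) (-1) x := by
      simpa using (hasDerivAt_id x).const_sub y
    refine (h1.inv (sub_ne_zero.2 hx.symm)).congr_deriv ?_
    have : (x - y) ^ 2 = (y - x) ^ 2 := by ring
    rw [inv_pow, this]
    simp
  have hne {x : ℂ} (hx : x ∈ tsupport h) : x ≠ y := fun e => hy (e ▸ hx)
  have hk : ContDiff ℝ (⊤ : ℕ∞) fun x => h x * (y - x)⁻¹ := by
    rw [contDiff_iff_contDiffAt]
    intro x
    by_cases hx : x ∈ tsupport h
    · refine hh.contDiffAt.mul (ContDiffAt.inv (by fun_prop) (sub_ne_zero.2 (hne hx).symm))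
    · refine (contDiffAt_const (c := (0 : ℂ))).congr_of_eventuallyEq ?_
      filter_upwards [hnear hx] with w hw
      simp [hw]
  have hkc : HasCompactSupport fun x => h x * (y - x)⁻¹ := hc.mul_right
  have hdz (x : ℂ) : dz (fun x => h x * (y - x)⁻¹) x =
      (y - x)⁻¹ * dz h x + h x * ((x - y)⁻¹) ^ 2 := by
    by_cases hx : x ∈ tsupport h
    · have hd := hinv (hne hx)
      rw [dz_mul (hh.differentiable (by simp) x) (hd.differentiableAt.restrictScalars ℝ),
        dz_of_hasDerivAt hd]
      ring
    · rw [image_eq_zero_of_notMem_tsupport hx,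
        image_eq_zero_of_notMem_tsupport fun h' => hx (tsupport_dz_subset h h'),
        image_eq_zero_of_notMem_tsupport fun h' =>
          hx (tsupport_mul_subset_left (tsupport_dz_subset _ h'))]
      simp
  have h0 := integral_dz_eq_zero hk hkc
  simp only [hdz] at h0
  have hi1 : Integrable fun x => (y - x)⁻¹ * dz h x := by
    have := (integrable_cauchyT (contDiff_dz hh).continuous hc.dz y).comp_sub_left y
    simpa using this
  have hi2 : Integrable fun x => h x * ((x - y)⁻¹) ^ 2 := by
    have h1 : Integrable fun x => dz (fun x => h x * (y - x)⁻¹) x :=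
      (contDiff_dz hk).continuous.integrable_of_hasCompactSupport hkc.dz
    simp only [hdz] at h1
    exact (h1.sub hi1).congr (Eventually.of_forall fun x => by simp)
  rw [integral_add hi1 hi2] at h0
  rw [cauchyT_apply, ← integral_sub_left_eq_self _ volume y]
  simp only [sub_sub_cancel]
  linear_combination h0

/-- The antiholomorphic correction term of the disk kernel. -/
def reflInt (h : ℂ → ℂ) (y : ℂ) : ℂ := ∫ x, h x * kerRefl x y ^ 2

theorem norm_one_sub_mul_ge {r : ℝ} {x w : ℂ} (hx : ‖x‖ ≤ r) (hw : ‖w‖ ≤ 1) :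
    1 - r ≤ ‖1 - x * w‖ := by
  have h := norm_sub_norm_le 1 (x * w)
  rw [norm_one, norm_mul] at h
  nlinarith [norm_nonneg x, norm_nonneg w]

theorem hasDerivAt_reflInt {h : ℂ → ℂ} (hh : Continuous h) (hc : HasCompactSupport h)
    (hD : tsupport h ⊆ ball 0 1) :
    ∃ G : ℂ → ℂ, (reflInt h = fun y => G ((starRingEnd ℂ) y)) ∧
      DifferentiableOn ℂ G (ball 0 1) := by
  obtain ⟨r, hr0, hr1, hr⟩ := exists_lt_one_subset_ball hc hD
  have hhi : Integrable h := hh.integrable_of_hasCompactSupport hc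
  refine ⟨fun w => ∫ x, h x * (w / (1 - x * w)) ^ 2, rfl, fun w hw => ?_⟩
  refine DifferentiableAt.differentiableWithinAt ?_
  have hmeas (w : ℂ) : AEStronglyMeasurable fun x => h x * (w / (1 - x * w)) ^ 2 := by
    refine hh.aestronglyMeasurable.mul (Measurable.aestronglyMeasurable ?_)
    exact ((measurable_const.div ((measurable_id.mul_const w).const_sub 1)).pow_const 2)
  have hmeas' : AEStronglyMeasurable
      fun x => h x * (2 * (w / (1 - x * w)) * (1 / (1 - x * w) ^ 2)) := by
    refine hh.aestronglyMeasurable.mul (Measurable.aestronglyMeasurable ?_)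
    have h1 : Measurable fun x : ℂ => 1 - x * w := (measurable_id.mul_const w).const_sub 1
    exact ((measurable_const.div h1).const_mul 2).mul (measurable_const.div (h1.pow_const 2))
  have hsupp {x : ℂ} (hx : h x ≠ 0) : ‖x‖ ≤ r := by
    have := hr (subset_tsupport h hx)
    rw [mem_ball_zero_iff] at this
    exact this.le
  have hδ : 0 < 1 - r := by linarith
  have key := hasDerivAt_integral_of_dominated_loc_of_deriv_le (𝕜 := ℂ) (μ := (volume : Measure ℂ))
    (F := fun w x => h x * (w / (1 - x * w)) ^ 2)
    (F' := fun w x => h x * (2 * (w / (1 - x * w)) * (1 / (1 - x * w) ^ 2)))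
    (x₀ := w) (s := ball 0 1) (bound := fun x => ‖h x‖ * (2 / (1 - r) ^ 3))
    (isOpen_ball.mem_nhds hw) (Eventually.of_forall hmeas) ?_ hmeas' ?_ (hhi.norm.mul_const _) ?_
  · exact key.2.differentiableAt
  · refine (hhi.norm.mul_const ((1 - r)⁻¹ ^ 2)).mono' (hmeas w) (Eventually.of_forall fun x => ?_)
    rw [norm_mul]
    by_cases hx : h x = 0
    · simp [hx]
    have := norm_one_sub_mul_ge (hsupp hx) (mem_ball_zero_iff.1 hw).le
    rw [norm_pow, norm_div]
    gcongr
    rw [← one_div]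
    exact div_le_div₀ zero_le_one (mem_ball_zero_iff.1 hw).le hδ this
  · refine Eventually.of_forall fun x w hw => ?_
    rw [norm_mul]
    by_cases hx : h x = 0
    · simp [hx]
    have h2 := norm_one_sub_mul_ge (hsupp hx) (mem_ball_zero_iff.1 hw).le
    gcongr
    rw [norm_mul, norm_mul, norm_div, norm_div, norm_pow, norm_one]
    have h3 : ‖w‖ / ‖1 - x * w‖ ≤ 1 / (1 - r) :=
      div_le_div₀ zero_le_one (mem_ball_zero_iff.1 hw).le hδ h2
    have h4 : 1 / ‖1 - x * w‖ ^ 2 ≤ 1 / (1 - r) ^ 2 := by gcongr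
    calc ‖(2 : ℂ)‖ * (‖w‖ / ‖1 - x * w‖) * (1 / ‖1 - x * w‖ ^ 2)
        ≤ 2 * (1 / (1 - r)) * (1 / (1 - r) ^ 2) := by
          gcongr
          simp
      _ = _ := by field_simp
  · refine Eventually.of_forall fun x w hw => ?_
    by_cases hx : h x = 0
    · simpa [hx] using hasDerivAt_const w (0 : ℂ)
    have h2 : 1 - x * w ≠ 0 := norm_pos_iff.1
      (hδ.trans_le (norm_one_sub_mul_ge (hsupp hx) (mem_ball_zero_iff.1 hw).le))
    have h3 : HasDerivAt (fun w => 1 - x * w) (-x) w := by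
      simpa using ((hasDerivAt_id w).const_mul x).const_sub 1
    refine ((((hasDerivAt_id w).div h3 h2).pow 2).const_mul (h x)).congr_deriv ?_
    simp
    left
    left
    field_simp
    ring

theorem contDiffOn_reflInt {h : ℂ → ℂ} (hh : Continuous h) (hc : HasCompactSupport h)
    (hD : tsupport h ⊆ ball 0 1) : ContDiffOn ℝ (⊤ : ℕ∞) (reflInt h) (ball 0 1) := by
  obtain ⟨G, hG, hGd⟩ := hasDerivAt_reflInt hh hc hD
  rw [hG]
  have h1 : ContDiffOn ℝ (⊤ : ℕ∞) G (ball 0 1) :=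
    (hGd.contDiffOn isOpen_ball).restrict_scalars ℝ
  refine h1.comp Complex.conjCLE.contDiff.contDiffOn fun y hy => ?_
  rw [mem_ball_zero_iff] at *
  simpa using hy

theorem dz_reflInt {h : ℂ → ℂ} (hh : Continuous h) (hc : HasCompactSupport h)
    (hD : tsupport h ⊆ ball 0 1) {y : ℂ} (hy : y ∈ ball (0 : ℂ) 1) : dz (reflInt h) y = 0 := by
  obtain ⟨G, hG, hGd⟩ := hasDerivAt_reflInt hh hc hD
  rw [hG]
  have hy' : (starRingEnd ℂ) y ∈ ball (0 : ℂ) 1 := by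
    rw [mem_ball_zero_iff] at *
    simpa using hy
  exact dz_comp_conj (hGd.differentiableAt (isOpen_ball.mem_nhds hy')).hasDerivAt

/-- The dual operator: `∫ h ∂∂φ` is expressed through the Laplacian of `φ` tested with `vOp h`. -/
def vOp (h : ℂ → ℂ) (y : ℂ) : ℂ := cauchyT (dz h) y + reflInt h y

theorem contDiffOn_vOp {h : ℂ → ℂ} (hh : ContDiff ℝ (⊤ : ℕ∞) h) (hc : HasCompactSupport h)
    (hD : tsupport h ⊆ ball 0 1) : ContDiffOn ℝ (⊤ : ℕ∞) (vOp h) (ball 0 1) :=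
  (contDiff_cauchyT (contDiff_dz hh) hc.dz).contDiffOn.add (contDiffOn_reflInt hh.continuous hc hD)

theorem dz_vOp {h : ℂ → ℂ} (hh : ContDiff ℝ (⊤ : ℕ∞) h) (hc : HasCompactSupport h)
    (hD : tsupport h ⊆ ball 0 1) {y : ℂ} (hy : y ∈ ball (0 : ℂ) 1) :
    dz (vOp h) y = cauchyT (dz (dz h)) y := by
  have h1 := ((contDiff_cauchyT (contDiff_dz hh) hc.dz).differentiable (by simp)) y
  have h2 := ((contDiffOn_reflInt hh.continuous hc hD).differentiableOn (by simp)).differentiableAt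
    (isOpen_ball.mem_nhds hy)
  have := dz_add h1 h2
  rw [dz_reflInt hh.continuous hc hD hy, add_zero, dz_cauchyT (contDiff_dz hh) hc.dz] at this
  exact this

theorem dzbar_dz_vOp {h : ℂ → ℂ} (hh : ContDiff ℝ (⊤ : ℕ∞) h) (hc : HasCompactSupport h)
    (hD : tsupport h ⊆ ball 0 1) {y : ℂ} (hy : y ∈ ball (0 : ℂ) 1) :
    dzbar (dz (vOp h)) y = π * dz (dz h) y := by
  rw [← dzbar_cauchyT (contDiff_dz (contDiff_dz hh)) hc.dz.dz]
  refine dzbar_congr ?_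
  filter_upwards [isOpen_ball.mem_nhds hy] with z hz
  exact dz_vOp hh hc hD hz

theorem exists_le_norm_sub_of_notMem {K : Set ℂ} (hK : IsClosed K) {y : ℂ} (hy : y ∉ K) :
    ∃ m > 0, ∀ x ∈ K, m ≤ ‖x - y‖ := by
  obtain ⟨m, hm, hb⟩ := Metric.isOpen_iff.1 hK.isOpen_compl y hy
  refine ⟨m, hm, fun x hx => not_lt.1 fun h => hb (mem_ball_iff_norm.2 h) hx⟩

theorem integrable_mul_of_le_on_tsupport {h k : ℂ → ℂ} (hh : Continuous h)
    (hc : HasCompactSupport h) (hk : Measurable k) {C : ℝ} (hb : ∀ x ∈ tsupport h, ‖k x‖ ≤ C) :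
    Integrable fun x => h x * k x := by
  refine ((hh.integrable_of_hasCompactSupport hc).norm.mul_const C).mono'
    (hh.aestronglyMeasurable.mul hk.aestronglyMeasurable) (Eventually.of_forall fun x => ?_)
  rw [norm_mul]
  by_cases hx : x ∈ tsupport h
  · exact mul_le_mul_of_nonneg_left (hb x hx) (norm_nonneg _)
  · simp [image_eq_zero_of_notMem_tsupport hx]

theorem vOp_eq_integral {h : ℂ → ℂ} (hh : ContDiff ℝ (⊤ : ℕ∞) h) (hc : HasCompactSupport h)
    (hD : tsupport h ⊆ ball 0 1) {y : ℂ} (hy : y ∈ ball (0 : ℂ) 1) (hyh : y ∉ tsupport h) :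
    vOp h y = ∫ x, h x * kerV x y := by
  obtain ⟨m, hm, hmx⟩ := exists_le_norm_sub_of_notMem (isClosed_tsupport h) hyh
  have hn {x : ℂ} (hx : x ∈ tsupport h) : ‖x‖ ≤ 1 := (mem_ball_zero_iff.1 (hD hx)).le
  have hy1 := (mem_ball_zero_iff.1 hy).le
  have h1 : Integrable fun x => h x * kerRefl x y ^ 2 := by
    refine integrable_mul_of_le_on_tsupport hh.continuous hc
      (measurable_kerRefl.of_uncurry_right.pow_const 2) (C := (m⁻¹) ^ 2) fun x hx => ?_
    rw [norm_pow]
    gcongr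
    exact norm_kerRefl_le hm (hn hx) hy1 (hmx x hx)
  have h2 : Integrable fun x => h x * ((x - y)⁻¹) ^ 2 := by
    refine integrable_mul_of_le_on_tsupport hh.continuous hc
      ((measurable_id.sub_const y).inv.pow_const 2) (C := (m⁻¹) ^ 2) fun x hx => ?_
    rw [norm_pow, norm_inv]
    gcongr
    exact hmx x hx
  rw [vOp, cauchyT_dz_eq hh hc hyh, reflInt, neg_add_eq_sub, ← integral_sub h1 h2]
  congr 1 with x
  rw [kerV]
  ring

theorem lintegral_normSq_dz {ψ : ℂ → ℂ} (hψ : ContDiff ℝ (⊤ : ℕ∞) ψ) (hc : HasCompactSupport ψ) :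
    ∫⁻ z, ‖dz ψ z‖ₑ ^ 2 = ∫⁻ z, ‖dzbar ψ z‖ₑ ^ 2 := by
  have hi {g : ℂ → ℂ} (hg : Continuous g) (hgc : HasCompactSupport g) :
      ∫⁻ z, ‖g z‖ₑ ^ 2 = ENNReal.ofReal (∫ z, ‖g z‖ ^ 2) := by
    rw [ofReal_integral_eq_lintegral_ofReal]
    · simp only [ENNReal.ofReal_pow (norm_nonneg _), ofReal_norm]
    · exact Continuous.integrable_of_hasCompactSupport (hg.norm.pow 2)
        (hgc.mono fun z hz h => hz (by simp [h]))
    · exact Eventually.of_forall fun z => by positivity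
  rw [hi (contDiff_dz hψ).continuous hc.dz, hi (contDiff_dzbar hψ).continuous hc.dzbar,
    integral_normSq_dz hψ hc]

theorem norm_dz_le (ψ : ℂ → ℂ) (z : ℂ) : ‖dz ψ z‖ ≤ ‖fderiv ℝ ψ z‖ := by
  have h1 := (fderiv ℝ ψ z).le_opNorm 1
  have h2 := (fderiv ℝ ψ z).le_opNorm Complex.I
  rw [norm_one, mul_one] at h1
  rw [Complex.norm_I, mul_one] at h2
  rw [dz, norm_div]
  have h3 := norm_sub_le (fderiv ℝ ψ z 1) (Complex.I * fderiv ℝ ψ z Complex.I)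
  rw [norm_mul, Complex.norm_I, one_mul] at h3
  norm_num
  linarith

theorem norm_dzbar_le (ψ : ℂ → ℂ) (z : ℂ) : ‖dzbar ψ z‖ ≤ ‖fderiv ℝ ψ z‖ := by
  have h1 := (fderiv ℝ ψ z).le_opNorm 1
  have h2 := (fderiv ℝ ψ z).le_opNorm Complex.I
  rw [norm_one, mul_one] at h1
  rw [Complex.norm_I, mul_one] at h2
  rw [dzbar, norm_div]
  have h3 := norm_add_le (fderiv ℝ ψ z 1) (Complex.I * fderiv ℝ ψ z Complex.I)
  rw [norm_mul, Complex.norm_I, one_mul] at h3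
  norm_num
  linarith

theorem norm_cauchyT_le {h : ℂ → ℂ} (hh : Continuous h) (hc : HasCompactSupport h)
    (hD : tsupport h ⊆ ball 0 1) {y : ℂ} (hy : 2 ≤ ‖y‖) :
    ‖cauchyT h y‖ ≤ 2 / ‖y‖ * ∫ x, ‖h x‖ := by
  rw [cauchyT_apply, ← integral_sub_left_eq_self _ volume y, ← integral_const_mul]
  simp only [sub_sub_cancel]
  refine norm_integral_le_of_norm_le
    ((hh.integrable_of_hasCompactSupport hc).norm.const_mul _) (Eventually.of_forall fun x => ?_)
  rw [norm_mul]
  by_cases hx : x ∈ tsupport h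
  · gcongr
    have h1 := mem_ball_zero_iff.1 (hD hx)
    have h2 := norm_sub_norm_le y x
    rw [norm_inv, ← one_div, div_le_div_iff₀ (by linarith) (by linarith)]
    linarith
  · simp [image_eq_zero_of_notMem_tsupport hx]

/-- A family of smooth cutoffs at scale `R` with gradient of size `1 / R`. -/
theorem exists_cutoff_scale : ∃ M : ℝ, 0 ≤ M ∧ ∀ R : ℝ, 0 < R → ∃ χ : ℂ → ℂ,
    ContDiff ℝ (⊤ : ℕ∞) χ ∧ HasCompactSupport χ ∧ (∀ y, ‖χ y‖ ≤ 1) ∧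
    (∀ y, ‖y‖ < R → χ y = 1) ∧ (∀ y, 2 * R < ‖y‖ → χ =ᶠ[𝓝 y] 0) ∧
    ∀ y, ‖fderiv ℝ χ y‖ ≤ M / R := by
  let B : ContDiffBump (0 : ℂ) := ⟨1, 2, one_pos, one_lt_two⟩
  have hB : ContDiff ℝ (⊤ : ℕ∞) fun y => ((B y : ℝ) : ℂ) :=
    Complex.ofRealCLM.contDiff.comp B.contDiff
  have hBc : HasCompactSupport fun y => ((B y : ℝ) : ℂ) :=
    B.hasCompactSupport.comp_left (g := Complex.ofReal) rfl
  obtain ⟨M, hM⟩ := (hB.continuous_fderiv (by simp)).bounded_above_of_compact_support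
    (hBc.fderiv ℝ)
  refine ⟨M, (norm_nonneg _).trans (hM 0), fun R hR => ⟨fun y => ((B (R⁻¹ • y) : ℝ) : ℂ), ?_, ?_,
    ?_, ?_, ?_, ?_⟩⟩
  · exact hB.comp (contDiff_const_smul _)
  · exact hBc.comp_smul (inv_ne_zero hR.ne')
  · intro y
    rw [Complex.norm_real, Real.norm_eq_abs, abs_of_nonneg B.nonneg]
    exact B.le_one
  · intro y hy
    beta_reduce
    rw [B.one_of_mem_closedBall, Complex.ofReal_one]
    rw [mem_closedBall_zero_iff, norm_smul, norm_inv, Real.norm_eq_abs, abs_of_pos hR,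
      inv_mul_le_iff₀ hR]
    change _ ≤ R * 1
    linarith
  · intro y hy
    filter_upwards [(isOpen_lt continuous_const continuous_norm).mem_nhds hy] with z hz
    rw [B.zero_of_le_dist, Complex.ofReal_zero, Pi.zero_apply]
    rw [dist_zero_right, norm_smul, norm_inv, Real.norm_eq_abs, abs_of_pos hR, le_inv_mul_iff₀ hR]
    have hz' : 2 * R < ‖z‖ := hz
    change R * 2 ≤ _
    linarith
  · intro y
    have h1 : HasFDerivAt (fun y => ((B (R⁻¹ • y) : ℝ) : ℂ))
        ((fderiv ℝ (fun y => ((B y : ℝ) : ℂ)) (R⁻¹ • y)) ∘L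
          (R⁻¹ • ContinuousLinearMap.id ℝ ℂ)) y :=
      (hB.differentiable (by simp) _).hasFDerivAt.comp y ((hasFDerivAt_id y).const_smul R⁻¹)
    rw [h1.fderiv, ContinuousLinearMap.comp_smul, norm_smul, norm_inv, Real.norm_eq_abs,
      abs_of_pos hR, ContinuousLinearMap.comp_id, div_eq_inv_mul]
    gcongr
    exact hM _

theorem setLIntegral_cauchyT_dz_le {h : ℂ → ℂ} (hh : ContDiff ℝ (⊤ : ℕ∞) h)
    (hc : HasCompactSupport h) (hD : tsupport h ⊆ ball 0 1) :
    ∃ C : ℝ, 0 ≤ C ∧ ∀ R : ℝ, 2 ≤ R → ∫⁻ y in ball 0 R, ‖cauchyT (dz h) y‖ₑ ^ 2 ≤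
      ENNReal.ofReal (π ^ 2) * (∫⁻ y, ‖h y‖ₑ ^ 2) + ENNReal.ofReal (C / R ^ 2) := by
  obtain ⟨M, hM0, hM⟩ := exists_cutoff_scale
  set I := ∫ x, ‖h x‖ with hI
  have hI0 : 0 ≤ I := integral_nonneg fun x => norm_nonneg _
  refine ⟨(2 * I * M) ^ 2 * 9 * π, by positivity, fun R hR => ?_⟩
  have hR0 : 0 < R := by linarith
  obtain ⟨χ, hχ, hχc, hχ1, hχin, hχout, hχd⟩ := hM R hR0
  have hu := contDiff_cauchyT hh hc
  have hχu : ContDiff ℝ (⊤ : ℕ∞) fun y => χ y * cauchyT h y := hχ.mul hu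
  have hχuc : HasCompactSupport fun y => χ y * cauchyT h y := hχc.mul_right
  have hd {g : ℂ → ℂ} (hg : ContDiff ℝ (⊤ : ℕ∞) g) (y : ℂ) : DifferentiableAt ℝ g y :=
    hg.differentiable (by simp) y
  have hbar (y : ℂ) : ‖dzbar (fun y => χ y * cauchyT h y) y‖ₑ ^ 2 ≤
      ENNReal.ofReal (π ^ 2) * ‖h y‖ₑ ^ 2 + (ball 0 (3 * R)).indicator
        (fun _ => ENNReal.ofReal ((2 * I * M / R ^ 2) ^ 2)) y := by
    by_cases hy : ‖y‖ < R
    · have he : (fun y => χ y * cauchyT h y) =ᶠ[𝓝 y] cauchyT h := by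
        filter_upwards [(isOpen_lt continuous_norm continuous_const).mem_nhds hy] with z hz
        rw [hχin z hz, one_mul]
      rw [dzbar_congr he, dzbar_cauchyT hh hc, enorm_mul, mul_pow]
      refine le_add_right (le_of_eq ?_)
      rw [ENNReal.ofReal_pow pi_pos.le, ← ofReal_norm, Complex.norm_real, Real.norm_eq_abs,
        abs_of_pos pi_pos]
    · rw [not_lt] at hy
      have hy0 : h y = 0 := by
        refine image_eq_zero_of_notMem_tsupport fun hy' => ?_
        have := mem_ball_zero_iff.1 (hD hy')
        linarith
      refine le_add_left ?_
      by_cases hy3 : y ∈ ball (0 : ℂ) (3 * R)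
      · rw [indicator_of_mem hy3, dzbar_mul (hd hχ y) (hd hu y), dzbar_cauchyT hh hc, hy0,
          mul_zero, mul_zero, add_zero, ← ofReal_norm,
          ← ENNReal.ofReal_pow (norm_nonneg _)]
        refine ENNReal.ofReal_le_ofReal (pow_le_pow_left₀ (norm_nonneg _) ?_ 2)
        rw [norm_mul]
        calc ‖dzbar χ y‖ * ‖cauchyT h y‖ ≤ (M / R) * (2 / R * I) := by
              gcongr
              · exact (norm_dzbar_le _ _).trans (hχd y)
              · refine (norm_cauchyT_le hh.continuous hc hD (hR.trans hy)).trans ?_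
                rw [← hI]
                gcongr
          _ = _ := by field_simp
      · rw [mem_ball_zero_iff, not_lt] at hy3
        have he : (fun y => χ y * cauchyT h y) =ᶠ[𝓝 y] fun _ => 0 := by
          filter_upwards [hχout y (by linarith)] with z hz
          simp [hz]
        rw [dzbar_congr he]
        simp [dzbar]
  calc ∫⁻ y in ball 0 R, ‖cauchyT (dz h) y‖ₑ ^ 2
      = ∫⁻ y in ball 0 R, ‖dz (fun y => χ y * cauchyT h y) y‖ₑ ^ 2 := by
        refine setLIntegral_congr_fun measurableSet_ball fun y hy => ?_
        have he : (fun y => χ y * cauchyT h y) =ᶠ[𝓝 y] cauchyT h := by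
          filter_upwards [isOpen_ball.mem_nhds hy] with z hz
          rw [hχin z (mem_ball_zero_iff.1 hz), one_mul]
        simp only [dz_congr he, dz_cauchyT hh hc]
    _ ≤ ∫⁻ y, ‖dz (fun y => χ y * cauchyT h y) y‖ₑ ^ 2 := setLIntegral_le_lintegral _ _
    _ = ∫⁻ y, ‖dzbar (fun y => χ y * cauchyT h y) y‖ₑ ^ 2 := lintegral_normSq_dz hχu hχuc
    _ ≤ ∫⁻ y, (ENNReal.ofReal (π ^ 2) * ‖h y‖ₑ ^ 2 + (ball 0 (3 * R)).indicator
        (fun _ => ENNReal.ofReal ((2 * I * M / R ^ 2) ^ 2)) y) := lintegral_mono hbar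
    _ = ENNReal.ofReal (π ^ 2) * (∫⁻ y, ‖h y‖ₑ ^ 2) +
        ENNReal.ofReal ((2 * I * M / R ^ 2) ^ 2) * volume (ball (0 : ℂ) (3 * R)) := by
        rw [lintegral_add_right _ (measurable_const.indicator measurableSet_ball),
          lintegral_const_mul _ (hh.continuous.measurable.enorm.pow_const 2),
          lintegral_indicator_const measurableSet_ball]
    _ = _ := by
        congr 1
        rw [volume_ball_complex, ← ENNReal.ofReal_pow (by linarith),
          show (NNReal.pi : ℝ≥0∞) = ENNReal.ofReal π by
            rw [← NNReal.coe_real_pi, ENNReal.ofReal_coe_nnreal],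
          ← ENNReal.ofReal_mul (by positivity), ← ENNReal.ofReal_mul (by positivity)]
        congr 1
        field_simp
        norm_num

theorem lintegral_cauchyT_dz_le {h : ℂ → ℂ} (hh : ContDiff ℝ (⊤ : ℕ∞) h)
    (hc : HasCompactSupport h) (hD : tsupport h ⊆ ball 0 1) :
    ∫⁻ y, ‖cauchyT (dz h) y‖ₑ ^ 2 ≤ ENNReal.ofReal (π ^ 2) * ∫⁻ y, ‖h y‖ₑ ^ 2 := by
  obtain ⟨C, hC0, hC⟩ := setLIntegral_cauchyT_dz_le hh hc hD
  have hlim : Tendsto (fun n : ℕ => ENNReal.ofReal (π ^ 2) * (∫⁻ y, ‖h y‖ₑ ^ 2) +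
      ENNReal.ofReal (C / (n : ℝ) ^ 2)) atTop
      (𝓝 (ENNReal.ofReal (π ^ 2) * (∫⁻ y, ‖h y‖ₑ ^ 2) + ENNReal.ofReal 0)) := by
    refine tendsto_const_nhds.add (ENNReal.tendsto_ofReal ?_)
    exact Tendsto.div_atTop tendsto_const_nhds
      ((tendsto_pow_atTop two_ne_zero).comp tendsto_natCast_atTop_atTop)
  rw [ENNReal.ofReal_zero, add_zero] at hlim
  rw [← setLIntegral_univ, ← iUnion_ball_nat (0 : ℂ), setLIntegral_iUnion_of_directed]
  · refine iSup_le fun n => ge_of_tendsto hlim ?_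
    filter_upwards [eventually_ge_atTop n, eventually_ge_atTop 2] with k hk hk2
    exact (lintegral_mono_set (ball_subset_ball (by exact_mod_cast hk))).trans
      (hC k (by exact_mod_cast hk2))
  · exact Monotone.directed_le fun m n hmn => ball_subset_ball (by exact_mod_cast hmn)

theorem ENNReal.add_sq_le_two_mul (a b : ℝ≥0∞) : (a + b) ^ 2 ≤ 2 * (a ^ 2 + b ^ 2) := by
  rcases eq_or_ne a ⊤ with rfl | ha
  · simp
  rcases eq_or_ne b ⊤ with rfl | hb
  · simp
  lift a to ℝ≥0 using ha
  lift b to ℝ≥0 using hb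
  exact_mod_cast add_sq_le (a := a) (b := b)

theorem abs_det_le_one_of_norm_le {A : ℂ →L[ℝ] ℂ} (hA : ∀ v, ‖A v‖ ≤ ‖v‖) : |A.det| ≤ 1 := by
  have h := Measure.addHaar_image_continuousLinearMap (volume : Measure ℂ) A (ball 0 1)
  have h1 : A '' ball 0 1 ⊆ ball 0 1 := by
    rintro _ ⟨v, hv, rfl⟩
    rw [mem_ball_zero_iff] at *
    exact (hA v).trans_lt hv
  have h2 : volume (A '' ball 0 1) ≤ 1 * volume (ball (0 : ℂ) 1) := by
    rw [one_mul]; exact measure_mono h1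
  rw [h] at h2
  have h3 := (ENNReal.mul_le_mul_iff_left (measure_ball_pos volume (0 : ℂ) one_pos).ne'
    measure_ball_lt_top.ne).1 h2
  simpa using h3

theorem reflInt_eq_cauchyT {h : ℂ → ℂ} (hh : ContDiff ℝ (⊤ : ℕ∞) h) (hc : HasCompactSupport h)
    (hD : tsupport h ⊆ ball 0 1) {ζ : ℂ} (hζ : 1 < ‖ζ‖) :
    reflInt h ((starRingEnd ℂ) ζ⁻¹) = -cauchyT (dz h) ζ := by
  have hζn : ζ ∉ tsupport h := fun h' => by
    have := mem_ball_zero_iff.1 (hD h')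
    linarith
  have hζ0 : ζ ≠ 0 := norm_pos_iff.1 (by linarith)
  rw [cauchyT_dz_eq hh hc hζn, neg_neg, reflInt]
  congr 1 with x
  by_cases hx : x ∈ tsupport h
  · have hne : x - ζ ≠ 0 := sub_ne_zero.2 fun e => hζn (e ▸ hx)
    have hne' : ζ - x ≠ 0 := sub_ne_zero.2 fun e => hζn (e ▸ hx)
    congr 1
    rw [kerRefl, Complex.conj_conj]
    have : ζ⁻¹ / (1 - x * ζ⁻¹) = -(x - ζ)⁻¹ := by
      have h1 : 1 - x * ζ⁻¹ = (ζ - x) * ζ⁻¹ := by field_simp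
      rw [h1, div_eq_iff (mul_ne_zero hne' (inv_ne_zero hζ0)), ← inv_neg, neg_sub]
      field_simp
    rw [this]
    ring
  · simp [image_eq_zero_of_notMem_tsupport hx]

theorem setLIntegral_reflInt_le {h : ℂ → ℂ} (hh : ContDiff ℝ (⊤ : ℕ∞) h)
    (hc : HasCompactSupport h) (hD : tsupport h ⊆ ball 0 1) :
    ∫⁻ y in ball 0 1, ‖reflInt h y‖ₑ ^ 2 ≤ ENNReal.ofReal (π ^ 2) * ∫⁻ y, ‖h y‖ₑ ^ 2 := by
  set S : Set ℂ := {ζ | 1 < ‖ζ‖} with hS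
  have hSm : MeasurableSet S := (isOpen_lt continuous_const continuous_norm).measurableSet
  set T : ℂ → ℂ := fun ζ => (starRingEnd ℂ) ζ⁻¹ with hT
  have hS0 {ζ : ℂ} (hζ : ζ ∈ S) : ζ ≠ 0 := by
    have : 1 < ‖ζ‖ := hζ
    exact norm_pos_iff.1 (by linarith)
  have hTd {ζ : ℂ} (hζ : ζ ∈ S) : HasFDerivAt T (((Complex.conjCLE : ℂ →L[ℝ] ℂ)) ∘L
      ((ContinuousLinearMap.toSpanSingleton ℂ (-(ζ ^ 2)⁻¹)).restrictScalars ℝ)) ζ := by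
    have h1 := ((hasDerivAt_inv (hS0 hζ)).hasFDerivAt.restrictScalars ℝ)
    exact (Complex.conjCLE.hasFDerivAt (x := ζ⁻¹)).comp ζ h1
  have hTi : InjOn T S := by
    intro a _ b _ hab
    have : a⁻¹ = b⁻¹ := (starRingEnd ℂ).injective hab
    exact inv_injective this
  have him : ball (0 : ℂ) 1 ⊆ T '' S ∪ {0} := by
    intro y hy
    by_cases hy0 : y = 0
    · exact Or.inr hy0
    · refine Or.inl ⟨(starRingEnd ℂ) y⁻¹, ?_, by simp [hT]⟩
      rw [mem_ball_zero_iff] at hy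
      change 1 < ‖(starRingEnd ℂ) y⁻¹‖
      rw [RCLike.norm_conj, norm_inv]
      exact (one_lt_inv₀ (norm_pos_iff.2 hy0)).2 hy
  calc ∫⁻ y in ball 0 1, ‖reflInt h y‖ₑ ^ 2 ≤ ∫⁻ y in T '' S ∪ {0}, ‖reflInt h y‖ₑ ^ 2 :=
        lintegral_mono_set him
    _ ≤ (∫⁻ y in T '' S, ‖reflInt h y‖ₑ ^ 2) + ∫⁻ y in {0}, ‖reflInt h y‖ₑ ^ 2 :=
        lintegral_union_le _ _ _
    _ = ∫⁻ y in T '' S, ‖reflInt h y‖ₑ ^ 2 := by simp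
    _ = _ := lintegral_image_eq_lintegral_abs_det_fderiv_mul volume hSm
        (fun ζ hζ => (hTd hζ).hasFDerivWithinAt) hTi _
    _ ≤ ∫⁻ ζ in S, ‖cauchyT (dz h) ζ‖ₑ ^ 2 := by
        refine setLIntegral_mono' hSm fun ζ hζ => ?_
        have hdet : ENNReal.ofReal |(((Complex.conjCLE : ℂ →L[ℝ] ℂ)) ∘L
          ((ContinuousLinearMap.toSpanSingleton ℂ (-(ζ ^ 2)⁻¹)).restrictScalars ℝ)).det| ≤ 1 := by
          rw [ENNReal.ofReal_le_one]
          refine abs_det_le_one_of_norm_le fun v => ?_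
          simp only [ContinuousLinearMap.coe_comp, Function.comp_apply,
            ContinuousLinearMap.coe_restrictScalars', ContinuousLinearMap.toSpanSingleton_apply,
            ContinuousLinearEquiv.coe_coe, Complex.conjCLE_apply, RCLike.norm_conj, norm_smul,
            norm_neg, norm_inv, norm_pow]
          refine mul_le_of_le_one_right (norm_nonneg _) (inv_le_one_of_one_le₀ ?_)
          exact one_le_pow₀ (le_of_lt hζ)
        have e : reflInt h (T ζ) = -cauchyT (dz h) ζ := reflInt_eq_cauchyT hh hc hD hζ
        rw [e, enorm_neg]
        exact (mul_le_mul_left hdet _).trans_eq (one_mul _)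
    _ ≤ ∫⁻ ζ, ‖cauchyT (dz h) ζ‖ₑ ^ 2 := setLIntegral_le_lintegral _ _
    _ ≤ _ := lintegral_cauchyT_dz_le hh hc hD

theorem setLIntegral_vOp_le {h : ℂ → ℂ} (hh : ContDiff ℝ (⊤ : ℕ∞) h)
    (hc : HasCompactSupport h) (hD : tsupport h ⊆ ball 0 1) :
    ∫⁻ y in ball 0 1, ‖vOp h y‖ₑ ^ 2 ≤ ENNReal.ofReal (4 * π ^ 2) * ∫⁻ y, ‖h y‖ₑ ^ 2 := by
  have hm : Measurable fun y => ‖cauchyT (dz h) y‖ₑ ^ 2 :=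
    ((contDiff_cauchyT (contDiff_dz hh) hc.dz).continuous.measurable.enorm.pow_const 2)
  calc ∫⁻ y in ball 0 1, ‖vOp h y‖ₑ ^ 2
      ≤ ∫⁻ y in ball 0 1, 2 * (‖cauchyT (dz h) y‖ₑ ^ 2 + ‖reflInt h y‖ₑ ^ 2) := by
        refine lintegral_mono fun y => ?_
        calc ‖vOp h y‖ₑ ^ 2 ≤ (‖cauchyT (dz h) y‖ₑ + ‖reflInt h y‖ₑ) ^ 2 := by
              gcongr
              exact enorm_add_le _ _
          _ ≤ 2 * (‖cauchyT (dz h) y‖ₑ ^ 2 + ‖reflInt h y‖ₑ ^ 2) := ENNReal.add_sq_le_two_mul _ _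
    _ = 2 * ((∫⁻ y in ball 0 1, ‖cauchyT (dz h) y‖ₑ ^ 2) +
          ∫⁻ y in ball 0 1, ‖reflInt h y‖ₑ ^ 2) := by
        rw [lintegral_const_mul' _ _ (by finiteness), lintegral_add_left hm]
    _ ≤ 2 * (ENNReal.ofReal (π ^ 2) * (∫⁻ y, ‖h y‖ₑ ^ 2) +
          ENNReal.ofReal (π ^ 2) * ∫⁻ y, ‖h y‖ₑ ^ 2) := by
        gcongr
        · exact (setLIntegral_le_lintegral _ _).trans (lintegral_cauchyT_dz_le hh hc hD)
        · exact setLIntegral_reflInt_le hh hc hD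
    _ = _ := by
        rw [ENNReal.ofReal_mul (by norm_num)]
        norm_num
        ring

theorem integral_dzbar_eq_zero {ψ : ℂ → ℂ} (hψ : ContDiff ℝ (⊤ : ℕ∞) ψ)
    (hc : HasCompactSupport ψ) : ∫ z, dzbar ψ z = 0 := by
  have hi (v : ℂ) : Integrable fun z => fderiv ℝ ψ z v :=
    (contDiff_fderiv_apply hψ v).continuous.integrable_of_hasCompactSupport (hc.fderiv_apply ℝ v)
  simp only [dzbar]
  rw [integral_div, integral_add (hi 1) ((hi Complex.I).const_mul _), integral_const_mul,
    integral_fderiv_eq_zero hψ hc, integral_fderiv_eq_zero hψ hc]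
  simp

theorem integrable_mul_of_tsupport {A B : ℂ → ℂ} (hA : Continuous A) (hAc : HasCompactSupport A)
    (hB : Continuous B) : Integrable fun z => A z * B z :=
  (hA.mul hB).integrable_of_hasCompactSupport hAc.mul_right

theorem integral_mul_dz_eq {A B : ℂ → ℂ} (hA : ContDiff ℝ (⊤ : ℕ∞) A) (hAc : HasCompactSupport A)
    (hAD : tsupport A ⊆ ball 0 1) (hB : ContDiffOn ℝ (⊤ : ℕ∞) B (ball 0 1)) :
    ∫ z, A z * dz B z = -∫ z, dz A z * B z := by
  obtain ⟨r, hr0, hr1, hr⟩ := exists_lt_one_subset_ball hAc hAD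
  obtain ⟨g, hg, hgc, hgB⟩ := exists_smooth_extension hB hr0 hr1
  have e1 : (fun z => A z * dz B z) = fun z => A z * dz g z := by
    funext z
    by_cases hz : z ∈ tsupport A
    · rw [dz_congr (ψ := B) (χ := g)]
      filter_upwards [isOpen_ball.mem_nhds (hr hz)] with w hw using (hgB hw).symm
    · simp [image_eq_zero_of_notMem_tsupport hz]
  have e2 : (fun z => dz A z * B z) = fun z => dz A z * g z := by
    funext z
    by_cases hz : z ∈ tsupport A
    · rw [hgB (hr hz)]
    · simp [image_eq_zero_of_notMem_tsupport fun h => hz (tsupport_dz_subset A h)]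
  have h0 := integral_dz_eq_zero (hA.mul hg) hAc.mul_right
  have hd (z : ℂ) : dz (fun w => A w * g w) z = dz A z * g z + A z * dz g z :=
    dz_mul (hA.differentiable (by simp) z) (hg.differentiable (by simp) z)
  simp only [hd] at h0
  rw [integral_add (integrable_mul_of_tsupport (contDiff_dz hA).continuous hAc.dz hg.continuous)
    (integrable_mul_of_tsupport hA.continuous hAc (contDiff_dz hg).continuous)] at h0
  rw [e1, e2]
  linear_combination h0

theorem integral_mul_dzbar_eq {A B : ℂ → ℂ} (hA : ContDiff ℝ (⊤ : ℕ∞) A)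
    (hAc : HasCompactSupport A)
    (hAD : tsupport A ⊆ ball 0 1) (hB : ContDiffOn ℝ (⊤ : ℕ∞) B (ball 0 1)) :
    ∫ z, A z * dzbar B z = -∫ z, dzbar A z * B z := by
  obtain ⟨r, hr0, hr1, hr⟩ := exists_lt_one_subset_ball hAc hAD
  obtain ⟨g, hg, hgc, hgB⟩ := exists_smooth_extension hB hr0 hr1
  have e1 : (fun z => A z * dzbar B z) = fun z => A z * dzbar g z := by
    funext z
    by_cases hz : z ∈ tsupport A
    · rw [dzbar_congr (ψ := B) (χ := g)]
      filter_upwards [isOpen_ball.mem_nhds (hr hz)] with w hw using (hgB hw).symm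
    · simp [image_eq_zero_of_notMem_tsupport hz]
  have e2 : (fun z => dzbar A z * B z) = fun z => dzbar A z * g z := by
    funext z
    by_cases hz : z ∈ tsupport A
    · rw [hgB (hr hz)]
    · simp [image_eq_zero_of_notMem_tsupport fun h => hz (tsupport_dzbar_subset A h)]
  have h0 := integral_dzbar_eq_zero (hA.mul hg) hAc.mul_right
  have hd (z : ℂ) : dzbar (fun w => A w * g w) z = dzbar A z * g z + A z * dzbar g z :=
    dzbar_mul (hA.differentiable (by simp) z) (hg.differentiable (by simp) z)
  simp only [hd] at h0
  rw [integral_add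
    (integrable_mul_of_tsupport (contDiff_dzbar hA).continuous hAc.dzbar hg.continuous)
    (integrable_mul_of_tsupport hA.continuous hAc (contDiff_dzbar hg).continuous)] at h0
  rw [e1, e2]
  linear_combination h0

theorem contDiffOn_fderiv_apply {F : Type*} [NormedAddCommGroup F] [NormedSpace ℝ F] {f : ℂ → F}
    {U : Set ℂ} (hU : IsOpen U) (hf : ContDiffOn ℝ (⊤ : ℕ∞) f U) (v : ℂ) :
    ContDiffOn ℝ (⊤ : ℕ∞) (fun z => fderiv ℝ f z v) U :=
  (hf.fderiv_of_isOpen hU (by simp)).clm_apply contDiffOn_const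

theorem contDiffOn_dz {ψ : ℂ → ℂ} {U : Set ℂ} (hU : IsOpen U)
    (hψ : ContDiffOn ℝ (⊤ : ℕ∞) ψ U) : ContDiffOn ℝ (⊤ : ℕ∞) (dz ψ) U :=
  ((contDiffOn_fderiv_apply hU hψ 1).sub
    (contDiffOn_const.mul (contDiffOn_fderiv_apply hU hψ Complex.I))).div_const 2

theorem contDiffOn_dzbar {ψ : ℂ → ℂ} {U : Set ℂ} (hU : IsOpen U)
    (hψ : ContDiffOn ℝ (⊤ : ℕ∞) ψ U) : ContDiffOn ℝ (⊤ : ℕ∞) (dzbar ψ) U :=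
  ((contDiffOn_fderiv_apply hU hψ 1).add
    (contDiffOn_const.mul (contDiffOn_fderiv_apply hU hψ Complex.I))).div_const 2

theorem integral_mul_dz_dz_eq {A B : ℂ → ℂ} (hA : ContDiff ℝ (⊤ : ℕ∞) A)
    (hAc : HasCompactSupport A)
    (hAD : tsupport A ⊆ ball 0 1) (hB : ContDiffOn ℝ (⊤ : ℕ∞) B (ball 0 1)) :
    ∫ z, A z * dz (dz B) z = ∫ z, dz (dz A) z * B z := by
  rw [integral_mul_dz_eq hA hAc hAD (contDiffOn_dz isOpen_ball hB),
    integral_mul_dz_eq (contDiff_dz hA) hAc.dz ((tsupport_dz_subset A).trans hAD) hB, neg_neg]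

theorem integral_mul_dz_dzbar_eq {A B : ℂ → ℂ} (hA : ContDiff ℝ (⊤ : ℕ∞) A)
    (hAc : HasCompactSupport A)
    (hAD : tsupport A ⊆ ball 0 1) (hB : ContDiffOn ℝ (⊤ : ℕ∞) B (ball 0 1)) :
    ∫ z, A z * dz (dzbar B) z = ∫ z, dzbar (dz A) z * B z := by
  rw [integral_mul_dz_eq hA hAc hAD (contDiffOn_dzbar isOpen_ball hB),
    integral_mul_dzbar_eq (contDiff_dz hA) hAc.dz ((tsupport_dz_subset A).trans hAD) hB, neg_neg]

theorem vOp_boundary {h : ℂ → ℂ} (hh : ContDiff ℝ (⊤ : ℕ∞) h)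
    (hc : HasCompactSupport h) (hD : tsupport h ⊆ ball 0 1) :
    ∃ r C : ℝ, 0 < r ∧ r < 1 ∧ 0 ≤ C ∧ tsupport h ⊆ ball 0 r ∧ ∀ y : ℂ, r < ‖y‖ → ‖y‖ < 1 →
      ‖vOp h y‖ ≤ C * (1 - ‖y‖) ∧ ‖fderiv ℝ (vOp h) y‖ ≤ C := by
  obtain ⟨r, hr0, hr1, hr⟩ := exists_lt_one_subset_ball hc hD
  set m := (1 - r) / 2 with hm
  have hm0 : 0 < m := by rw [hm]; linarith
  set I := ∫ x, ‖h x‖ with hI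
  have hI0 : 0 ≤ I := integral_nonneg fun x => norm_nonneg _
  have hhi : Integrable fun x => ‖h x‖ := (hh.continuous.integrable_of_hasCompactSupport hc).norm
  have hn {x : ℂ} (hx : x ∈ tsupport h) : ‖x‖ ≤ 1 := (mem_ball_zero_iff.1 (hD hx)).le
  have hfar {x y : ℂ} (hx : x ∈ tsupport h) (hy : (1 + r) / 2 < ‖y‖) : m ≤ ‖x - y‖ := by
    have h1 := mem_ball_zero_iff.1 (hr hx)
    have h2 := norm_sub_norm_le y x
    rw [norm_sub_rev] at h2
    rw [hm]
    linarith
  have hnot {y : ℂ} (hy : (1 + r) / 2 < ‖y‖) : y ∉ tsupport h := fun h' => by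
    have := mem_ball_zero_iff.1 (hr h')
    linarith
  refine ⟨(1 + r) / 2, I * (8 / m ^ 3), by linarith, by linarith, by positivity,
    hr.trans (ball_subset_ball (by linarith)), fun y hy hy1 => ⟨?_, ?_⟩⟩
  · rw [vOp_eq_integral hh hc hD (mem_ball_zero_iff.2 hy1) (hnot hy)]
    have h0 : I * (8 / m ^ 3) * (1 - ‖y‖) = ∫ x, ‖h x‖ * (8 * (1 - ‖y‖) / m ^ 3) := by
      rw [integral_mul_const, ← hI]
      ring
    rw [h0]
    refine norm_integral_le_of_norm_le (hhi.mul_const _) (Eventually.of_forall fun x => ?_)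
    rw [norm_mul]
    by_cases hx : x ∈ tsupport h
    · gcongr
      exact norm_kerV_le_boundary hm0 (hn hx) hy1 (hfar hx hy)
    · simp [image_eq_zero_of_notMem_tsupport hx]
  · refine norm_fderiv_le_of_lip' ℝ (by positivity) ?_
    have hopen : {z : ℂ | (1 + r) / 2 < ‖z‖ ∧ ‖z‖ < 1} ∈ 𝓝 y :=
      ((isOpen_lt continuous_const continuous_norm).inter
        (isOpen_lt continuous_norm continuous_const)).mem_nhds ⟨hy, hy1⟩
    filter_upwards [hopen] with z hz
    obtain ⟨hz, hz1⟩ := hz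
    have hinteg {w : ℂ} (hw : (1 + r) / 2 < ‖w‖) (hw1 : ‖w‖ < 1) :
        Integrable fun x => h x * kerV x w :=
      integrable_mul_of_le_on_tsupport hh.continuous hc (measurable_kerV_left w)
        (C := 2 / m ^ 2) fun x hx => norm_kerV_le hm0 (hn hx) hw1.le (hfar hx hw)
    rw [vOp_eq_integral hh hc hD (mem_ball_zero_iff.2 hy1) (hnot hy),
      vOp_eq_integral hh hc hD (mem_ball_zero_iff.2 hz1) (hnot hz),
      ← integral_sub (hinteg hz hz1) (hinteg hy hy1)]
    have h0 : I * (8 / m ^ 3) * ‖z - y‖ = ∫ x, ‖h x‖ * (8 * ‖z - y‖ / m ^ 3) := by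
      rw [integral_mul_const, ← hI]
      ring
    rw [h0]
    refine norm_integral_le_of_norm_le (hhi.mul_const _) (Eventually.of_forall fun x => ?_)
    rw [← mul_sub, norm_mul]
    by_cases hx : x ∈ tsupport h
    · gcongr
      refine (norm_kerV_sub_le hm0 (hn hx) hz1.le hy1.le (hfar hx hz) (hfar hx hy)).trans ?_
      gcongr
      norm_num
    · simp [image_eq_zero_of_notMem_tsupport hx]

/-- A smooth cutoff of the unit disc at distance comparable to `δ` from the circle. -/
def discCut (δ : ℝ) (y : ℂ) : ℂ := ((Real.smoothTransition ((1 - ‖y‖ ^ 2) / δ - 1) : ℝ) : ℂ)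

theorem exists_deriv_smoothTransition_le : ∃ M : ℝ, 0 ≤ M ∧
    (∀ t, |deriv Real.smoothTransition t| ≤ M) ∧
    ∀ t, |deriv (deriv Real.smoothTransition) t| ≤ M := by
  have hs : ContDiff ℝ (⊤ : ℕ∞) Real.smoothTransition := Real.smoothTransition.contDiff
  have h1 : ContDiff ℝ (⊤ : ℕ∞) (deriv Real.smoothTransition) :=
    ContDiff.deriv' (by simpa using hs)
  have h2 : ContDiff ℝ (⊤ : ℕ∞) (deriv (deriv Real.smoothTransition)) :=
    ContDiff.deriv' (by simpa using h1)
  have hc : HasCompactSupport (deriv Real.smoothTransition) := by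
    refine HasCompactSupport.intro (K := Icc 0 1) isCompact_Icc fun t ht => ?_
    rcases lt_or_ge t 0 with h | h
    · have : Real.smoothTransition =ᶠ[𝓝 t] fun _ => 0 := by
        filter_upwards [Iio_mem_nhds h] with s hs
        exact Real.smoothTransition.zero_of_nonpos (le_of_lt hs)
      rw [this.deriv_eq]; simp
    · have h' : 1 < t := by
        by_contra h''
        exact ht ⟨h, not_lt.1 h''⟩
      have : Real.smoothTransition =ᶠ[𝓝 t] fun _ => 1 := by
        filter_upwards [Ioi_mem_nhds h'] with s hs
        exact Real.smoothTransition.one_of_one_le (le_of_lt hs)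
      rw [this.deriv_eq]; simp
  obtain ⟨M₁, hM₁⟩ := h1.continuous.bounded_above_of_compact_support hc
  obtain ⟨M₂, hM₂⟩ := h2.continuous.bounded_above_of_compact_support hc.deriv
  exact ⟨max M₁ M₂, (norm_nonneg _).trans ((hM₁ 0).trans (le_max_left _ _)),
    fun t => (hM₁ t).trans (le_max_left _ _), fun t => (hM₂ t).trans (le_max_right _ _)⟩

theorem fderiv_comp_normSq {k : ℝ → ℝ} (δ : ℝ) (hk : Differentiable ℝ k) (y v : ℂ) :
    fderiv ℝ (fun w : ℂ => ((k ((1 - ‖w‖ ^ 2) / δ - 1) : ℝ) : ℂ)) y v =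
      ((deriv k ((1 - ‖y‖ ^ 2) / δ - 1) * (-(2 * (y.re * v.re + y.im * v.im)) / δ) : ℝ) : ℂ) := by
  have h1 : HasFDerivAt (fun w : ℂ => (1 - ‖w‖ ^ 2) / δ - 1)
      (-(2 / δ) • innerSL ℝ y) y := by
    have := ((((hasStrictFDerivAt_norm_sq y).hasFDerivAt.const_sub 1).mul_const δ⁻¹).sub_const 1)
    simp only [← div_eq_mul_inv] at this
    refine this.congr_fderiv ?_
    ext w <;> simp [div_eq_mul_inv] <;> ring
  have h2 := ((hk _).hasDerivAt.comp_hasFDerivAt y h1)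
  have h3 := Complex.ofRealCLM.hasFDerivAt.comp y h2
  have h4 : fderiv ℝ (fun w : ℂ => ((k ((1 - ‖w‖ ^ 2) / δ - 1) : ℝ) : ℂ)) y = _ := h3.fderiv
  rw [h4]
  simp [Complex.inner]
  ring_nf

theorem dz_comp_normSq {k : ℝ → ℝ} (δ : ℝ) (hk : Differentiable ℝ k) (y : ℂ) :
    dz (fun w : ℂ => ((k ((1 - ‖w‖ ^ 2) / δ - 1) : ℝ) : ℂ)) y =
      ((deriv k ((1 - ‖y‖ ^ 2) / δ - 1) : ℝ) : ℂ) * (-(starRingEnd ℂ) y / δ) := by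
  rw [dz, fderiv_comp_normSq δ hk, fderiv_comp_normSq δ hk]
  apply Complex.ext <;> simp <;> ring

theorem dzbar_comp_normSq {k : ℝ → ℝ} (δ : ℝ) (hk : Differentiable ℝ k) (y : ℂ) :
    dzbar (fun w : ℂ => ((k ((1 - ‖w‖ ^ 2) / δ - 1) : ℝ) : ℂ)) y =
      ((deriv k ((1 - ‖y‖ ^ 2) / δ - 1) : ℝ) : ℂ) * (-y / δ) := by
  rw [dzbar, fderiv_comp_normSq δ hk, fderiv_comp_normSq δ hk]
  apply Complex.ext <;> simp <;> ring

theorem contDiff_comp_normSq {k : ℝ → ℝ} (δ : ℝ) (hk : ContDiff ℝ (⊤ : ℕ∞) k) :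
    ContDiff ℝ (⊤ : ℕ∞) fun w : ℂ => ((k ((1 - ‖w‖ ^ 2) / δ - 1) : ℝ) : ℂ) :=
  Complex.ofRealCLM.contDiff.comp
    (hk.comp (((contDiff_const.sub (contDiff_norm_sq ℝ)).div_const δ).sub contDiff_const))

theorem contDiff_discCut (δ : ℝ) : ContDiff ℝ (⊤ : ℕ∞) (discCut δ) :=
  contDiff_comp_normSq δ Real.smoothTransition.contDiff

theorem norm_discCut_le (δ : ℝ) (y : ℂ) : ‖discCut δ y‖ ≤ 1 := by
  rw [discCut, Complex.norm_real, Real.norm_eq_abs, abs_of_nonneg (Real.smoothTransition.nonneg _)]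
  exact Real.smoothTransition.le_one _

theorem discCut_eq_one {δ : ℝ} (hδ : 0 < δ) {y : ℂ} (hy : ‖y‖ ^ 2 ≤ 1 - 2 * δ) :
    discCut δ y = 1 := by
  rw [discCut, Real.smoothTransition.one_of_one_le]
  · simp
  · rw [le_sub_iff_add_le, le_div_iff₀ hδ]; linarith

theorem discCut_eq_zero {δ : ℝ} (hδ : 0 < δ) {y : ℂ} (hy : 1 - δ ≤ ‖y‖ ^ 2) :
    discCut δ y = 0 := by
  rw [discCut, Real.smoothTransition.zero_of_nonpos]
  · simp
  · rw [sub_nonpos, div_le_iff₀ hδ]; linarith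

theorem tsupport_discCut_subset {δ : ℝ} (hδ : 0 < δ) :
    tsupport (discCut δ) ⊆ {y | ‖y‖ ^ 2 ≤ 1 - δ} := by
  refine closure_minimal (fun y hy => ?_)
    (isClosed_le (by fun_prop) continuous_const)
  by_contra h
  exact hy (discCut_eq_zero hδ (not_le.1 h).le)

theorem exists_discCut_bounds : ∃ M : ℝ, 0 ≤ M ∧ ∀ δ : ℝ, 0 < δ → δ ≤ 1 → ∀ y ∈ ball (0 : ℂ) 1,
    ‖dz (discCut δ) y‖ ≤ M / δ ∧ ‖dzbar (discCut δ) y‖ ≤ M / δ ∧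
      ‖dzbar (dz (discCut δ)) y‖ ≤ 2 * M / δ ^ 2 := by
  obtain ⟨M, hM, h1, h2⟩ := exists_deriv_smoothTransition_le
  have hs : ContDiff ℝ (⊤ : ℕ∞) Real.smoothTransition := Real.smoothTransition.contDiff
  have hs1 : ContDiff ℝ (⊤ : ℕ∞) (deriv Real.smoothTransition) :=
    ContDiff.deriv' (by simpa using hs)
  refine ⟨M, hM, fun δ hδ hδ1 y hy => ?_⟩
  have hy1 : ‖y‖ ≤ 1 := (mem_ball_zero_iff.1 hy).le
  have hd : dz (discCut δ) = fun y =>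
      ((deriv Real.smoothTransition ((1 - ‖y‖ ^ 2) / δ - 1) : ℝ) : ℂ)
      * (-(starRingEnd ℂ) y / δ) :=
    funext fun y => dz_comp_normSq δ (hs.differentiable (by simp)) y
  have hc : HasFDerivAt (fun w : ℂ => -(starRingEnd ℂ) w / (δ : ℂ))
      ((-(δ : ℂ)⁻¹) • (Complex.conjCLE : ℂ →L[ℝ] ℂ)) y := by
    have := ((Complex.conjCLE : ℂ →L[ℝ] ℂ).hasFDerivAt (x := y)).const_smul (-(δ : ℂ)⁻¹)
    refine this.congr_of_eventuallyEq (Eventually.of_forall fun w => ?_)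
    simp [div_eq_mul_inv, mul_comm]
  have hcd : dzbar (fun w : ℂ => -(starRingEnd ℂ) w / (δ : ℂ)) y = -(δ : ℂ)⁻¹ := by
    rw [dzbar, hc.fderiv]
    simp
    ring_nf
    simp
    ring
  refine ⟨?_, ?_, ?_⟩
  · rw [hd]
    simp only [norm_mul, Complex.norm_real, norm_div, norm_neg, RCLike.norm_conj, norm_eq_abs]
    rw [abs_of_pos hδ]
    calc _ ≤ M * (1 / δ) := by gcongr; exact h1 _
      _ = _ := by ring
  · have := dzbar_comp_normSq δ (hs.differentiable (by simp)) y
    change ‖dzbar (fun w : ℂ => ((Real.smoothTransition ((1 - ‖w‖ ^ 2) / δ - 1) : ℝ) : ℂ)) y‖ ≤ _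
    rw [this]
    simp only [norm_mul, Complex.norm_real, norm_div, norm_neg, norm_eq_abs]
    rw [abs_of_pos hδ]
    calc _ ≤ M * (1 / δ) := by gcongr; exact h1 _
      _ = _ := by ring
  · rw [hd, dzbar_mul ((contDiff_comp_normSq δ hs1).differentiable (by simp) y)
      hc.differentiableAt, hcd, dzbar_comp_normSq δ (hs1.differentiable (by simp))]
    refine (norm_add_le _ _).trans ?_
    simp only [norm_mul, Complex.norm_real, norm_div, norm_neg, norm_eq_abs, RCLike.norm_conj,
      norm_inv]
    rw [abs_of_pos hδ]
    calc _ ≤ M * (1 / δ) * (1 / δ) + M * (δ⁻¹ * δ⁻¹) := by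
          gcongr
          · exact h2 _
          · exact h1 _
          · rw [← mul_inv, inv_le_inv₀ hδ (by positivity)]; nlinarith
      _ = _ := by field_simp; ring

theorem contDiff_mul_of_tsupport {χ v : ℂ → ℂ} {U : Set ℂ} (hU : IsOpen U)
    (hχ : ContDiff ℝ (⊤ : ℕ∞) χ) (hsupp : tsupport χ ⊆ U) (hv : ContDiffOn ℝ (⊤ : ℕ∞) v U) :
    ContDiff ℝ (⊤ : ℕ∞) fun y => χ y * v y := by
  rw [contDiff_iff_contDiffAt]
  intro y
  by_cases hy : y ∈ tsupport χ
  · exact hχ.contDiffAt.mul (hv.contDiffAt (hU.mem_nhds (hsupp hy)))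
  · have : (fun y => χ y * v y) =ᶠ[𝓝 y] fun _ => 0 := by
      filter_upwards [(isClosed_tsupport χ).isOpen_compl.mem_nhds hy] with w hw
      simp [image_eq_zero_of_notMem_tsupport hw]
    exact contDiffAt_const.congr_of_eventuallyEq this

theorem dzbar_dz_mul {χ v : ℂ → ℂ} {U : Set ℂ} (hU : IsOpen U)
    (hχ : ContDiff ℝ (⊤ : ℕ∞) χ) (hv : ContDiffOn ℝ (⊤ : ℕ∞) v U) {y : ℂ} (hy : y ∈ U) :
    dzbar (dz fun w => χ w * v w) y =
      dzbar (dz χ) y * v y + dz χ y * dzbar v y + dzbar χ y * dz v y + χ y * dzbar (dz v) y := by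
  have hvd {w : ℂ} (hw : w ∈ U) : DifferentiableAt ℝ v w :=
    (hv.contDiffAt (hU.mem_nhds hw)).differentiableAt (by simp)
  have hdvd {w : ℂ} (hw : w ∈ U) : DifferentiableAt ℝ (dz v) w :=
    ((contDiffOn_dz hU hv).contDiffAt (hU.mem_nhds hw)).differentiableAt (by simp)
  have hχd : Differentiable ℝ χ := hχ.differentiable (by simp)
  have hdχd : Differentiable ℝ (dz χ) := (contDiff_dz hχ).differentiable (by simp)
  have e : dz (fun w => χ w * v w) =ᶠ[𝓝 y] fun w => dz χ w * v w + χ w * dz v w := by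
    filter_upwards [hU.mem_nhds hy] with w hw using dz_mul (hχd w) (hvd hw)
  have hadd := dzbar_add (f := fun w => dz χ w * v w) (g := fun w => χ w * dz v w)
    ((hdχd y).mul (hvd hy)) ((hχd y).mul (hdvd hy))
  rw [dzbar_congr e, hadd,
    dzbar_mul (hdχd y) (hvd hy), dzbar_mul (hχd y) (hdvd hy)]
  ring

theorem exists_norm_vOp_le {h : ℂ → ℂ} (hh : ContDiff ℝ (⊤ : ℕ∞) h)
    (hc : HasCompactSupport h) (hD : tsupport h ⊆ ball 0 1) :
    ∃ C : ℝ, ∀ y ∈ ball (0 : ℂ) 1, ‖vOp h y‖ ≤ C := by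
  obtain ⟨r, C, hr0, hr1, hC, -, hb⟩ := vOp_boundary hh hc hD
  obtain ⟨C', hC'⟩ := (isCompact_closedBall (0 : ℂ) r).exists_bound_of_continuousOn
    ((contDiffOn_vOp hh hc hD).continuousOn.mono (closedBall_subset_ball hr1))
  refine ⟨max C C', fun y hy => ?_⟩
  rcases le_or_gt ‖y‖ r with h' | h'
  · exact (hC' y (mem_closedBall_zero_iff.2 h')).trans (le_max_right _ _)
  · refine ((hb y h' (mem_ball_zero_iff.1 hy)).1.trans ?_).trans (le_max_left _ _)
    have := norm_nonneg y
    nlinarith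

theorem volume_annulus_le {δ : ℝ} (hδ : 0 < δ) (hδ1 : δ ≤ 1 / 4) :
    volume {y : ℂ | 1 - 2 * δ ≤ ‖y‖ ^ 2 ∧ ‖y‖ ^ 2 ≤ 1 - δ} ≤ ENNReal.ofReal (2 * π * δ) := by
  have hsub : {y : ℂ | 1 - 2 * δ ≤ ‖y‖ ^ 2 ∧ ‖y‖ ^ 2 ≤ 1 - δ} ⊆
      ball 0 1 \ ball 0 (√(1 - 2 * δ)) := by
    rintro y ⟨h1, h2⟩
    refine ⟨?_, ?_⟩
    · rw [mem_ball_zero_iff]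
      nlinarith [norm_nonneg y]
    · rw [mem_ball_zero_iff, not_lt]
      exact Real.sqrt_le_iff.2 ⟨norm_nonneg y, h1⟩
  refine (measure_mono hsub).trans ?_
  rw [measure_sdiff (ball_subset_ball (Real.sqrt_le_one.2 (by linarith)))
    measurableSet_ball.nullMeasurableSet measure_ball_lt_top.ne, volume_ball_complex,
    volume_ball_complex, ← ENNReal.ofReal_pow (Real.sqrt_nonneg _), Real.sq_sqrt (by linarith)]
  have hpi : ((NNReal.pi : ℝ≥0) : ℝ≥0∞) = ENNReal.ofReal π := by
    rw [← NNReal.coe_real_pi, ENNReal.ofReal_coe_nnreal]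
  rw [hpi, ENNReal.ofReal_one, one_pow, one_mul, ← ENNReal.ofReal_mul (by linarith),
    ← ENNReal.ofReal_sub _ (by have := Real.pi_pos; nlinarith)]
  apply ENNReal.ofReal_le_ofReal
  nlinarith [Real.pi_pos]

theorem exists_norm_le_near_sphere {φ : ℂ → ℂ} (hφ : ContinuousOn φ (closedBall 0 1))
    (h0 : ∀ y ∈ sphere (0 : ℂ) 1, φ y = 0) {ε : ℝ} (hε : 0 < ε) :
    ∃ r : ℝ, 0 < r ∧ r < 1 ∧ ∀ y, r ≤ ‖y‖ → ‖y‖ < 1 → ‖φ y‖ ≤ ε := by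
  have hK : IsCompact (closedBall (0 : ℂ) 1 ∩ {y | ε ≤ ‖φ y‖}) := by
    refine (isCompact_closedBall (0 : ℂ) 1).of_isClosed_subset ?_ inter_subset_left
    exact hφ.norm.preimage_isClosed_of_isClosed isClosed_closedBall isClosed_Ici
  obtain ⟨r, hr0, hr1, hr⟩ := exists_lt_one_subset_ball hK (by
    rintro y ⟨hy, hy'⟩
    rw [mem_closedBall_zero_iff] at hy
    rw [mem_ball_zero_iff]
    refine lt_of_le_of_ne hy fun h => ?_
    rw [mem_ofPred_eq, h0 y (mem_sphere_zero_iff_norm.2 h), norm_zero] at hy'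
    linarith)
  refine ⟨r, hr0, hr1, fun y hy hy1 => ?_⟩
  by_contra h
  have := mem_ball_zero_iff.1 (hr ⟨mem_closedBall_zero_iff.2 hy1.le, (not_le.1 h).le⟩)
  linarith

theorem green_vOp {h φ : ℂ → ℂ} (hh : ContDiff ℝ (⊤ : ℕ∞) h)
    (hc : HasCompactSupport h) (hD : tsupport h ⊆ ball 0 1)
    (hφ : ContDiffOn ℝ (⊤ : ℕ∞) φ (ball 0 1)) (hφc : ContinuousOn φ (closedBall 0 1))
    (h0 : ∀ y ∈ sphere (0 : ℂ) 1, φ y = 0) (hinteg : IntegrableOn (dz (dzbar φ)) (ball 0 1)) :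
    π * ∫ y, h y * dz (dz φ) y = ∫ y in ball 0 1, vOp h y * dz (dzbar φ) y := by
  obtain ⟨r, C, hr0, hr1, hC, hrs, hb⟩ := vOp_boundary hh hc hD
  obtain ⟨Cv, hCv⟩ := exists_norm_vOp_le hh hc hD
  obtain ⟨M, hM, hcut⟩ := exists_discCut_bounds
  have hv := contDiffOn_vOp hh hc hD
  set f := dz (dzbar φ) with hf
  have hcutD {δ : ℝ} (hδ : 0 < δ) : tsupport (discCut δ) ⊆ ball 0 1 :=
    (tsupport_discCut_subset hδ).trans fun y hy => by
      rw [mem_ball_zero_iff]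
      have : ‖y‖ ^ 2 ≤ 1 - δ := hy
      nlinarith [norm_nonneg y]
  have hfc : ContinuousOn f (ball 0 1) :=
    (contDiffOn_dz isOpen_ball (contDiffOn_dzbar isOpen_ball hφ)).continuousOn
  have hlim : Tendsto (fun δ : ℝ => ∫ y in ball 0 1, discCut δ y * vOp h y * f y) (𝓝[>] 0)
      (𝓝 (∫ y in ball 0 1, vOp h y * f y)) := by
    refine tendsto_integral_filter_of_dominated_convergence (fun y => Cv * ‖f y‖)
      (Eventually.of_forall fun δ => ?_) (Eventually.of_forall fun δ => ?_)
      (hinteg.norm.const_mul _) ?_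
    · exact (((contDiff_discCut δ).continuous.continuousOn.mul hv.continuousOn).mul
        hfc).aestronglyMeasurable measurableSet_ball
    · refine (ae_restrict_mem measurableSet_ball).mono fun y hy => ?_
      rw [norm_mul, norm_mul]
      gcongr
      exact (mul_le_of_le_one_left (norm_nonneg _) (norm_discCut_le δ y)).trans (hCv y hy)
    · refine (ae_restrict_mem measurableSet_ball).mono fun y hy => ?_
      refine tendsto_const_nhds.congr' ?_
      have hy1 := mem_ball_zero_iff.1 hy
      have : 0 < (1 - ‖y‖ ^ 2) / 2 := by nlinarith [norm_nonneg y]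
      filter_upwards [Ioo_mem_nhdsGT this] with δ hδ
      rw [discCut_eq_one hδ.1 (by linarith [hδ.2]), one_mul]
  have hlim' : Tendsto (fun δ : ℝ => ∫ y in ball 0 1, discCut δ y * vOp h y * f y) (𝓝[>] 0)
      (𝓝 (π * ∫ y, h y * dz (dz φ) y)) := by
    rw [Metric.tendsto_nhds]
    intro ε hε
    set ε' := ε / (16 * π * (M * C + 1)) with hε'
    have hMC : 0 ≤ M * C := mul_nonneg hM hC
    have hε'0 : 0 < ε' := by have := Real.pi_pos; positivity
    obtain ⟨r', hr'0, hr'1, hr'⟩ := exists_norm_le_near_sphere hφc h0 hε'0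
    set R := max r r' with hR
    have hR1 : R < 1 := max_lt hr1 hr'1
    have hR0 : 0 < R := lt_max_of_lt_left hr0
    have hpos : 0 < min ((1 - R ^ 2) / 2) (1 / 4) := lt_min (by nlinarith) (by norm_num)
    filter_upwards [Ioo_mem_nhdsGT hpos] with δ hδ
    obtain ⟨hδ0, hδ'⟩ := hδ
    have hδR : δ < (1 - R ^ 2) / 2 := hδ'.trans_le (min_le_left _ _)
    have hδ4 : δ ≤ 1 / 4 := (hδ'.trans_le (min_le_right _ _)).le
    set A : ℂ → ℂ := fun y => discCut δ y * vOp h y with hA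
    have hAs : ContDiff ℝ (⊤ : ℕ∞) A :=
      contDiff_mul_of_tsupport isOpen_ball (contDiff_discCut δ) (hcutD hδ0) hv
    have hAt : tsupport A ⊆ tsupport (discCut δ) := tsupport_mul_subset_left
    have hcutc : HasCompactSupport (discCut δ) :=
      (isCompact_closedBall (0 : ℂ) 1).of_isClosed_subset (isClosed_tsupport _)
        ((hcutD hδ0).trans ball_subset_closedBall)
    have hAc : HasCompactSupport A := hcutc.mul_right
    have hAD : tsupport A ⊆ ball 0 1 := hAt.trans (hcutD hδ0)
    set S := {y : ℂ | 1 - 2 * δ ≤ ‖y‖ ^ 2 ∧ ‖y‖ ^ 2 ≤ 1 - δ} with hS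
    have hSR {y : ℂ} (hy : 1 - 2 * δ ≤ ‖y‖ ^ 2) : R < ‖y‖ := by
      nlinarith [norm_nonneg y]
    have e1 : ∫ y in ball 0 1, discCut δ y * vOp h y * f y = ∫ y, A y * f y :=
      setIntegral_eq_integral_of_forall_compl_eq_zero fun y hy => by
        change A y * f y = 0
        rw [image_eq_zero_of_notMem_tsupport fun h' => hy (hAD h'), zero_mul]
    have e2 := integral_mul_dz_dzbar_eq hAs hAc hAD hφ
    have e3 := integral_mul_dz_dz_eq hh hc hD hφ
    -- the error term lives on the annulus `S`
    have herr (y : ℂ) : ‖dzbar (dz A) y * φ y - π * (dz (dz h) y * φ y)‖ ≤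
        S.indicator (fun _ => 6 * M * C / δ * ε') y := by
      by_cases hyS : y ∈ S
      · rw [indicator_of_mem hyS]
        have hyR := hSR hyS.1
        have hy1 : ‖y‖ < 1 := by nlinarith [hyS.2, norm_nonneg y]
        have hyD : y ∈ ball (0 : ℂ) 1 := mem_ball_zero_iff.2 hy1
        have hyh : y ∉ tsupport h := fun h' => by
          have := mem_ball_zero_iff.1 (hrs h')
          have := le_max_left r r'
          linarith
        have hdd : dz (dz h) y = 0 := image_eq_zero_of_notMem_tsupport fun h' =>
          hyh (tsupport_dz_subset h (tsupport_dz_subset _ h'))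
        rw [dzbar_dz_mul isOpen_ball (contDiff_discCut δ) hv hyD, dzbar_dz_vOp hh hc hD hyD, hdd]
        simp only [mul_zero, zero_mul, add_zero, sub_zero, norm_mul]
        obtain ⟨c1, c2, c3⟩ := hcut δ hδ0 (by linarith) y hyD
        obtain ⟨b1, b2⟩ := hb y ((le_max_left r r').trans_lt hyR) hy1
        have b1' : ‖vOp h y‖ ≤ C * (2 * δ) := b1.trans (by
          gcongr
          nlinarith [hyS.1, norm_nonneg y])
        gcongr
        · calc _ ≤ ‖dzbar (dz (discCut δ)) y * vOp h y‖ + ‖dz (discCut δ) y * dzbar (vOp h) y‖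
                + ‖dzbar (discCut δ) y * dz (vOp h) y‖ := norm_add₃_le
            _ ≤ 2 * M / δ ^ 2 * (C * (2 * δ)) + M / δ * C + M / δ * C := by
              simp only [norm_mul]
              gcongr
              · exact (norm_dzbar_le _ _).trans b2
              · exact (norm_dz_le _ _).trans b2
            _ = _ := by field_simp; ring
        · exact hr' y ((le_max_right r r').trans hyR.le) hy1
      · rw [indicator_of_notMem hyS, norm_le_zero_iff]
        rcases lt_or_ge (‖y‖ ^ 2) (1 - 2 * δ) with h' | h'
        · have hyD : y ∈ ball (0 : ℂ) 1 := by
            rw [mem_ball_zero_iff]; nlinarith [norm_nonneg y]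
          have : A =ᶠ[𝓝 y] vOp h := by
            filter_upwards [(isOpen_lt (by fun_prop) continuous_const :
              IsOpen {w : ℂ | ‖w‖ ^ 2 < 1 - 2 * δ}).mem_nhds h'] with w hw
            rw [hA]
            simp only [discCut_eq_one hδ0 (le_of_lt hw), one_mul]
          have this' : dz A =ᶠ[𝓝 y] dz (vOp h) := by
            filter_upwards [this.eventuallyEq_nhds] with w hw using dz_congr hw
          rw [dzbar_congr this', dzbar_dz_vOp hh hc hD hyD]
          ring
        · have h2 : ¬ ‖y‖ ^ 2 ≤ 1 - δ := fun h'' => hyS ⟨h', h''⟩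
          have hyA : y ∉ tsupport A := fun h'' => h2 (tsupport_discCut_subset hδ0 (hAt h''))
          have hyh : y ∉ tsupport h := fun h'' => by
            have := mem_ball_zero_iff.1 (hrs h'')
            have := le_max_left r r'
            have := hSR h'
            linarith
          rw [image_eq_zero_of_notMem_tsupport fun h'' => hyA
              (tsupport_dz_subset A (tsupport_dzbar_subset _ h'')),
            image_eq_zero_of_notMem_tsupport fun h'' => hyh
              (tsupport_dz_subset h (tsupport_dz_subset _ h''))]
          simp
    have hcn : Continuous fun y : ℂ => ‖y‖ ^ 2 := by fun_prop
    have hSm : MeasurableSet S := ((isClosed_le continuous_const hcn).inter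
      (isClosed_le hcn continuous_const)).measurableSet
    have hSv := volume_annulus_le hδ0 hδ4
    have hSi : Integrable (S.indicator fun _ : ℂ => 6 * M * C / δ * ε') :=
      (integrable_indicator_iff hSm).2 (integrableOn_const (hSv.trans_lt ENNReal.ofReal_lt_top).ne)
    have hi {u : ℂ → ℂ} (hu : Continuous u) (huc : HasCompactSupport u)
        (huD : tsupport u ⊆ ball 0 1) : Integrable fun y => u y * φ y := by
      have hcont : Continuous fun y => u y * φ y := by
        rw [continuous_iff_continuousAt]
        intro y
        by_cases hy : y ∈ tsupport u
        · exact hu.continuousAt.mul (hφ.continuousOn.continuousAt (isOpen_ball.mem_nhds (huD hy)))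
        · have : (fun y => u y * φ y) =ᶠ[𝓝 y] fun _ => 0 := by
            filter_upwards [(isClosed_tsupport u).isOpen_compl.mem_nhds hy] with w hw
            simp [image_eq_zero_of_notMem_tsupport hw]
          exact continuousAt_const.congr this.symm
      exact hcont.integrable_of_hasCompactSupport huc.mul_right
    rw [dist_eq_norm, e1, e2, e3, ← integral_const_mul, ← integral_sub]
    · refine (norm_integral_le_of_norm_le hSi (Eventually.of_forall herr)).trans_lt ?_
      rw [integral_indicator hSm, setIntegral_const, smul_eq_mul]
      have hreal : volume.real S ≤ 2 * π * δ :=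
        ENNReal.toReal_le_of_le_ofReal (by have := Real.pi_pos; positivity) hSv
      calc _ ≤ 2 * π * δ * (6 * M * C / δ * ε') := by gcongr
        _ = 12 * π * (M * C) * ε' := by field_simp; ring
        _ < 16 * π * (M * C + 1) * ε' := by
          gcongr
          · norm_num
          · linarith
        _ = ε := by
          rw [hε']
          have := Real.pi_pos
          field_simp
    · exact hi (contDiff_dzbar (contDiff_dz hAs)).continuous hAc.dz.dzbar
        ((tsupport_dzbar_subset _).trans ((tsupport_dz_subset A).trans hAD))
    · exact (hi (contDiff_dz (contDiff_dz hh)).continuous hc.dz.dz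
        ((tsupport_dz_subset _).trans ((tsupport_dz_subset h).trans hD))).const_mul _
  exact tendsto_nhds_unique hlim' hlim

/-- Cauchy–Schwarz for lower Lebesgue integrals, in squared form. -/
theorem lintegral_mul_sq_le {α : Type*} [MeasurableSpace α] {μ : Measure α} {f g : α → ℝ≥0∞}
    (hf : AEMeasurable f μ) (hg : AEMeasurable g μ) :
    (∫⁻ x, f x * g x ∂μ) ^ 2 ≤ (∫⁻ x, f x ^ 2 ∂μ) * ∫⁻ x, g x ^ 2 ∂μ := by
  have h := ENNReal.lintegral_mul_le_Lp_mul_Lq μ Real.HolderConjugate.two_two hf hg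
  simp only [Pi.mul_apply, ENNReal.rpow_two] at h
  calc (∫⁻ x, f x * g x ∂μ) ^ 2
      ≤ ((∫⁻ x, f x ^ 2 ∂μ) ^ (1 / 2 : ℝ) * (∫⁻ x, g x ^ 2 ∂μ) ^ (1 / 2 : ℝ)) ^ 2 := by gcongr
    _ = _ := by
      rw [mul_pow, ← ENNReal.rpow_two, ← ENNReal.rpow_two, ← ENNReal.rpow_mul, ← ENNReal.rpow_mul]
      norm_num

/-- The potential of the kernel `kerV` over the set `E`. -/
def vSet (E : Set ℂ) (y : ℂ) : ℂ := ∫ x in E, kerV x y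

theorem measurable_vSet (E : Set ℂ) : Measurable (vSet E) := by
  have : StronglyMeasurable fun p : ℂ × ℂ => kerV p.1 p.2 := measurable_kerV.stronglyMeasurable
  exact (this.integral_prod_left' (μ := volume.restrict E)).measurable

/-- Smooth functions decreasing to the indicator function of `E`. -/
structure SmoothApprox (E : Set ℂ) where
  r : ℝ
  r_pos : 0 < r
  r_lt : r < 1
  U : ℕ → Set ℂ
  g : ℕ → ℂ → ℝ
  contDiff_g : ∀ n, ContDiff ℝ (⊤ : ℕ∞) (g n)
  g_mem : ∀ n x, g n x ∈ Icc (0 : ℝ) 1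
  g_eq : ∀ n, ∀ x ∈ E, g n x = 1
  tsupport_subset : ∀ n, tsupport (g n) ⊆ U n
  isCompact_U : ∀ n, IsCompact (U n)
  antitone_U : Antitone U
  subset_U : ∀ n, E ⊆ U n
  U_subset : ∀ n, U n ⊆ ball 0 r
  exists_notMem : ∀ y ∉ E, ∃ n, y ∉ U n
  tendsto : Tendsto (fun n => volume (U n \ E)) atTop (𝓝 0)

theorem nonempty_smoothApprox {E : Set ℂ} (hE : IsCompact E) (hED : E ⊆ ball 0 1) :
    Nonempty (SmoothApprox E) := by
  obtain ⟨r, hr0, hr1, hr⟩ := exists_lt_one_subset_ball hE hED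
  obtain ⟨δ, hδ, hδr⟩ := hE.exists_cthickening_subset_open isOpen_ball hr
  have hpos (n : ℕ) : 0 < δ / (n + 1) := by positivity
  have hle (n : ℕ) : δ / (n + 1) ≤ δ := div_le_self hδ.le (by norm_cast; omega)
  have hex (n : ℕ) : ∃ g : ℂ → ℝ, ContDiff ℝ (⊤ : ℕ∞) g ∧ (∀ x, g x ∈ Icc (0 : ℝ) 1) ∧
      (∀ x ∈ E, g x = 1) ∧ ∀ x ∉ thickening (δ / (n + 1)) E, g x = 0 := by
    obtain ⟨f, hf0, hf1, hf⟩ := exists_contMDiffMap_zero_one_of_isClosed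
      (n := (⊤ : ℕ∞)) (modelWithCornersSelf ℝ ℂ)
      (s := (thickening (δ / (n + 1)) E)ᶜ) (t := E) isOpen_thickening.isClosed_compl hE.isClosed
      (disjoint_compl_left_iff_subset.2 (self_subset_thickening (hpos n) E))
    exact ⟨f, f.contMDiff.contDiff, hf, fun x hx => hf1 hx, fun x hx => hf0 hx⟩
  choose g hg1 hg2 hg3 hg4 using hex
  have htend : Tendsto (fun n : ℕ => δ / ((n : ℝ) + 1)) atTop (𝓝 0) :=
    tendsto_const_nhds.div_atTop (tendsto_natCast_atTop_atTop.atTop_add tendsto_const_nhds)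
  refine ⟨⟨r, hr0, hr1, fun n => cthickening (δ / (n + 1)) E, g, hg1, hg2, hg3, fun n => ?_,
    fun n => hE.cthickening, fun m n hmn => ?_, fun n => self_subset_cthickening E,
    fun n => (cthickening_mono (hle n) E).trans hδr, fun y hy => ?_, ?_⟩⟩
  · refine closure_minimal (fun x hx => ?_) isClosed_cthickening
    by_contra h
    exact hx (hg4 n x fun h' => h (thickening_subset_cthickening _ _ h'))
  · refine cthickening_mono ?_ E
    gcongr
  · have : 0 < infEDist y E := by
      rw [infEDist_pos_iff_notMem_closure, hE.isClosed.closure_eq]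
      exact hy
    have h2 : Tendsto (fun n : ℕ => ENNReal.ofReal (δ / ((n : ℝ) + 1))) atTop (𝓝 0) := by
      simpa using ENNReal.tendsto_ofReal htend
    obtain ⟨n, hn⟩ := (h2.eventually_lt_const this).exists
    exact ⟨n, fun h => absurd (mem_cthickening_iff.1 h) (not_le.2 hn)⟩
  · have h1 := (tendsto_measure_cthickening_of_isCompact (μ := volume) hE).comp htend
    have h2 (n : ℕ) : volume (cthickening (δ / ((n : ℝ) + 1)) E \ E) =
        volume (cthickening (δ / ((n : ℝ) + 1)) E) - volume E :=
      measure_sdiff (self_subset_cthickening E) hE.measurableSet.nullMeasurableSet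
        hE.measure_lt_top.ne
    simp only [h2]
    have := ENNReal.Tendsto.sub h1 (tendsto_const_nhds (x := volume E))
      (Or.inl hE.measure_lt_top.ne)
    simpa using this

namespace SmoothApprox

variable {E : Set ℂ} (S : SmoothApprox E)

/-- The complex valued approximations. -/
def h (n : ℕ) (x : ℂ) : ℂ := (S.g n x : ℂ)

theorem contDiff_h (n : ℕ) : ContDiff ℝ (⊤ : ℕ∞) (S.h n) :=
  Complex.ofRealCLM.contDiff.comp (S.contDiff_g n)

theorem tsupport_h (n : ℕ) : tsupport (S.h n) ⊆ S.U n := by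
  refine (closure_mono fun x hx => ?_).trans (S.tsupport_subset n)
  intro h'
  exact hx (by simp [h, h'])

theorem U_subset_ball (n : ℕ) : S.U n ⊆ ball 0 1 :=
  (S.U_subset n).trans (ball_subset_ball S.r_lt.le)

theorem tsupport_h_ball (n : ℕ) : tsupport (S.h n) ⊆ ball 0 1 :=
  (S.tsupport_h n).trans (S.U_subset_ball n)

theorem hasCompactSupport_h (n : ℕ) : HasCompactSupport (S.h n) :=
  (S.isCompact_U n).of_isClosed_subset (isClosed_tsupport _) (S.tsupport_h n)

theorem h_eq_zero {n : ℕ} {x : ℂ} (hx : x ∉ S.U n) : S.h n x = 0 :=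
  image_eq_zero_of_notMem_tsupport fun h => hx (S.tsupport_h n h)

theorem norm_h_le (n : ℕ) (x : ℂ) : ‖S.h n x‖ ≤ 1 := by
  rw [h, Complex.norm_real, Real.norm_eq_abs, abs_of_nonneg (S.g_mem n x).1]
  exact (S.g_mem n x).2

theorem lintegral_h_le (n : ℕ) : ∫⁻ x, ‖S.h n x‖ₑ ^ 2 ≤ volume (S.U n) := by
  rw [← lintegral_indicator_one (S.isCompact_U n).measurableSet]
  refine lintegral_mono fun x => ?_
  by_cases hx : x ∈ S.U n
  · rw [indicator_of_mem hx]
    have : ‖S.h n x‖ₑ ≤ 1 := by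
      rw [← ofReal_norm]
      exact ENNReal.ofReal_le_one.2 (S.norm_h_le n x)
    calc _ ≤ (1 : ℝ≥0∞) ^ 2 := by gcongr
      _ = _ := by simp
  · simp [S.h_eq_zero hx]

theorem lintegral_sub_le {n m : ℕ} (hnm : n ≤ m) :
    ∫⁻ x, ‖S.h n x - S.h m x‖ₑ ^ 2 ≤ volume (S.U n \ E) := by
  have hsub := S.antitone_U hnm
  refine (lintegral_mono (g := (S.U n \ E).indicator 1) fun x => ?_).trans
    (lintegral_indicator_one_le (S.U n \ E))
  by_cases hx : x ∈ S.U n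
  · by_cases hxE : x ∈ E
    · simp [h, S.g_eq _ x hxE]
    · rw [indicator_of_mem (show x ∈ S.U n \ E from ⟨hx, hxE⟩)]
      have : ‖S.h n x - S.h m x‖ₑ ≤ 1 := by
        rw [← ofReal_norm]
        refine ENNReal.ofReal_le_one.2 ?_
        rw [h, h, ← Complex.ofReal_sub, Complex.norm_real, Real.norm_eq_abs, abs_le]
        constructor <;> linarith [(S.g_mem n x).1, (S.g_mem n x).2, (S.g_mem m x).1,
          (S.g_mem m x).2]
      calc _ ≤ (1 : ℝ≥0∞) ^ 2 := by gcongr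
        _ = _ := by simp
  · simp [S.h_eq_zero hx, S.h_eq_zero fun h' => hx (hsub h')]

end SmoothApprox

theorem vOp_sub {h k : ℂ → ℂ} (hh : ContDiff ℝ (⊤ : ℕ∞) h) (hc : HasCompactSupport h)
    (hD : tsupport h ⊆ ball 0 1) (hk : ContDiff ℝ (⊤ : ℕ∞) k) (kc : HasCompactSupport k)
    (kD : tsupport k ⊆ ball 0 1) {y : ℂ} (hy : y ∈ ball (0 : ℂ) 1) :
    vOp (fun x => h x - k x) y = vOp h y - vOp k y := by
  have hdz : dz (fun x => h x - k x) = fun x => dz h x - dz k x := by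
    funext x
    have := fderiv_fun_sub (𝕜 := ℝ) (hh.differentiable (by simp) x) (hk.differentiable (by simp) x)
    simp only [dz, this, _root_.sub_apply]
    ring
  have hi {u : ℂ → ℂ} (hu : ContDiff ℝ (⊤ : ℕ∞) u) (uc : HasCompactSupport u)
      (uD : tsupport u ⊆ ball 0 1) : Integrable fun x => u x * kerRefl x y ^ 2 := by
    have hy1 := mem_ball_zero_iff.1 hy
    refine integrable_mul_of_le_on_tsupport hu.continuous uc
      (measurable_kerRefl.of_uncurry_right.pow_const 2) (C := (1 / (1 - ‖y‖)) ^ 2) fun x hx => ?_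
    have hx1 := mem_ball_zero_iff.1 (uD hx)
    rw [norm_pow, kerRefl, norm_div, RCLike.norm_conj]
    have hy2 : 0 < 1 - ‖y‖ := by linarith
    have hle : 1 - ‖y‖ ≤ ‖1 - x * (starRingEnd ℂ) y‖ := by
      calc 1 - ‖y‖ ≤ ‖(1 : ℂ)‖ - ‖x * (starRingEnd ℂ) y‖ := by
            rw [norm_one, norm_mul, RCLike.norm_conj]
            nlinarith [norm_nonneg x, norm_nonneg y]
        _ ≤ _ := norm_sub_norm_le _ _
    gcongr
  rw [vOp, vOp, vOp, hdz, cauchyT_apply, cauchyT_apply, cauchyT_apply, reflInt, reflInt, reflInt]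
  simp only [mul_sub, sub_mul]
  rw [integral_sub (integrable_cauchyT (contDiff_dz hh).continuous hc.dz y)
    (integrable_cauchyT (contDiff_dz hk).continuous kc.dz y),
    integral_sub (hi hh hc hD) (hi hk kc kD)]
  ring

namespace SmoothApprox

variable {E : Set ℂ} (S : SmoothApprox E)

theorem continuousOn_vOp (n : ℕ) : ContinuousOn (vOp (S.h n)) (ball 0 1) :=
  (contDiffOn_vOp (S.contDiff_h n) (S.hasCompactSupport_h n) (S.tsupport_h_ball n)).continuousOn

theorem volume_sdiff_ne_top (n : ℕ) : volume (S.U n \ E) ≠ ∞ :=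
  ((measure_mono sdiff_subset).trans_lt (S.isCompact_U n).measure_lt_top).ne

theorem norm_vOp_sub_vSet_le (hE : IsCompact E) {n : ℕ} {y : ℂ} {m : ℝ} (hm : 0 < m)
    (hy : y ∈ ball (0 : ℂ) 1) (hmx : ∀ x ∈ S.U n, m ≤ ‖x - y‖) :
    ‖vOp (S.h n) y - vSet E y‖ ≤ 2 / m ^ 2 * volume.real (S.U n \ E) := by
  have hyU : y ∉ S.U n := fun h => by
    have := hmx y h
    rw [sub_self, norm_zero] at this
    linarith
  have hn {x : ℂ} (hx : x ∈ S.U n) : ‖x‖ ≤ 1 := (mem_ball_zero_iff.1 (S.U_subset_ball n hx)).le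
  have hy1 := (mem_ball_zero_iff.1 hy).le
  rw [vOp_eq_integral (S.contDiff_h n) (S.hasCompactSupport_h n) (S.tsupport_h_ball n) hy
    fun h => hyU (S.tsupport_h n h), vSet, ← integral_indicator hE.measurableSet, ← integral_sub]
  · have hms : MeasurableSet (S.U n \ E) :=
      (S.isCompact_U n).measurableSet.diff hE.measurableSet
    have e : 2 / m ^ 2 * volume.real (S.U n \ E) =
        ∫ x, (S.U n \ E).indicator (fun _ => 2 / m ^ 2) x := by
      rw [integral_indicator hms, setIntegral_const, smul_eq_mul, mul_comm]
    rw [e]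
    refine norm_integral_le_of_norm_le ((integrable_indicator_iff hms).2
      (integrableOn_const (S.volume_sdiff_ne_top n))) (Eventually.of_forall fun x => ?_)
    by_cases hxE : x ∈ E
    · simp [hxE, h, S.g_eq n x hxE]
    · by_cases hxU : x ∈ S.U n
      · rw [indicator_of_notMem hxE, indicator_of_mem (show x ∈ S.U n \ E from ⟨hxU, hxE⟩),
          sub_zero, norm_mul]
        exact (mul_le_of_le_one_left (norm_nonneg _) (S.norm_h_le n x)).trans
          (norm_kerV_le hm (hn hxU) hy1 (hmx x hxU))
      · simp [hxE, hxU, S.h_eq_zero hxU]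
  · exact integrable_mul_of_le_on_tsupport (S.contDiff_h n).continuous (S.hasCompactSupport_h n)
      (measurable_kerV_left y) (C := 2 / m ^ 2)
      fun x hx => norm_kerV_le hm (hn (S.tsupport_h n hx)) hy1 (hmx x (S.tsupport_h n hx))
  · rw [integrable_indicator_iff hE.measurableSet]
    refine Measure.integrableOn_of_bounded hE.measure_lt_top.ne
      (measurable_kerV_left y).aestronglyMeasurable (M := 2 / m ^ 2) ?_
    refine (ae_restrict_mem hE.measurableSet).mono fun x hx => ?_
    exact norm_kerV_le hm (hn (S.subset_U n hx)) hy1 (hmx x (S.subset_U n hx))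

theorem tendsto_real : Tendsto (fun n => volume.real (S.U n \ E)) atTop (𝓝 0) :=
  (ENNReal.tendsto_toReal ENNReal.zero_ne_top).comp S.tendsto

theorem tendsto_vOp (hE : IsCompact E) {y : ℂ} (hy : y ∈ ball (0 : ℂ) 1) (hyE : y ∉ E) :
    Tendsto (fun n => vOp (S.h n) y) atTop (𝓝 (vSet E y)) := by
  obtain ⟨n₀, hn₀⟩ := S.exists_notMem y hyE
  obtain ⟨m, hm, hmx⟩ := exists_le_norm_sub_of_notMem (S.isCompact_U n₀).isClosed hn₀
  rw [tendsto_iff_norm_sub_tendsto_zero]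
  refine squeeze_zero' (g := fun n => 2 / m ^ 2 * volume.real (S.U n \ E))
    (Eventually.of_forall fun n => norm_nonneg _) ?_ ?_
  · filter_upwards [eventually_ge_atTop n₀] with n hn
    exact S.norm_vOp_sub_vSet_le hE hm hy fun x hx => hmx x (S.antitone_U hn hx)
  · simpa using S.tendsto_real.const_mul (2 / m ^ 2)

theorem lintegral_vOp_sub_vSet_le (hE : IsCompact E) (n : ℕ) :
    ∫⁻ y in ball 0 1 \ E, ‖vOp (S.h n) y - vSet E y‖ₑ ^ 2 ≤
      ENNReal.ofReal (4 * π ^ 2) * volume (S.U n \ E) := by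
  have hms : MeasurableSet (ball (0 : ℂ) 1 \ E) := measurableSet_ball.diff hE.measurableSet
  have hlim : ∫⁻ y in ball 0 1 \ E, ‖vOp (S.h n) y - vSet E y‖ₑ ^ 2 =
      ∫⁻ y in ball 0 1 \ E,
        liminf (fun m => ‖vOp (S.h n) y - vOp (S.h m) y‖ₑ ^ 2) atTop := by
    refine setLIntegral_congr_fun hms fun y hy => ?_
    refine (Tendsto.liminf_eq ?_).symm
    exact ((ENNReal.continuous_pow 2).tendsto _).comp
      ((continuous_enorm.tendsto _).comp ((tendsto_const_nhds.sub (S.tendsto_vOp hE hy.1 hy.2))))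
  rw [hlim]
  refine (lintegral_liminf_le' fun m => ?_).trans (liminf_le_of_frequently_le' ?_)
  · exact ((((S.continuousOn_vOp n).sub (S.continuousOn_vOp m)).mono
      sdiff_subset).aemeasurable hms).enorm.pow_const 2
  · refine Eventually.frequently ?_
    filter_upwards [eventually_ge_atTop n] with m hm
    have hsubD : tsupport (fun x => S.h n x - S.h m x) ⊆ S.U n :=
      closure_minimal (fun x hx => by
        by_contra h'
        exact hx (by simp [S.h_eq_zero h', S.h_eq_zero fun h'' => h' (S.antitone_U hm h'')]))
        (S.isCompact_U n).isClosed
    have hb := setLIntegral_vOp_le ((S.contDiff_h n).sub (S.contDiff_h m))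
      ((S.isCompact_U n).of_isClosed_subset (isClosed_tsupport _) hsubD)
      (hsubD.trans (S.U_subset_ball n))
    calc ∫⁻ y in ball 0 1 \ E, ‖vOp (S.h n) y - vOp (S.h m) y‖ₑ ^ 2
        ≤ ∫⁻ y in ball 0 1, ‖vOp (S.h n) y - vOp (S.h m) y‖ₑ ^ 2 :=
          lintegral_mono_set sdiff_subset
      _ = ∫⁻ y in ball 0 1, ‖vOp (fun x => S.h n x - S.h m x) y‖ₑ ^ 2 :=
          setLIntegral_congr_fun measurableSet_ball fun y hy => by
            beta_reduce
            rw [vOp_sub (S.contDiff_h n) (S.hasCompactSupport_h n) (S.tsupport_h_ball n)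
              (S.contDiff_h m) (S.hasCompactSupport_h m) (S.tsupport_h_ball m) hy]
      _ ≤ _ := hb
      _ ≤ _ := by gcongr; exact S.lintegral_sub_le hm

theorem tendsto_volume_U :
    Tendsto (fun n => volume (S.U n \ E) + volume E) atTop (𝓝 (volume E)) := by
  simpa using S.tendsto.add_const (volume E)

theorem volume_U_le (n : ℕ) : volume (S.U n) ≤ volume (S.U n \ E) + volume E := by
  calc volume (S.U n) ≤ volume (S.U n \ E ∪ E) := measure_mono (by simp)
    _ ≤ _ := measure_union_le _ _

theorem lintegral_vOp_le (n : ℕ) : ∫⁻ y in ball 0 1, ‖vOp (S.h n) y‖ₑ ^ 2 ≤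
    ENNReal.ofReal (4 * π ^ 2) * (volume (S.U n \ E) + volume E) := by
  refine (setLIntegral_vOp_le (S.contDiff_h n) (S.hasCompactSupport_h n)
    (S.tsupport_h_ball n)).trans ?_
  gcongr
  exact (S.lintegral_h_le n).trans (S.volume_U_le n)

theorem _root_.lintegral_vSet_le (hE : IsCompact E) (hED : E ⊆ ball 0 1) :
    ∫⁻ y in ball 0 1 \ E, ‖vSet E y‖ₑ ^ 2 ≤ ENNReal.ofReal (4 * π ^ 2) * volume E := by
  obtain ⟨S⟩ := nonempty_smoothApprox hE hED
  have hms : MeasurableSet (ball (0 : ℂ) 1 \ E) := measurableSet_ball.diff hE.measurableSet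
  have hlim : ∫⁻ y in ball 0 1 \ E, ‖vSet E y‖ₑ ^ 2 =
      ∫⁻ y in ball 0 1 \ E, liminf (fun m => ‖vOp (S.h m) y‖ₑ ^ 2) atTop := by
    refine setLIntegral_congr_fun hms fun y hy => ?_
    refine (Tendsto.liminf_eq ?_).symm
    exact ((ENNReal.continuous_pow 2).tendsto _).comp
      ((continuous_enorm.tendsto _).comp (S.tendsto_vOp hE hy.1 hy.2))
  rw [hlim]
  refine (lintegral_liminf_le' fun m => ?_).trans ?_
  · exact (((S.continuousOn_vOp m).mono sdiff_subset).aemeasurable hms).enorm.pow_const 2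
  · have ht : Tendsto (fun n => ENNReal.ofReal (4 * π ^ 2) * (volume (S.U n \ E) + volume E)) atTop
        (𝓝 (ENNReal.ofReal (4 * π ^ 2) * volume E)) :=
      ENNReal.Tendsto.const_mul (S.tendsto_volume_U) (Or.inr ENNReal.ofReal_ne_top)
    rw [← ht.liminf_eq]
    refine liminf_le_liminf (Eventually.of_forall fun m => ?_)
    exact (lintegral_mono_set sdiff_subset).trans (S.lintegral_vOp_le m)

/-- A bound for the error made by replacing the indicator function of `E` by `S.h n`. -/
theorem exists_lintegral_sub_mul_le (hE : IsCompact E) {f : ℂ → ℂ}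
    (hf : ContinuousOn f (ball 0 1)) (hinteg : IntegrableOn f (ball 0 1)) :
    ∃ B : ℕ → ℝ≥0∞, (∀ n, B n ≠ ∞) ∧ Tendsto B atTop (𝓝 0) ∧ ∀ n,
      ∫⁻ y in ball 0 1 \ E, ‖(vOp (S.h n) y - vSet E y) * f y‖ₑ ≤ B n := by
  have hms : MeasurableSet (ball (0 : ℂ) 1 \ E) := measurableSet_ball.diff hE.measurableSet
  set R := (1 + S.r) / 2 with hR
  have hR1 : R < 1 := by rw [hR]; linarith [S.r_lt]
  set m := (1 - S.r) / 2 with hm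
  have hm0 : 0 < m := by rw [hm]; linarith [S.r_lt]
  obtain ⟨L, hL⟩ := (isCompact_closedBall (0 : ℂ) R).exists_bound_of_continuousOn
    (hf.mono (closedBall_subset_ball hR1))
  set K := ∫⁻ y in closedBall 0 R, ‖f y‖ₑ ^ 2 with hK
  have hKt : K ≠ ∞ := by
    have : K ≤ ∫⁻ y in closedBall (0 : ℂ) R, ENNReal.ofReal L ^ 2 := by
      refine setLIntegral_mono' measurableSet_closedBall fun y hy => ?_
      gcongr
      rw [← ofReal_norm]
      exact ENNReal.ofReal_le_ofReal (hL y hy)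
    refine (this.trans_lt ?_).ne
    rw [setLIntegral_const]
    exact ENNReal.mul_lt_top (by finiteness) measure_closedBall_lt_top
  have hft : ∫⁻ y in ball 0 1, ‖f y‖ₑ ≠ ∞ := hinteg.2.ne
  refine ⟨fun n => (ENNReal.ofReal (4 * π ^ 2) * volume (S.U n \ E) * K) ^ (1 / 2 : ℝ) +
    ENNReal.ofReal (2 / m ^ 2) * volume (S.U n \ E) * ∫⁻ y in ball 0 1, ‖f y‖ₑ, fun n => ?_, ?_,
    fun n => ?_⟩
  · have := S.volume_sdiff_ne_top n
    refine ENNReal.add_ne_top.2 ⟨ENNReal.rpow_ne_top_of_nonneg (by norm_num) ?_, ?_⟩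
    · exact ENNReal.mul_ne_top (ENNReal.mul_ne_top ENNReal.ofReal_ne_top this) hKt
    · exact ENNReal.mul_ne_top (ENNReal.mul_ne_top ENNReal.ofReal_ne_top this) hft
  · have h1 : Tendsto (fun n => ENNReal.ofReal (4 * π ^ 2) * volume (S.U n \ E) * K) atTop
        (𝓝 0) := by
      have := ENNReal.Tendsto.mul_const (b := K)
        (ENNReal.Tendsto.const_mul (a := ENNReal.ofReal (4 * π ^ 2)) S.tendsto
        (Or.inr ENNReal.ofReal_ne_top)) (Or.inr hKt)
      simpa using this
    have h2 := ENNReal.Tendsto.mul_const (b := ∫⁻ y in ball 0 1, ‖f y‖ₑ)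
      (ENNReal.Tendsto.const_mul (a := ENNReal.ofReal (2 / m ^ 2)) S.tendsto
        (Or.inr ENNReal.ofReal_ne_top)) (Or.inr hft)
    have h3 := (ENNReal.continuous_rpow_const (y := 1 / 2)).tendsto 0 |>.comp h1
    have := h3.add h2
    simpa [ENNReal.zero_rpow_of_pos] using this
  · have hwm : AEMeasurable (fun y => ‖vOp (S.h n) y - vSet E y‖ₑ)
        (volume.restrict (ball 0 1 \ E)) :=
      ((((S.continuousOn_vOp n).mono sdiff_subset).aemeasurable hms).sub
        (measurable_vSet E).aemeasurable).enorm
    have hfm : AEMeasurable (fun y => ‖f y‖ₑ) (volume.restrict (ball 0 1 \ E)) :=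
      ((hf.mono sdiff_subset).aemeasurable hms).enorm
    simp only [enorm_mul]
    rw [← lintegral_inter_add_sdiff _ (ball (0 : ℂ) 1 \ E)
      (measurableSet_closedBall (x := (0 : ℂ)) (ε := R))]
    gcongr
    · have h2 := lintegral_mul_sq_le (hwm.mono_set inter_subset_left)
        (hfm.mono_set (inter_subset_left (t := closedBall 0 R)))
      rw [← ENNReal.rpow_le_rpow_iff (z := 2) (by norm_num), ← ENNReal.rpow_mul,
        show (1 / 2 : ℝ) * 2 = 1 by norm_num, ENNReal.rpow_one, ENNReal.rpow_two]
      refine h2.trans ?_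
      gcongr
      · exact (lintegral_mono_set inter_subset_left).trans (S.lintegral_vOp_sub_vSet_le hE n)
      · exact lintegral_mono_set inter_subset_right
    · rw [← lintegral_const_mul' _ _ (ENNReal.mul_ne_top ENNReal.ofReal_ne_top
        (S.volume_sdiff_ne_top n))]
      calc _ ≤ ∫⁻ y in (ball 0 1 \ E) \ closedBall 0 R,
            ENNReal.ofReal (2 / m ^ 2) * volume (S.U n \ E) * ‖f y‖ₑ := by
            refine setLIntegral_mono' (hms.diff measurableSet_closedBall) fun y hy => ?_
            gcongr
            have hyR : R < ‖y‖ := by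
              have := hy.2
              rwa [mem_closedBall_zero_iff, not_le] at this
            have := S.norm_vOp_sub_vSet_le hE (n := n) hm0 hy.1.1 fun x hx => by
              have h1 := mem_ball_zero_iff.1 (S.U_subset n hx)
              have h2 := norm_sub_norm_le y x
              rw [norm_sub_rev] at h2
              rw [hm]
              rw [hR] at hyR
              linarith
            rw [← ofReal_norm, ← ofReal_measureReal (S.volume_sdiff_ne_top n),
              ← ENNReal.ofReal_mul (by positivity)]
            exact ENNReal.ofReal_le_ofReal this
        _ ≤ _ := lintegral_mono_set (sdiff_subset.trans sdiff_subset)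

theorem integrableOn_vOp_mul (n : ℕ) {f : ℂ → ℂ}
    (hf : ContinuousOn f (ball 0 1)) (hinteg : IntegrableOn f (ball 0 1)) :
    IntegrableOn (fun y => vOp (S.h n) y * f y) (ball 0 1) := by
  obtain ⟨C, hC⟩ := exists_norm_vOp_le (S.contDiff_h n) (S.hasCompactSupport_h n)
    (S.tsupport_h_ball n)
  refine (hinteg.norm.const_mul C).mono'
    (((S.continuousOn_vOp n).mul hf).aestronglyMeasurable measurableSet_ball) ?_
  refine (ae_restrict_mem measurableSet_ball).mono fun y hy => ?_
  rw [norm_mul]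
  gcongr
  exact hC y hy

theorem integrableOn_sub_mul (hE : IsCompact E) (n : ℕ) {f : ℂ → ℂ}
    (hf : ContinuousOn f (ball 0 1)) (hinteg : IntegrableOn f (ball 0 1)) :
    IntegrableOn (fun y => (vOp (S.h n) y - vSet E y) * f y) (ball 0 1 \ E) := by
  have hms : MeasurableSet (ball (0 : ℂ) 1 \ E) := measurableSet_ball.diff hE.measurableSet
  obtain ⟨B, hBt, -, hB⟩ := S.exists_lintegral_sub_mul_le hE hf hinteg
  refine ⟨?_, (hB n).trans_lt (hBt n).lt_top⟩
  exact (((((S.continuousOn_vOp n).mono sdiff_subset).aemeasurable hms).sub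
    (measurable_vSet E).aemeasurable).mul
      ((hf.mono sdiff_subset).aemeasurable hms)).aestronglyMeasurable

theorem _root_.integrableOn_vSet_mul (hE : IsCompact E) (hED : E ⊆ ball 0 1) {f : ℂ → ℂ}
    (hf : ContinuousOn f (ball 0 1)) (hinteg : IntegrableOn f (ball 0 1)) :
    IntegrableOn (fun y => vSet E y * f y) (ball 0 1 \ E) := by
  obtain ⟨S⟩ := nonempty_smoothApprox hE hED
  refine (((S.integrableOn_vOp_mul 0 hf hinteg).mono_set sdiff_subset).sub
    (S.integrableOn_sub_mul hE 0 hf hinteg)).congr (Eventually.of_forall fun y => ?_)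
  simp only [Pi.sub_apply]
  ring

theorem tendsto_setIntegral_vOp_mul (hE : IsCompact E) {f : ℂ → ℂ}
    (hf : ContinuousOn f (ball 0 1)) (hinteg : IntegrableOn f (ball 0 1)) :
    Tendsto (fun n => ∫ y in ball 0 1 \ E, vOp (S.h n) y * f y) atTop
      (𝓝 (∫ y in ball 0 1 \ E, vSet E y * f y)) := by
  obtain ⟨B, hBt, hB0, hB⟩ := S.exists_lintegral_sub_mul_le hE hf hinteg
  rw [tendsto_iff_edist_tendsto_0]
  refine tendsto_of_tendsto_of_tendsto_of_le_of_le tendsto_const_nhds hB0 (fun n => zero_le)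
    fun n => ?_
  beta_reduce
  rw [edist_eq_enorm_sub,
    ← integral_sub ((S.integrableOn_vOp_mul n hf hinteg).mono_set sdiff_subset)
    (integrableOn_vSet_mul hE ((S.subset_U n).trans (S.U_subset_ball n)) hf hinteg)]
  refine (enorm_integral_le_lintegral_enorm _).trans ?_
  simp only [← sub_mul]
  exact hB n

theorem tendsto_integral_h_mul (hE : IsCompact E) {Q : ℂ → ℂ} (hQ : ContinuousOn Q (ball 0 1)) :
    Tendsto (fun n => ∫ y, S.h n y * Q y) atTop (𝓝 (∫ y in E, Q y)) := by
  obtain ⟨L, hL⟩ := (isCompact_closedBall (0 : ℂ) S.r).exists_bound_of_continuousOn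
    (hQ.mono (closedBall_subset_ball S.r_lt))
  rw [tendsto_iff_norm_sub_tendsto_zero]
  refine squeeze_zero (g := fun n => L * volume.real (S.U n \ E)) (fun n => norm_nonneg _)
    (fun n => ?_) (by simpa using S.tendsto_real.const_mul L)
  have hms : MeasurableSet (S.U n \ E) :=
    (S.isCompact_U n).measurableSet.diff hE.measurableSet
  have e : L * volume.real (S.U n \ E) =
      ∫ x, (S.U n \ E).indicator (fun _ => L) x := by
    rw [integral_indicator hms, setIntegral_const, smul_eq_mul, mul_comm]
  have hUi : IntegrableOn (fun y => S.h n y * Q y) (S.U n) :=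
    ((S.contDiff_h n).continuous.continuousOn.mul
      (hQ.mono (S.U_subset_ball n))).integrableOn_compact (S.isCompact_U n)
  have hi : Integrable fun y => S.h n y * Q y := by
    rw [← integrableOn_iff_integrable_of_support_subset (s := S.U n)]
    · exact hUi
    · intro y hy
      by_contra h'
      exact hy (by simp [S.h_eq_zero h'])
  have hEi : Integrable (E.indicator Q) := by
    rw [integrable_indicator_iff hE.measurableSet]
    exact (hQ.mono ((S.subset_U n).trans (S.U_subset_ball n))).integrableOn_compact hE
  rw [e, ← integral_indicator hE.measurableSet, ← integral_sub hi hEi]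
  refine norm_integral_le_of_norm_le ((integrable_indicator_iff hms).2
    (integrableOn_const (S.volume_sdiff_ne_top n))) (Eventually.of_forall fun x => ?_)
  by_cases hxE : x ∈ E
  · simp [hxE, h, S.g_eq n x hxE]
  · by_cases hxU : x ∈ S.U n
    · rw [indicator_of_notMem hxE, indicator_of_mem (show x ∈ S.U n \ E from ⟨hxU, hxE⟩),
        sub_zero, norm_mul]
      exact (mul_le_of_le_one_left (norm_nonneg _) (S.norm_h_le n x)).trans
        (hL x (ball_subset_closedBall (S.U_subset n hxU)))
    · simp [hxE, hxU, S.h_eq_zero hxU]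

end SmoothApprox

theorem enorm_green_vSet_sq_le {E : Set ℂ} (hE : IsCompact E) (hED : E ⊆ ball 0 1) {φ : ℂ → ℂ}
    (hφ : ContDiffOn ℝ (⊤ : ℕ∞) φ (ball 0 1)) (hφc : ContinuousOn φ (closedBall 0 1))
    (h0 : ∀ y ∈ sphere (0 : ℂ) 1, φ y = 0) (hinteg : IntegrableOn (dz (dzbar φ)) (ball 0 1)) :
    ‖π * (∫ y in E, dz (dz φ) y) - ∫ y in ball 0 1 \ E, vSet E y * dz (dzbar φ) y‖ₑ ^ 2 ≤
      ENNReal.ofReal (4 * π ^ 2) * volume E * ∫⁻ y in E, ‖dz (dzbar φ) y‖ₑ ^ 2 := by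
  obtain ⟨S⟩ := nonempty_smoothApprox hE hED
  set f := dz (dzbar φ) with hf
  have hfc : ContinuousOn f (ball 0 1) :=
    (contDiffOn_dz isOpen_ball (contDiffOn_dzbar isOpen_ball hφ)).continuousOn
  have hQc : ContinuousOn (dz (dz φ)) (ball 0 1) :=
    (contDiffOn_dz isOpen_ball (contDiffOn_dz isOpen_ball hφ)).continuousOn
  have ht := ((S.tendsto_integral_h_mul hE hQc).const_mul (π : ℂ)).sub
    (S.tendsto_setIntegral_vOp_mul hE hfc hinteg)
  have ht2 := ((ENNReal.continuous_pow 2).tendsto _).comp ((continuous_enorm.tendsto _).comp ht)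
  have hKt : ∫⁻ y in E, ‖f y‖ₑ ^ 2 ≠ ∞ := by
    obtain ⟨L, hL⟩ := hE.exists_bound_of_continuousOn (hfc.mono hED)
    have : ∫⁻ y in E, ‖f y‖ₑ ^ 2 ≤ ∫⁻ y in E, ENNReal.ofReal L ^ 2 := by
      refine setLIntegral_mono' hE.measurableSet fun y hy => ?_
      gcongr
      rw [← ofReal_norm]
      exact ENNReal.ofReal_le_ofReal (hL y hy)
    refine (this.trans_lt ?_).ne
    rw [setLIntegral_const]
    exact ENNReal.mul_lt_top (by finiteness) hE.measure_lt_top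
  have hb : Tendsto (fun n => ENNReal.ofReal (4 * π ^ 2) * (volume (S.U n \ E) + volume E) *
      ∫⁻ y in E, ‖f y‖ₑ ^ 2) atTop (𝓝 (ENNReal.ofReal (4 * π ^ 2) * volume E *
        ∫⁻ y in E, ‖f y‖ₑ ^ 2)) :=
    ENNReal.Tendsto.mul_const (ENNReal.Tendsto.const_mul (S.tendsto_volume_U)
      (Or.inr ENNReal.ofReal_ne_top)) (Or.inr hKt)
  refine le_of_tendsto_of_tendsto' ht2 hb fun n => ?_
  simp only [Function.comp_apply]
  have hi := S.integrableOn_vOp_mul n hfc hinteg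
  rw [green_vOp (S.contDiff_h n) (S.hasCompactSupport_h n) (S.tsupport_h_ball n) hφ hφc h0 hinteg,
    ← hf, setIntegral_sdiff hE.measurableSet hi hED, sub_sub_cancel]
  calc _ ≤ (∫⁻ y in E, ‖vOp (S.h n) y‖ₑ * ‖f y‖ₑ) ^ 2 := by
        gcongr
        refine (enorm_integral_le_lintegral_enorm _).trans_eq ?_
        simp only [enorm_mul]
    _ ≤ (∫⁻ y in E, ‖vOp (S.h n) y‖ₑ ^ 2) * ∫⁻ y in E, ‖f y‖ₑ ^ 2 :=
        lintegral_mul_sq_le (((S.continuousOn_vOp n).mono hED).aemeasurable hE.measurableSet).enorm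
          ((hfc.mono hED).aemeasurable hE.measurableSet).enorm
    _ ≤ _ := by
        gcongr
        exact (lintegral_mono_set hED).trans (S.lintegral_vOp_le n)

/-- A Whitney-type averaging kernel: for a point `y` of the unit disc at distance `d y` from a
set, `z ↦ whit d z y` is a normalized tent of radius `d y / 20` centred at `y` pushed slightly
towards the origin. -/
def whit (d : ℂ → ℝ) (z y : ℂ) : ℝ :=
  3 / π * (((d y / 20) ^ 3)⁻¹ * max 0 (d y / 20 - ‖z - ((1 - d y / 5 : ℝ) : ℂ) * y‖))

theorem whit_nonneg {d : ℂ → ℝ} {y : ℂ} (hd : 0 ≤ d y) (z : ℂ) : 0 ≤ whit d z y := by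
  have := Real.pi_pos
  unfold whit
  positivity

theorem whit_eq_zero {d : ℂ → ℝ} {y : ℂ} (hd : d y = 0) (z : ℂ) : whit d z y = 0 := by
  simp [whit, hd]

theorem measurable_whit {d : ℂ → ℝ} (hd : Continuous d) :
    Measurable fun p : ℂ × ℂ => whit d p.1 p.2 := by
  have h : Continuous fun p : ℂ × ℂ =>
      max 0 (d p.2 / 20 - ‖p.1 - ((1 - d p.2 / 5 : ℝ) : ℂ) * p.2‖) := by fun_prop
  have h2 : Continuous fun p : ℂ × ℂ => (d p.2 / 20) ^ 3 := by fun_prop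
  exact (h2.measurable.inv.mul h.measurable).const_mul _

theorem integral_tent {t : ℝ} (ht : 0 < t) (c : ℂ) :
    ∫ z : ℂ, max 0 (t - ‖z - c‖) = π * t ^ 3 / 3 := by
  rw [integral_sub_right_eq_self (fun z : ℂ => max 0 (t - ‖z‖)) c,
    integral_fun_norm_addHaar volume fun ρ => max 0 (t - ρ), Complex.finrank_real_complex]
  have e : ∫ ρ in Ioi (0 : ℝ), ρ ^ (2 - 1) • max 0 (t - ρ) = t ^ 3 / 6 := by
    have e1 : ∫ ρ in Ioi (0 : ℝ), ρ ^ (2 - 1) • max 0 (t - ρ) =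
        ∫ ρ in Ioc (0 : ℝ) t, ρ * (t - ρ) := by
      rw [← integral_indicator measurableSet_Ioi, ← integral_indicator measurableSet_Ioc]
      congr 1 with ρ
      by_cases h0 : 0 < ρ
      · by_cases h1 : ρ ≤ t
        · rw [indicator_of_mem (show ρ ∈ Ioi 0 from h0),
            indicator_of_mem (show ρ ∈ Ioc 0 t from ⟨h0, h1⟩),
            max_eq_right (by linarith)]
          simp
        · rw [indicator_of_mem (show ρ ∈ Ioi 0 from h0),
            indicator_of_notMem fun h => h1 h.2, max_eq_left (by linarith)]
          simp
      · rw [indicator_of_notMem (by simpa using h0), indicator_of_notMem fun h => h0 h.1]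
    rw [e1, ← intervalIntegral.integral_of_le ht.le]
    have : ∀ ρ : ℝ, ρ * (t - ρ) = t * ρ - ρ ^ 2 := fun ρ => by ring
    simp only [this]
    rw [intervalIntegral.integral_sub (Continuous.intervalIntegrable (by fun_prop) _ _)
      (Continuous.intervalIntegrable (by fun_prop) _ _),
      intervalIntegral.integral_const_mul, integral_id, integral_pow]
    ring
  rw [e, measureReal_def, volume_ball_complex]
  simp
  ring

theorem integral_whit {d : ℂ → ℝ} {y : ℂ} (hd : 0 < d y) : ∫ z, whit d z y = 1 := by
  simp only [whit]
  rw [integral_const_mul, integral_const_mul, integral_tent (by positivity)]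
  have := Real.pi_pos
  field_simp

theorem integrable_whit {d : ℂ → ℝ} {y : ℂ} (hd : 0 < d y) : Integrable fun z => whit d z y := by
  by_contra h
  have := integral_whit hd
  rw [integral_undef h] at this
  exact zero_ne_one this

theorem norm_sub_lt_of_whit_ne_zero {d : ℂ → ℝ} {z y : ℂ} (h : whit d z y ≠ 0) :
    ‖z - ((1 - d y / 5 : ℝ) : ℂ) * y‖ < d y / 20 := by
  by_contra h'
  exact h (by rw [whit, max_eq_left (by linarith [not_lt.1 h'])]; simp)

theorem norm_sub_le_of_whit_ne_zero {d : ℂ → ℝ} {z y : ℂ} (hy : ‖y‖ ≤ 1) (hd : 0 ≤ d y)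
    (h : whit d z y ≠ 0) : ‖z - y‖ ≤ d y / 4 := by
  have h1 := norm_sub_lt_of_whit_ne_zero h
  have e : z - y = (z - ((1 - d y / 5 : ℝ) : ℂ) * y) - ((d y / 5 : ℝ) : ℂ) * y := by
    push_cast
    ring
  have h2 : ‖((d y / 5 : ℝ) : ℂ) * y‖ ≤ d y / 5 := by
    rw [norm_mul, Complex.norm_real, Real.norm_eq_abs, abs_of_nonneg (by positivity)]
    exact mul_le_of_le_one_right (by positivity) hy
  rw [e]
  linarith [norm_sub_le (z - ((1 - d y / 5 : ℝ) : ℂ) * y) (((d y / 5 : ℝ) : ℂ) * y)]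

theorem norm_lt_one_of_whit_ne_zero {d : ℂ → ℝ} {z y : ℂ} (hy : ‖y‖ ≤ 1) (hd2 : d y ≤ 2)
    (h : whit d z y ≠ 0) : ‖z‖ < 1 := by
  have h1 := norm_sub_lt_of_whit_ne_zero h
  have hd : 0 < d y := by linarith [norm_nonneg (z - ((1 - d y / 5 : ℝ) : ℂ) * y)]
  have h2 : ‖((1 - d y / 5 : ℝ) : ℂ) * y‖ ≤ 1 - d y / 5 := by
    rw [norm_mul, Complex.norm_real, Real.norm_eq_abs, abs_of_nonneg (by linarith)]
    exact mul_le_of_le_one_right (by linarith) hy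
  have e : z = (z - ((1 - d y / 5 : ℝ) : ℂ) * y) + ((1 - d y / 5 : ℝ) : ℂ) * y := by ring
  rw [e]
  linarith [norm_add_le (z - ((1 - d y / 5 : ℝ) : ℂ) * y) (((1 - d y / 5 : ℝ) : ℂ) * y)]

theorem whit_le {d : ℂ → ℝ} {y : ℂ} {s : ℝ} (hs : 0 < s) (h : s ≤ d y / 20) (z : ℂ) :
    whit d z y ≤ 3 / π * (1 / s ^ 2) := by
  have := Real.pi_pos
  have ht : 0 < d y / 20 := hs.trans_le h
  have hm : max 0 (d y / 20 - ‖z - ((1 - d y / 5 : ℝ) : ℂ) * y‖) ≤ d y / 20 :=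
    max_le ht.le (by linarith [norm_nonneg (z - ((1 - d y / 5 : ℝ) : ℂ) * y)])
  rw [whit]
  gcongr
  calc _ ≤ ((d y / 20) ^ 3)⁻¹ * (d y / 20) := by gcongr
    _ = 1 / (d y / 20) ^ 2 := by field_simp
    _ ≤ _ := by gcongr

theorem abs_inv_cube_mul_sub_le {s t₁ t₂ m₁ m₂ : ℝ} (hs : 0 < s) (h1 : s ≤ t₁) (h1' : t₁ ≤ 3 * s)
    (h2 : s ≤ t₂) (h2' : t₂ ≤ 3 * s) (hm0 : 0 ≤ m₂) (hm : m₂ ≤ t₂) :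
    |(t₁ ^ 3)⁻¹ * m₁ - (t₂ ^ 3)⁻¹ * m₂| ≤ (|m₁ - m₂| + 27 * |t₁ - t₂|) / s ^ 3 := by
  have ht1 : 0 < t₁ := hs.trans_le h1
  have ht2 : 0 < t₂ := hs.trans_le h2
  have e : (t₁ ^ 3)⁻¹ * m₁ - (t₂ ^ 3)⁻¹ * m₂ =
      (t₁ ^ 3)⁻¹ * (m₁ - m₂) + (t₂ - t₁) * ((t₁ ^ 2 + t₁ * t₂ + t₂ ^ 2) * ((t₁ ^ 3)⁻¹ *
        ((t₂ ^ 3)⁻¹ * m₂))) := by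
    field_simp
    ring
  have b1 : (t₁ ^ 3)⁻¹ ≤ (s ^ 3)⁻¹ := by gcongr
  have b2 : (t₂ ^ 3)⁻¹ * m₂ ≤ (s ^ 2)⁻¹ := by
    calc (t₂ ^ 3)⁻¹ * m₂ ≤ (t₂ ^ 3)⁻¹ * t₂ := by gcongr
      _ = (t₂ ^ 2)⁻¹ := by field_simp
      _ ≤ _ := by gcongr
  have b3 : t₁ ^ 2 + t₁ * t₂ + t₂ ^ 2 ≤ 27 * s ^ 2 := by nlinarith
  have b4 : |(t₁ ^ 2 + t₁ * t₂ + t₂ ^ 2) * ((t₁ ^ 3)⁻¹ * ((t₂ ^ 3)⁻¹ * m₂))| ≤ 27 / s ^ 3 := by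
    rw [abs_of_nonneg (by positivity)]
    calc _ ≤ 27 * s ^ 2 * ((s ^ 3)⁻¹ * (s ^ 2)⁻¹) := by gcongr
      _ = _ := by field_simp
  rw [e]
  calc _ ≤ |(t₁ ^ 3)⁻¹ * (m₁ - m₂)| + |(t₂ - t₁) * ((t₁ ^ 2 + t₁ * t₂ + t₂ ^ 2) *
        ((t₁ ^ 3)⁻¹ * ((t₂ ^ 3)⁻¹ * m₂)))| := abs_add_le _ _
    _ ≤ (s ^ 3)⁻¹ * |m₁ - m₂| + |t₁ - t₂| * (27 / s ^ 3) := by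
      rw [abs_mul, abs_mul, abs_of_pos (by positivity : 0 < (t₁ ^ 3)⁻¹), abs_sub_comm t₂ t₁]
      gcongr
    _ = _ := by field_simp

theorem abs_whit_sub_le {d : ℂ → ℝ} {z y₁ y₂ : ℂ} {s : ℝ} (hs : 0 < s)
    (h1 : s ≤ d y₁ / 20) (h1' : d y₁ / 20 ≤ 3 * s) (h2 : s ≤ d y₂ / 20) (h2' : d y₂ / 20 ≤ 3 * s)
    (hy₁ : ‖y₁‖ ≤ 1) (hd : d y₂ ≤ 2) (hlip : |d y₁ - d y₂| ≤ ‖y₁ - y₂‖) :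
    |whit d z y₁ - whit d z y₂| ≤ 3 / π * (5 / s ^ 3 * ‖y₁ - y₂‖) := by
  have hpi := Real.pi_pos
  set m₁ := max 0 (d y₁ / 20 - ‖z - ((1 - d y₁ / 5 : ℝ) : ℂ) * y₁‖) with hm₁
  set m₂ := max 0 (d y₂ / 20 - ‖z - ((1 - d y₂ / 5 : ℝ) : ℂ) * y₂‖) with hm₂
  have hm2 : m₂ ≤ d y₂ / 20 :=
    max_le (hs.le.trans h2) (by linarith [norm_nonneg (z - ((1 - d y₂ / 5 : ℝ) : ℂ) * y₂)])
  have ht : |d y₁ / 20 - d y₂ / 20| ≤ ‖y₁ - y₂‖ / 20 := by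
    rw [← sub_div, abs_div, abs_of_pos (by norm_num : (0 : ℝ) < 20)]
    gcongr
  have hm : |m₁ - m₂| ≤ 3 * ‖y₁ - y₂‖ := by
    have h3 : |m₁ - m₂| ≤ |(d y₁ / 20 - ‖z - ((1 - d y₁ / 5 : ℝ) : ℂ) * y₁‖) -
        (d y₂ / 20 - ‖z - ((1 - d y₂ / 5 : ℝ) : ℂ) * y₂‖)| := by
      rw [hm₁, hm₂, max_comm 0, max_comm 0]
      exact abs_max_sub_max_le_abs _ _ _
    have h4 : |‖z - ((1 - d y₁ / 5 : ℝ) : ℂ) * y₁‖ - ‖z - ((1 - d y₂ / 5 : ℝ) : ℂ) * y₂‖| ≤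
        2 * ‖y₁ - y₂‖ := by
      refine (abs_norm_sub_norm_le _ _).trans ?_
      have e : z - ((1 - d y₁ / 5 : ℝ) : ℂ) * y₁ - (z - ((1 - d y₂ / 5 : ℝ) : ℂ) * y₂) =
          -(((1 - d y₂ / 5 : ℝ) : ℂ) * (y₁ - y₂)) + (((d y₁ - d y₂) / 5 : ℝ) : ℂ) * y₁ := by
        push_cast
        ring
      rw [e]
      refine (norm_add_le _ _).trans ?_
      rw [norm_neg, norm_mul, norm_mul, Complex.norm_real, Complex.norm_real, Real.norm_eq_abs,
        Real.norm_eq_abs, abs_of_nonneg (by linarith : 0 ≤ 1 - d y₂ / 5), abs_div,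
        abs_of_pos (by norm_num : (0 : ℝ) < 5)]
      have a1 : (1 - d y₂ / 5) * ‖y₁ - y₂‖ ≤ 1 * ‖y₁ - y₂‖ := by
        gcongr
        linarith
      have a2 : |d y₁ - d y₂| / 5 * ‖y₁‖ ≤ ‖y₁ - y₂‖ / 5 * 1 := by gcongr
      linarith [norm_nonneg (y₁ - y₂)]
    rw [abs_le] at h4 ht
    refine h3.trans ?_
    rw [abs_le]
    constructor <;> linarith [norm_nonneg (y₁ - y₂)]
  have hmain := abs_inv_cube_mul_sub_le (m₁ := m₁) hs h1 h1' h2 h2' (le_max_left _ _) hm2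
  rw [whit, whit, ← mul_sub, abs_mul, abs_of_pos (by positivity : 0 < 3 / π)]
  gcongr
  refine hmain.trans ?_
  rw [div_mul_eq_mul_div]
  gcongr
  linarith [norm_nonneg (y₁ - y₂)]

/-- Products of `whit d z ·` with moderate functions are Lipschitz bumps. -/
theorem lipschitzWith_whit_mul {d : ℂ → ℝ} (hlip : ∀ x y, |d x - d y| ≤ ‖x - y‖)
    (hd0 : ∀ y, 0 ≤ d y) (hd2 : ∀ y ∈ ball (0 : ℂ) 1, d y ≤ 2) {z : ℂ} (hz : 0 < d z)
    {w : ℂ → ℂ} {W : ℝ≥0}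
    (hw1 : ∀ y ∈ ball (0 : ℂ) 1 ∩ ball z (d z / 2), ‖w y‖ ≤ W)
    (hw2 : ∀ y ∈ ball (0 : ℂ) 1 ∩ ball z (d z / 2), ‖w y‖ ≤ W * (1 - ‖y‖) / d z)
    (hw3 : ∀ y ∈ ball (0 : ℂ) 1 ∩ ball z (d z / 2), ∀ y' ∈ ball (0 : ℂ) 1 ∩ ball z (d z / 2),
      ‖w y - w y'‖ ≤ W * ‖y - y'‖ / d z) :
    LipschitzWith (Real.toNNReal (3 / π * (6 / (d z / 40) ^ 3)) * W)
      ((ball (0 : ℂ) 1).indicator fun y => (whit d z y : ℂ) * w y) := by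
  have hpi := Real.pi_pos
  set δ := d z with hδ
  set s := δ / 40 with hs
  have hs0 : 0 < s := by positivity
  have hδs : δ = 40 * s := by rw [hs]; ring
  set L : ℝ := 3 / π * (6 / s ^ 3) with hL
  have hL0 : 0 ≤ L := by positivity
  set Ψ : ℂ → ℂ := (ball (0 : ℂ) 1).indicator fun y => (whit d z y : ℂ) * w y with hΨ
  have hW0 : (0 : ℝ) ≤ W := W.2
  have hdN {y : ℂ} (hy : y ∈ ball z (δ / 2)) : s ≤ d y / 20 ∧ d y / 20 ≤ 3 * s := by
    have h1 := hlip y z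
    have h2 := mem_ball_iff_norm.1 hy
    rw [abs_le] at h1
    constructor <;> linarith
  have hzero {y : ℂ} (hyD : y ∈ ball (0 : ℂ) 1) (hy : δ / 3 < ‖y - z‖) : whit d z y = 0 := by
    by_contra h
    have h1 := norm_sub_le_of_whit_ne_zero (mem_ball_zero_iff.1 hyD).le (hd0 y) h
    have h2 := hlip y z
    rw [norm_sub_rev] at h1
    rw [abs_le] at h2
    linarith
  have hsup {y : ℂ} (hy : y ∈ ball z (δ / 2)) : ‖(whit d z y : ℂ)‖ ≤ 3 / π * (1 / s ^ 2) := by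
    rw [Complex.norm_real, Real.norm_eq_abs, abs_of_nonneg (whit_nonneg (hd0 y) z)]
    exact whit_le hs0 (hdN hy).1 z
  have key (y y' : ℂ) (hne : Ψ y ≠ 0) : ‖Ψ y - Ψ y'‖ ≤ L * W * ‖y - y'‖ := by
    have hyD : y ∈ ball (0 : ℂ) 1 := mem_of_indicator_ne_zero hne
    have hΨy : Ψ y = (whit d z y : ℂ) * w y := indicator_of_mem hyD _
    have hy3 : ‖y - z‖ ≤ δ / 3 := by
      by_contra h
      exact hne (by rw [hΨy, hzero hyD (not_le.1 h)]; simp)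
    have hyN : y ∈ ball z (δ / 2) := mem_ball_iff_norm.2 (by linarith)
    by_cases hyD' : y' ∈ ball (0 : ℂ) 1
    · have hΨy' : Ψ y' = (whit d z y' : ℂ) * w y' := indicator_of_mem hyD' _
      by_cases hyN' : y' ∈ ball z (δ / 2)
      · have e : Ψ y - Ψ y' = (whit d z y : ℂ) * (w y - w y') +
            ((whit d z y - whit d z y' : ℝ) : ℂ) * w y' := by
          rw [hΨy, hΨy']
          push_cast
          ring
        rw [e]
        calc _ ≤ ‖(whit d z y : ℂ) * (w y - w y')‖ +
              ‖((whit d z y - whit d z y' : ℝ) : ℂ) * w y'‖ := norm_add_le _ _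
          _ ≤ 3 / π * (1 / s ^ 2) * (W * ‖y - y'‖ / δ) +
              3 / π * (5 / s ^ 3 * ‖y - y'‖) * W := by
            rw [norm_mul, norm_mul]
            gcongr
            · exact hsup hyN
            · exact hw3 y ⟨hyD, hyN⟩ y' ⟨hyD', hyN'⟩
            · rw [Complex.norm_real]
              exact abs_whit_sub_le hs0 (hdN hyN).1 (hdN hyN).2 (hdN hyN').1 (hdN hyN').2
                (mem_ball_zero_iff.1 hyD).le (hd2 y' hyD') (hlip y y')
            · exact hw1 y' ⟨hyD', hyN'⟩
          _ = 3 / π * ((1 / 40 + 5) / s ^ 3) * W * ‖y - y'‖ := by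
            rw [hδs]
            field_simp
          _ ≤ L * W * ‖y - y'‖ := by
            rw [hL]
            gcongr
            norm_num
      · have h1 : δ / 2 ≤ ‖y' - z‖ := not_lt.1 fun h => hyN' (mem_ball_iff_norm.2 h)
        have h2 : Ψ y' = 0 := by rw [hΨy', hzero hyD' (by linarith)]; simp
        have h3 : δ / 6 ≤ ‖y - y'‖ := by
          have := norm_sub_le_norm_sub_add_norm_sub y' y z
          rw [norm_sub_rev y' y] at this
          linarith
        rw [h2, sub_zero, hΨy, norm_mul]
        calc _ ≤ 3 / π * (1 / s ^ 2) * W := by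
              gcongr
              · exact hsup hyN
              · exact hw1 y ⟨hyD, hyN⟩
          _ ≤ 3 / π * (6 / s ^ 3) * W * (δ / 6) := by
              rw [hδs]
              have : 3 / π * (6 / s ^ 3) * W * (40 * s / 6) = 40 * (3 / π * (1 / s ^ 2) * W) := by
                field_simp
              rw [this]
              have : 0 ≤ 3 / π * (1 / s ^ 2) * W := by positivity
              linarith
          _ ≤ _ := by rw [hL]; gcongr
    · have h2 : Ψ y' = 0 := indicator_of_notMem hyD' _
      have h3 : 1 - ‖y‖ ≤ ‖y - y'‖ := by
        have h4 : 1 ≤ ‖y'‖ := not_lt.1 fun h => hyD' (mem_ball_zero_iff.2 h)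
        have h5 := norm_sub_norm_le y' y
        rw [norm_sub_rev] at h5
        linarith
      rw [h2, sub_zero, hΨy, norm_mul]
      calc _ ≤ 3 / π * (1 / s ^ 2) * (W * (1 - ‖y‖) / δ) := by
            gcongr
            · exact hsup hyN
            · exact hw2 y ⟨hyD, hyN⟩
        _ ≤ 3 / π * (1 / s ^ 2) * (W * ‖y - y'‖ / δ) := by gcongr
        _ = 3 / π * ((1 / 40) / s ^ 3) * W * ‖y - y'‖ := by
            rw [hδs]
            field_simp
        _ ≤ L * W * ‖y - y'‖ := by
            rw [hL]
            gcongr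
            norm_num
  refine LipschitzWith.of_dist_le_mul fun y y' => ?_
  rw [dist_eq_norm, dist_eq_norm, NNReal.coe_mul, Real.coe_toNNReal _ hL0]
  by_cases h : Ψ y = 0
  · by_cases h' : Ψ y' = 0
    · rw [h, h', sub_zero, norm_zero]
      positivity
    · rw [norm_sub_rev, norm_sub_rev y]
      exact key y' y h'
  · exact key y y' h

theorem integral_norm_inv_cube {δ : ℝ} (hδ : 0 < δ) (z : ℂ) :
    ∫ x : ℂ, (Ioi δ).indicator (fun ρ => ρ ^ (-3 : ℝ)) ‖x - z‖ = 2 * π / δ := by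
  rw [integral_sub_right_eq_self (fun x : ℂ => (Ioi δ).indicator (fun ρ => ρ ^ (-3 : ℝ)) ‖x‖) z,
    integral_fun_norm_addHaar volume ((Ioi δ).indicator fun ρ => ρ ^ (-3 : ℝ)),
    Complex.finrank_real_complex]
  have e : ∫ ρ in Ioi (0 : ℝ), ρ ^ (2 - 1) • (Ioi δ).indicator (fun ρ => ρ ^ (-3 : ℝ)) ρ =
      1 / δ := by
    have e1 : ∫ ρ in Ioi (0 : ℝ), ρ ^ (2 - 1) • (Ioi δ).indicator (fun ρ => ρ ^ (-3 : ℝ)) ρ =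
        ∫ ρ in Ioi δ, ρ ^ (-2 : ℝ) := by
      rw [← integral_indicator measurableSet_Ioi, ← integral_indicator measurableSet_Ioi]
      congr 1 with ρ
      by_cases h : ρ ∈ Ioi δ
      · have h0 : 0 < ρ := hδ.trans h
        rw [indicator_of_mem (show ρ ∈ Ioi 0 from h0), indicator_of_mem h, indicator_of_mem h,
          show (-2 : ℝ) = 1 + -3 by norm_num, Real.rpow_add h0, Real.rpow_one]
        simp
      · simp [indicator_of_notMem h]
    rw [e1, integral_Ioi_rpow_of_lt (by norm_num) hδ, show (-2 + 1 : ℝ) = -1 by norm_num,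
      Real.rpow_neg_one]
    field_simp
  rw [e, measureReal_def, volume_ball_complex]
  simp
  ring

theorem integrable_norm_inv_cube {δ : ℝ} (hδ : 0 < δ) (z : ℂ) :
    Integrable fun x : ℂ => (Ioi δ).indicator (fun ρ => ρ ^ (-3 : ℝ)) ‖x - z‖ := by
  by_contra h
  have := integral_norm_inv_cube hδ z
  rw [integral_undef h] at this
  have : 0 < 2 * π / δ := by positivity
  linarith

/-- Integrating a kernel that decays like the inverse cube of the distance to `z` over a set
away from `z`. -/
theorem norm_setIntegral_le_of_inv_cube {E : Set ℂ} (hE : MeasurableSet E) {z : ℂ} {δ c : ℝ}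
    (hδ : 0 < δ) (hEz : ∀ x ∈ E, δ ≤ ‖x - z‖) {k : ℂ → ℂ} (hc : 0 ≤ c)
    (hk : ∀ x ∈ E, ‖k x‖ ≤ c / ‖x - z‖ ^ 3) : ‖∫ x in E, k x‖ ≤ c * (4 * π / δ) := by
  have hδ2 : 0 < δ / 2 := by positivity
  have hi := (integrable_norm_inv_cube hδ2 z).const_mul c
  have hnn (x : ℂ) : 0 ≤ c * (Ioi (δ / 2)).indicator (fun ρ => ρ ^ (-3 : ℝ)) ‖x - z‖ :=
    mul_nonneg hc (indicator_nonneg (fun ρ hρ => Real.rpow_nonneg (hδ2.trans hρ).le _) _)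
  calc ‖∫ x in E, k x‖
      ≤ ∫ x in E, c * (Ioi (δ / 2)).indicator (fun ρ => ρ ^ (-3 : ℝ)) ‖x - z‖ := by
        refine norm_integral_le_of_norm_le hi.integrableOn ((ae_restrict_iff' hE).2 ?_)
        refine Eventually.of_forall fun x hx => (hk x hx).trans_eq ?_
        have h1 := hEz x hx
        rw [indicator_of_mem (show ‖x - z‖ ∈ Ioi (δ / 2) by rw [mem_Ioi]; linarith),
          Real.rpow_neg (norm_nonneg _), div_eq_mul_inv]
        norm_cast
    _ ≤ ∫ x, c * (Ioi (δ / 2)).indicator (fun ρ => ρ ^ (-3 : ℝ)) ‖x - z‖ :=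
        setIntegral_le_integral hi (Eventually.of_forall hnn)
    _ = c * (4 * π / δ) := by
        rw [integral_const_mul, integral_norm_inv_cube hδ2]
        field_simp
        ring

theorem half_norm_sub_le {x y z : ℂ} {δ : ℝ} (hx : δ ≤ ‖x - z‖) (hy : y ∈ ball z (δ / 2)) :
    ‖x - z‖ / 2 ≤ ‖x - y‖ := by
  rw [mem_ball, dist_eq_norm] at hy
  have := norm_sub_le_norm_sub_add_norm_sub x y z
  linarith

theorem integrableOn_kerV {E : Set ℂ} (hE : MeasurableSet E) (hED : E ⊆ ball 0 1) {y : ℂ} {m : ℝ}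
    (hy : ‖y‖ ≤ 1) (hm : 0 < m) (h : ∀ x ∈ E, m ≤ ‖x - y‖) : IntegrableOn (fun x => kerV x y) E :=
  Measure.integrableOn_of_bounded (M := 2 / m ^ 2)
    ((measure_mono hED).trans_lt measure_ball_lt_top).ne
    (measurable_kerV_left y).aestronglyMeasurable
    ((ae_restrict_iff' hE).2 (Eventually.of_forall fun x hx =>
      norm_kerV_le hm (mem_ball_zero_iff.1 (hED hx)).le hy (h x hx)))

theorem norm_vSet_sub_le {E : Set ℂ} (hE : MeasurableSet E) (hED : E ⊆ ball 0 1) {z : ℂ} {δ : ℝ}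
    (hδ : 0 < δ) (hEz : ∀ x ∈ E, δ ≤ ‖x - z‖) {y y' : ℂ} (hy : y ∈ ball 0 1 ∩ ball z (δ / 2))
    (hy' : y' ∈ ball 0 1 ∩ ball z (δ / 2)) :
    ‖vSet E y - vSet E y'‖ ≤ 128 * π * ‖y - y'‖ / δ := by
  have hn {y : ℂ} (hy : y ∈ ball (0 : ℂ) 1) : ‖y‖ ≤ 1 := (mem_ball_zero_iff.1 hy).le
  have hi {y : ℂ} (hy : y ∈ ball 0 1 ∩ ball z (δ / 2)) : IntegrableOn (fun x => kerV x y) E :=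
    integrableOn_kerV hE hED (hn hy.1) (half_pos hδ) fun x hx => by
      linarith [half_norm_sub_le (hEz x hx) hy.2, hEz x hx]
  rw [vSet, vSet, ← integral_sub (hi hy) (hi hy')]
  refine (norm_setIntegral_le_of_inv_cube hE hδ hEz (c := 32 * ‖y - y'‖) (by positivity)
    fun x hx => ?_).trans_eq (by ring)
  have h0 : 0 < ‖x - z‖ := hδ.trans_le (hEz x hx)
  refine (norm_kerV_sub_le (half_pos h0) (hn (hED hx)) (hn hy.1) (hn hy'.1)
    (half_norm_sub_le (hEz x hx) hy.2) (half_norm_sub_le (hEz x hx) hy'.2)).trans_eq ?_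
  field_simp
  ring

theorem norm_vSet_le_boundary {E : Set ℂ} (hE : MeasurableSet E) (hED : E ⊆ ball 0 1) {z : ℂ}
    {δ : ℝ} (hδ : 0 < δ) (hEz : ∀ x ∈ E, δ ≤ ‖x - z‖) {y : ℂ}
    (hy : y ∈ ball 0 1 ∩ ball z (δ / 2)) : ‖vSet E y‖ ≤ 256 * π * (1 - ‖y‖) / δ := by
  have hy1 := mem_ball_zero_iff.1 hy.1
  refine (norm_setIntegral_le_of_inv_cube hE hδ hEz (c := 64 * (1 - ‖y‖)) (by linarith)
    fun x hx => ?_).trans_eq (by ring)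
  have h0 : 0 < ‖x - z‖ := hδ.trans_le (hEz x hx)
  refine (norm_kerV_le_boundary (half_pos h0) (mem_ball_zero_iff.1 (hED hx)).le hy1
    (half_norm_sub_le (hEz x hx) hy.2)).trans_eq ?_
  field_simp
  ring

/-- Integrals over the unit disc of `f` against Lipschitz bumps supported in discs centred at
points of `A` are controlled by `K`. -/
def LipTestBound (f : ℂ → ℝ) (A : Set ℂ) (K : ℝ≥0∞) : Prop :=
  ∀ x₀ ∈ A, ∀ ρ : ℝ, 0 < ρ → ρ ≤ 6 → ∀ (Ψ : ℂ → ℝ) (L : ℝ≥0), LipschitzWith L Ψ →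
    (∀ z ∉ ball x₀ ρ ∩ ball 0 1, Ψ z = 0) →
      ‖∫ z in ball 0 1, Ψ z * f z‖ₑ ≤ K * L * ENNReal.ofReal ρ ^ 3

section averaged

variable {f : ℂ → ℝ} {A : Set ℂ} {K : ℝ≥0∞}

theorem LipTestBound.complex (h : LipTestBound f A K) {x₀ : ℂ} (hx₀ : x₀ ∈ A) {ρ : ℝ} (hρ : 0 < ρ)
    (hρ6 : ρ ≤ 6) {Ψ : ℂ → ℂ} {L : ℝ≥0} (hΨ : LipschitzWith L Ψ)
    (h0 : ∀ z ∉ ball x₀ ρ ∩ ball 0 1, Ψ z = 0) :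
    ‖∫ z in ball 0 1, Ψ z * f z‖ₑ ≤ 2 * (K * L * ENNReal.ofReal ρ ^ 3) := by
  by_cases hi : IntegrableOn (fun z => Ψ z * f z) (ball 0 1)
  swap
  · rw [integral_undef hi]
    simp
  have hre : LipschitzWith L fun z => (Ψ z).re := by
    refine LipschitzWith.of_dist_le_mul fun x y => ?_
    refine le_trans ?_ (hΨ.dist_le_mul x y)
    rw [dist_eq_norm, dist_eq_norm, ← Complex.sub_re]
    exact Complex.abs_re_le_norm _
  have him : LipschitzWith L fun z => (Ψ z).im := by
    refine LipschitzWith.of_dist_le_mul fun x y => ?_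
    refine le_trans ?_ (hΨ.dist_le_mul x y)
    rw [dist_eq_norm, dist_eq_norm, ← Complex.sub_im]
    exact Complex.abs_im_le_norm _
  have h1 := h x₀ hx₀ ρ hρ hρ6 _ L hre fun z hz => by rw [h0 z hz, Complex.zero_re]
  have h2 := h x₀ hx₀ ρ hρ hρ6 _ L him fun z hz => by rw [h0 z hz, Complex.zero_im]
  have e := integral_re_add_im (𝕜 := ℂ) hi
  simp only [RCLike.re_to_complex, RCLike.im_to_complex, Complex.re_mul_ofReal,
    Complex.im_mul_ofReal] at e
  rw [← e, two_mul]
  refine (enorm_add_le _ _).trans (add_le_add ?_ ?_)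
  · refine le_trans (le_of_eq ?_) h1
    rw [← ofReal_norm, ← ofReal_norm]
    simp
  · refine le_trans (le_of_eq ?_) h2
    rw [← ofReal_norm, ← ofReal_norm]
    simp

theorem abs_infDist_sub_le (A : Set ℂ) (x y : ℂ) : |infDist x A - infDist y A| ≤ ‖x - y‖ := by
  rw [abs_sub_le_iff]
  have h1 := infDist_le_infDist_add_dist (s := A) (x := x) (y := y)
  have h2 := infDist_le_infDist_add_dist (s := A) (x := y) (y := x)
  rw [dist_comm, dist_eq_norm] at h2
  rw [dist_eq_norm] at h1
  constructor <;> linarith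

theorem infDist_le_two (hA : A.Nonempty) (hAD : A ⊆ ball 0 1) {y : ℂ} (hy : y ∈ ball (0 : ℂ) 1) :
    infDist y A ≤ 2 := by
  obtain ⟨x, hx⟩ := hA
  refine (infDist_le_dist_of_mem hx).trans ?_
  have h1 := mem_ball.1 hy
  have h2 := mem_ball.1 (hAD hx)
  linarith [dist_triangle_right y x 0]

theorem norm_sub_le_of_whit_infDist_ne_zero {z y : ℂ} (hy : y ∈ ball (0 : ℂ) 1)
    (h : whit (fun y => infDist y A) z y ≠ 0) : ‖z - y‖ ≤ infDist z A / 3 := by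
  have h1 := norm_sub_le_of_whit_ne_zero (mem_ball_zero_iff.1 hy).le infDist_nonneg h
  have h2 := (abs_le.1 (abs_infDist_sub_le A z y)).1
  linarith

variable {z : ℂ} {w : ℂ → ℂ} {W : ℝ≥0}

/-- Integrals against Whitney bumps times a slowly varying weight. -/
theorem integrableOn_whit_mul (hA : A.Nonempty) (hAD : A ⊆ ball 0 1)
    (hinteg : IntegrableOn f (ball 0 1)) (hd : 0 < infDist z A)
    (hw1 : ∀ y ∈ ball (0 : ℂ) 1 ∩ ball z (infDist z A / 2), ‖w y‖ ≤ W)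
    (hw2 : ∀ y ∈ ball (0 : ℂ) 1 ∩ ball z (infDist z A / 2), ‖w y‖ ≤ W * (1 - ‖y‖) / infDist z A)
    (hw3 : ∀ y ∈ ball (0 : ℂ) 1 ∩ ball z (infDist z A / 2),
      ∀ y' ∈ ball (0 : ℂ) 1 ∩ ball z (infDist z A / 2), ‖w y - w y'‖ ≤ W * ‖y - y'‖ / infDist z A) :
    IntegrableOn (fun y => (whit (fun y => infDist y A) z y : ℂ) * w y * f y) (ball 0 1) := by
  have hL := lipschitzWith_whit_mul (d := fun y => infDist y A) (abs_infDist_sub_le A)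
    (fun y => infDist_nonneg) (fun y hy => infDist_le_two hA hAD hy) hd hw1 hw2 hw3
  set L := Real.toNNReal (3 / π * (6 / (infDist z A / 40) ^ 3)) * W
  have hi : IntegrableOn (fun y => ((ball (0 : ℂ) 1).indicator
      fun y => (whit (fun y => infDist y A) z y : ℂ) * w y) y * (f y : ℂ)) (ball 0 1) := by
    refine Integrable.bdd_mul (c := L * 2) hinteg.ofReal hL.continuous.aestronglyMeasurable
      ((ae_restrict_iff' measurableSet_ball).2 (Eventually.of_forall fun y hy => ?_))
    have := hL.dist_le_mul y 1
    rw [indicator_of_notMem (a := (1 : ℂ)) (by simp), dist_zero_right] at this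
    refine this.trans ?_
    gcongr
    have h1 := mem_ball_zero_iff.1 hy
    rw [dist_eq_norm]
    refine (norm_sub_le _ _).trans ?_
    rw [norm_one]
    linarith
  exact hi.congr_fun (fun y hy => by simp only [indicator_of_mem hy]) measurableSet_ball

theorem LipTestBound.enorm_integral_whit_mul_le (h : LipTestBound f A K) (hA : A.Nonempty)
    (hAD : A ⊆ ball 0 1) (hz : z ∈ ball (0 : ℂ) 1) (hd : 0 < infDist z A)
    (hw1 : ∀ y ∈ ball (0 : ℂ) 1 ∩ ball z (infDist z A / 2), ‖w y‖ ≤ W)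
    (hw2 : ∀ y ∈ ball (0 : ℂ) 1 ∩ ball z (infDist z A / 2), ‖w y‖ ≤ W * (1 - ‖y‖) / infDist z A)
    (hw3 : ∀ y ∈ ball (0 : ℂ) 1 ∩ ball z (infDist z A / 2),
      ∀ y' ∈ ball (0 : ℂ) 1 ∩ ball z (infDist z A / 2), ‖w y - w y'‖ ≤ W * ‖y - y'‖ / infDist z A) :
    ‖∫ y in ball 0 1, (whit (fun y => infDist y A) z y : ℂ) * w y * f y‖ₑ ≤
      ENNReal.ofReal (62208000 / π) * K * W := by
  have hpi := Real.pi_pos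
  have hL := lipschitzWith_whit_mul (d := fun y => infDist y A) (abs_infDist_sub_le A)
    (fun y => infDist_nonneg) (fun y hy => infDist_le_two hA hAD hy) hd hw1 hw2 hw3
  beta_reduce at hL
  set δ := infDist z A with hδ
  obtain ⟨x₀, hx₀, hx₀z⟩ := (infDist_lt_iff hA (x := z) (r := 2 * δ)).1 (by linarith)
  have hδ2 : δ ≤ 2 := infDist_le_two hA hAD hz
  have key := h.complex hx₀ (ρ := 3 * δ) (by positivity) (by linarith) hL fun y hy => by
    by_cases hyD : y ∈ ball (0 : ℂ) 1
    · rw [indicator_of_mem hyD]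
      have : whit (fun y => infDist y A) z y = 0 := by
        by_contra hne
        have h1 := norm_sub_le_of_whit_infDist_ne_zero hyD hne
        refine hy ⟨?_, hyD⟩
        rw [mem_ball]
        rw [← dist_eq_norm] at h1
        linarith [dist_triangle_left y x₀ z]
      rw [this]
      simp
    · exact indicator_of_notMem hyD _
  rw [setIntegral_congr_fun (g := fun y => (whit (fun y => infDist y A) z y : ℂ) * w y * f y)
    measurableSet_ball fun y hy => by simp only [indicator_of_mem hy]] at key
  refine key.trans_eq ?_
  have e : (2 : ℝ≥0∞) * (ENNReal.ofReal (3 / π * (6 / (δ / 40) ^ 3)) * ENNReal.ofReal (3 * δ) ^ 3) =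
      ENNReal.ofReal (62208000 / π) := by
    rw [← ENNReal.ofReal_pow (by positivity), ← ENNReal.ofReal_mul (by positivity),
      show (2 : ℝ≥0∞) = ENNReal.ofReal 2 by simp, ← ENNReal.ofReal_mul (by positivity)]
    congr 1
    field_simp
    norm_num
  have ec (x : ℝ) : ((x.toNNReal : ℝ≥0) : ℝ≥0∞) = ENNReal.ofReal x := rfl
  rw [← e, ENNReal.coe_mul, ec]
  ring

variable {E : Set ℂ}

theorem LipTestBound.enorm_integral_whit_vSet_le (h : LipTestBound f A K)
    (hAD : A ⊆ ball 0 1) (hinteg : IntegrableOn f (ball 0 1)) (hE : MeasurableSet E) (hEA : E ⊆ A)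
    (hz : z ∈ ball (0 : ℂ) 1) (hd : 0 < infDist z A) :
    ‖∫ y in ball 0 1, (whit (fun y => infDist y A) z y : ℂ) * vSet E y * f y‖ₑ ≤
      ENNReal.ofReal (62208000 / π) * K * (ENNReal.ofReal (384 * π) + 2 * ‖vSet E z‖ₑ) := by
  have hpi := Real.pi_pos
  have hA : A.Nonempty := by
    rw [nonempty_iff_ne_empty]
    rintro rfl
    simp at hd
  set δ := infDist z A with hδ
  have hEz : ∀ x ∈ E, δ ≤ ‖x - z‖ := fun x hx => by
    rw [norm_sub_rev, ← dist_eq_norm]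
    exact infDist_le_dist_of_mem (hEA hx)
  have hED := hEA.trans hAD
  have hyz {y : ℂ} (hy : y ∈ ball (0 : ℂ) 1 ∩ ball z (δ / 2)) : ‖y - z‖ < δ / 2 := by
    rw [← dist_eq_norm]
    exact hy.2
  have hW : ((Real.toNNReal (384 * π) : ℝ≥0) : ℝ) = 384 * π := Real.coe_toNNReal _ (by positivity)
  have hW' : ((Real.toNNReal (128 * π) : ℝ≥0) : ℝ) = 128 * π := Real.coe_toNNReal _ (by positivity)
  by_cases hb : 1 - ‖z‖ ≤ δ
  · have hw2 : ∀ y ∈ ball (0 : ℂ) 1 ∩ ball z (δ / 2), ‖vSet E y‖ ≤ 256 * π * (1 - ‖y‖) / δ :=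
      fun y hy => norm_vSet_le_boundary hE hED hd hEz hy
    have := h.enorm_integral_whit_mul_le hA hAD hz hd (w := vSet E) (W := Real.toNNReal (384 * π))
      (fun y hy => by
        refine (hw2 y hy).trans ?_
        rw [hW, div_le_iff₀ hd]
        have h1 := hyz hy
        have h2 := norm_sub_norm_le z y
        rw [norm_sub_rev] at h2
        nlinarith)
      (fun y hy => by
        refine (hw2 y hy).trans ?_
        have := mem_ball_zero_iff.1 hy.1
        rw [hW]
        gcongr
        linarith)
      (fun y hy y' hy' => by
        refine (norm_vSet_sub_le hE hED hd hEz hy hy').trans ?_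
        rw [hW]
        gcongr
        norm_num)
    exact this.trans (mul_le_mul_right le_self_add _)
  · rw [not_le] at hb
    have hzm : z ∈ ball (0 : ℂ) 1 ∩ ball z (δ / 2) := ⟨hz, mem_ball_self (by positivity)⟩
    have hyb {y : ℂ} (hy : y ∈ ball (0 : ℂ) 1 ∩ ball z (δ / 2)) : δ / 2 ≤ 1 - ‖y‖ := by
      have h1 := hyz hy
      have h2 := norm_sub_norm_le y z
      linarith
    have hw {y : ℂ} (hy : y ∈ ball (0 : ℂ) 1 ∩ ball z (δ / 2)) :
        ‖vSet E y - vSet E z‖ ≤ 64 * π := by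
      refine (norm_vSet_sub_le hE hED hd hEz hy hzm).trans ?_
      rw [div_le_iff₀ hd]
      have h1 := hyz hy
      nlinarith
    have a1 : ∀ y ∈ ball (0 : ℂ) 1 ∩ ball z (δ / 2),
        ‖vSet E y - vSet E z‖ ≤ (Real.toNNReal (128 * π) : ℝ≥0) := fun y hy => by
      rw [hW']
      linarith [hw hy]
    have a2 : ∀ y ∈ ball (0 : ℂ) 1 ∩ ball z (δ / 2),
        ‖vSet E y - vSet E z‖ ≤ (Real.toNNReal (128 * π) : ℝ≥0) * (1 - ‖y‖) / δ := fun y hy => by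
      rw [hW', le_div_iff₀ hd]
      have := hw hy
      have := hyb hy
      nlinarith
    have a3 : ∀ y ∈ ball (0 : ℂ) 1 ∩ ball z (δ / 2), ∀ y' ∈ ball (0 : ℂ) 1 ∩ ball z (δ / 2),
        ‖(vSet E y - vSet E z) - (vSet E y' - vSet E z)‖ ≤
          (Real.toNNReal (128 * π) : ℝ≥0) * ‖y - y'‖ / δ := fun y hy y' hy' => by
      rw [hW', sub_sub_sub_cancel_right]
      exact norm_vSet_sub_le hE hED hd hEz hy hy'
    have b1 : ∀ y ∈ ball (0 : ℂ) 1 ∩ ball z (δ / 2), ‖(fun _ : ℂ => (1 : ℂ)) y‖ ≤ (2 : ℝ≥0) :=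
      fun y hy => by norm_num
    have b2 : ∀ y ∈ ball (0 : ℂ) 1 ∩ ball z (δ / 2),
        ‖(fun _ : ℂ => (1 : ℂ)) y‖ ≤ (2 : ℝ≥0) * (1 - ‖y‖) / δ := fun y hy => by
      rw [le_div_iff₀ hd]
      have := hyb hy
      norm_num
      linarith
    have b3 : ∀ y ∈ ball (0 : ℂ) 1 ∩ ball z (δ / 2), ∀ y' ∈ ball (0 : ℂ) 1 ∩ ball z (δ / 2),
        ‖(fun _ : ℂ => (1 : ℂ)) y - (fun _ : ℂ => (1 : ℂ)) y'‖ ≤ (2 : ℝ≥0) * ‖y - y'‖ / δ :=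
      fun y hy y' hy' => by
        simp only [sub_self, norm_zero]
        positivity
    have e : ∫ y in ball 0 1, (whit (fun y => infDist y A) z y : ℂ) * vSet E y * f y =
        (∫ y in ball 0 1, (whit (fun y => infDist y A) z y : ℂ) * (vSet E y - vSet E z) * f y) +
        vSet E z * ∫ y in ball 0 1, (whit (fun y => infDist y A) z y : ℂ) * 1 * f y := by
      rw [← integral_const_mul, ← integral_add (integrableOn_whit_mul hA hAD hinteg hd a1 a2 a3)
        ((integrableOn_whit_mul hA hAD hinteg hd b1 b2 b3).const_mul _)]
      congr 1 with y
      ring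
    rw [e]
    refine (enorm_add_le _ _).trans ?_
    rw [enorm_mul]
    have hA1 := h.enorm_integral_whit_mul_le hA hAD hz hd a1 a2 a3
    have hB1 := h.enorm_integral_whit_mul_le hA hAD hz hd b1 b2 b3
    calc _ ≤ ENNReal.ofReal (62208000 / π) * K * ENNReal.ofReal (128 * π) +
          ‖vSet E z‖ₑ * (ENNReal.ofReal (62208000 / π) * K * 2) :=
        add_le_add hA1 (mul_le_mul_right (by exact_mod_cast hB1) _)
      _ ≤ ENNReal.ofReal (62208000 / π) * K * ENNReal.ofReal (384 * π) +
          ‖vSet E z‖ₑ * (ENNReal.ofReal (62208000 / π) * K * 2) := by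
        gcongr
        norm_num
      _ = _ := by ring

theorem setIntegral_eq_integral_whit (hA : A.Nonempty) (hAD : A ⊆ ball 0 1) (hAm : MeasurableSet A)
    (hpos : ∀ y ∈ ball (0 : ℂ) 1 \ A, 0 < infDist y A) {g : ℂ → ℂ}
    (hg : IntegrableOn g (ball 0 1 \ A)) :
    ∫ y in ball 0 1 \ A, g y = ∫ z in ball 0 1 \ A, ∫ y in ball 0 1,
      (whit (fun y => infDist y A) z y : ℂ) * g y := by
  set d : ℂ → ℝ := fun y => infDist y A with hd
  have hms : MeasurableSet (ball (0 : ℂ) 1 \ A) := measurableSet_ball.diff hAm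
  have hsub {y z : ℂ} (hy : y ∈ ball (0 : ℂ) 1 \ A) (hne : whit d z y ≠ 0) :
      z ∈ ball (0 : ℂ) 1 \ A := by
    refine ⟨mem_ball_zero_iff.2 (norm_lt_one_of_whit_ne_zero (mem_ball_zero_iff.1 hy.1).le
      (infDist_le_two hA hAD hy.1) hne), fun hz => ?_⟩
    have h1 := norm_sub_le_of_whit_infDist_ne_zero hy.1 hne
    rw [infDist_zero_of_mem hz, zero_div] at h1
    rw [sub_eq_zero.1 (norm_le_zero_iff.1 h1)] at hz
    exact hy.2 hz
  have hone {y : ℂ} (hy : y ∈ ball (0 : ℂ) 1 \ A) :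
      ∫ z in ball 0 1 \ A, whit d z y = 1 := by
    rw [setIntegral_eq_integral_of_forall_compl_eq_zero, integral_whit (hpos y hy)]
    intro z hz
    by_contra hne
    exact hz (hsub hy hne)
  have hinner (z : ℂ) : ∫ y in ball 0 1, (whit d z y : ℂ) * g y =
      ∫ y in ball 0 1 \ A, (whit d z y : ℂ) * g y := by
    refine (setIntegral_eq_of_subset_of_forall_sdiff_eq_zero measurableSet_ball sdiff_subset
      fun y hy => ?_)
    have hyA : y ∈ A := by
      by_contra hc
      exact hy.2 ⟨hy.1, hc⟩
    rw [whit_eq_zero (infDist_zero_of_mem hyA)]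
    simp
  simp only [hinner]
  have hmeas : AEStronglyMeasurable (fun p : ℂ × ℂ => (whit d p.2 p.1 : ℂ) * g p.1)
      ((volume.restrict (ball 0 1 \ A)).prod (volume.restrict (ball 0 1 \ A))) := by
    refine AEStronglyMeasurable.mul ?_ hg.aestronglyMeasurable.comp_fst
    exact (Complex.measurable_ofReal.comp
      ((measurable_whit (continuous_infDist_pt A)).comp measurable_swap)).aestronglyMeasurable
  have hprod : Integrable (fun p : ℂ × ℂ => (whit d p.2 p.1 : ℂ) * g p.1)
      ((volume.restrict (ball 0 1 \ A)).prod (volume.restrict (ball 0 1 \ A))) := by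
    rw [integrable_prod_iff hmeas]
    refine ⟨(ae_restrict_iff' hms).2 (Eventually.of_forall fun y hy => ?_), ?_⟩
    · have hw : IntegrableOn (fun z => (whit d z y : ℂ)) (ball 0 1 \ A) :=
        (integrable_whit (d := d) (hpos y hy)).integrableOn.ofReal
      exact hw.mul_const (g y)
    · refine hg.norm.congr ((ae_restrict_iff' hms).2 (Eventually.of_forall fun y hy => ?_))
      have e (z : ℂ) : ‖(whit d z y : ℂ) * g y‖ = whit d z y * ‖g y‖ := by
        rw [norm_mul, Complex.norm_real, Real.norm_eq_abs,
          abs_of_nonneg (whit_nonneg infDist_nonneg z)]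
      simp only [e]
      rw [integral_mul_const, hone hy, one_mul]
  rw [← integral_integral_swap (f := fun y z => (whit d z y : ℂ) * g y) hprod]
  refine setIntegral_congr_fun hms fun y hy => ?_
  beta_reduce
  rw [integral_mul_const, integral_complex_ofReal, hone hy]
  simp

/-- The weighted estimate off the good set `A` obtained by averaging over Whitney bumps. -/
theorem LipTestBound.enorm_setIntegral_vSet_mul_le (h : LipTestBound f A K) (hA : A.Nonempty)
    (hAD : A ⊆ ball 0 1) (hAm : MeasurableSet A)
    (hpos : ∀ y ∈ ball (0 : ℂ) 1 \ A, 0 < infDist y A) (hf : ContinuousOn f (ball 0 1))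
    (hinteg : IntegrableOn f (ball 0 1)) (hE : IsCompact E) (hEA : E ⊆ A) {M : ℝ} (hM : 0 < M) :
    ‖∫ y in ball 0 1 \ A, vSet E y * f y‖ₑ ≤ ENNReal.ofReal (62208000 / π) * K *
      (ENNReal.ofReal (384 * π + M) * volume (ball 0 1 \ A) +
        ENNReal.ofReal (4 * π ^ 2 / M) * volume E) := by
  have hpi := Real.pi_pos
  have hms : MeasurableSet (ball (0 : ℂ) 1 \ A) := measurableSet_ball.diff hAm
  have hsub : ball (0 : ℂ) 1 \ A ⊆ ball 0 1 \ E := sdiff_subset_sdiff_right hEA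
  have hg : IntegrableOn (fun y => vSet E y * (f y : ℂ)) (ball 0 1 \ A) :=
    (integrableOn_vSet_mul hE (hEA.trans hAD) (Complex.continuous_ofReal.comp_continuousOn hf)
      hinteg.ofReal).mono_set hsub
  rw [setIntegral_eq_integral_whit hA hAD hAm hpos hg]
  have hamgm (x : ℂ) : 2 * ‖x‖ₑ ≤ ENNReal.ofReal M + ENNReal.ofReal (1 / M) * ‖x‖ₑ ^ 2 := by
    rw [← ofReal_norm, ← ENNReal.ofReal_pow (norm_nonneg _), ← ENNReal.ofReal_mul (by positivity),
      ← ENNReal.ofReal_add hM.le (by positivity), show (2 : ℝ≥0∞) = ENNReal.ofReal 2 by simp,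
      ← ENNReal.ofReal_mul (by positivity)]
    refine ENNReal.ofReal_le_ofReal ?_
    have := sq_nonneg (M - ‖x‖)
    rw [← sub_nonneg]
    have e : M + 1 / M * ‖x‖ ^ 2 - 2 * ‖x‖ = (M - ‖x‖) ^ 2 / M := by
      field_simp
      ring
    rw [e]
    positivity
  set B := ENNReal.ofReal (62208000 / π) * K
  calc ‖∫ z in ball 0 1 \ A, ∫ y in ball 0 1,
        (whit (fun y => infDist y A) z y : ℂ) * (vSet E y * f y)‖ₑ
      ≤ ∫⁻ z in ball 0 1 \ A, B * (ENNReal.ofReal (384 * π + M) +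
          ENNReal.ofReal (1 / M) * ‖vSet E z‖ₑ ^ 2) := by
        refine (enorm_integral_le_lintegral_enorm _).trans (setLIntegral_mono' hms fun z hz => ?_)
        have h1 := h.enorm_integral_whit_vSet_le hAD hinteg hE.measurableSet hEA hz.1 (hpos z hz)
        simp only [mul_assoc] at h1 ⊢
        simp only [← mul_assoc _ K] at h1
        refine h1.trans (mul_le_mul_right ?_ _)
        rw [ENNReal.ofReal_add (by positivity) hM.le, add_assoc]
        gcongr
        exact hamgm _
    _ = B * (ENNReal.ofReal (384 * π + M) * volume (ball (0 : ℂ) 1 \ A) +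
          ENNReal.ofReal (1 / M) * ∫⁻ z in ball 0 1 \ A, ‖vSet E z‖ₑ ^ 2) := by
        have hm : Measurable fun z => ‖vSet E z‖ₑ ^ 2 := (measurable_vSet E).enorm.pow_const 2
        rw [lintegral_const_mul _ (by fun_prop), lintegral_add_left measurable_const,
          lintegral_const_mul _ hm]
        simp
    _ ≤ _ := by
        refine mul_le_mul_right (add_le_add_right ?_ _) _
        calc _ ≤ ENNReal.ofReal (1 / M) * (ENNReal.ofReal (4 * π ^ 2) * volume E) :=
              mul_le_mul_right ((lintegral_mono_set hsub).trans
                (lintegral_vSet_le hE (hEA.trans hAD))) _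
          _ = _ := by
              rw [← mul_assoc, ← ENNReal.ofReal_mul (by positivity)]
              ring_nf

end averaged

theorem ENNReal.le_add_of_sq_le {x a b : ℝ≥0∞} (h : x ^ 2 ≤ 4 * a * b) : x ≤ a + b := by
  by_cases ha : a = ∞
  · simp [ha]
  by_cases hb : b = ∞
  · simp [hb]
  rw [← ENNReal.pow_le_pow_left_iff (n := 2) (by simp)]
  refine h.trans ?_
  lift a to ℝ≥0 using ha
  lift b to ℝ≥0 using hb
  norm_cast
  rw [← NNReal.coe_le_coe]
  push_cast
  nlinarith [sq_nonneg ((a : ℝ) - b)]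

theorem ofReal_mul_volume_le_enorm_setIntegral {Q : ℂ → ℂ} {E : Set ℂ} (hE : IsCompact E)
    (hQ : ContinuousOn Q E) {t : ℝ} (ht : 0 ≤ t) {ω : ℂ} (hω : ‖ω‖ = 1)
    (h : ∀ x ∈ E, t ≤ (ω * Q x).re) :
    ENNReal.ofReal t * volume E ≤ ‖∫ x in E, Q x‖ₑ := by
  have hi : IntegrableOn Q E := hQ.integrableOn_compact hE
  have h1 : t * volume.real E ≤ ‖∫ x in E, Q x‖ := by
    calc t * volume.real E = ∫ _ in E, t := by rw [setIntegral_const, smul_eq_mul, mul_comm]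
      _ ≤ ∫ x in E, (ω * Q x).re :=
        setIntegral_mono_on (integrableOn_const hE.measure_lt_top.ne) (hi.const_mul ω).re
          hE.measurableSet h
      _ = (∫ x in E, ω * Q x).re := integral_re (hi.const_mul ω)
      _ ≤ ‖∫ x in E, ω * Q x‖ := Complex.re_le_norm _
      _ = ‖∫ x in E, Q x‖ := by rw [integral_const_mul, norm_mul, hω, one_mul]
  rw [← ofReal_norm]
  refine le_trans (le_of_eq ?_) (ENNReal.ofReal_le_ofReal h1)
  rw [ENNReal.ofReal_mul ht, measureReal_def, ENNReal.ofReal_toReal hE.measure_lt_top.ne]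

section goodLambda

variable {φ : ℂ → ℂ} {f : ℂ → ℝ} {A : Set ℂ}

/-- The good-`λ` inequality on compact subsets of the good set. -/
theorem volume_compact_le {K : ℝ} (hK : 0 < K) {t : ℝ} (ht : 0 < t)
    (hφ : ContDiffOn ℝ (⊤ : ℕ∞) φ (ball 0 1)) (hφc : ContinuousOn φ (closedBall 0 1))
    (h0 : ∀ y ∈ sphere (0 : ℂ) 1, φ y = 0)
    (hf : ∀ y ∈ ball (0 : ℂ) 1, dz (dzbar φ) y = (4⁻¹ : ℂ) * f y)
    (hfc : ContinuousOn f (ball 0 1)) (hinteg : IntegrableOn f (ball 0 1))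
    (hAD : A ⊆ ball 0 1) (hAm : MeasurableSet A)
    (hpos : A.Nonempty → ∀ y ∈ ball (0 : ℂ) 1 \ A, 0 < infDist y A)
    (hLip : LipTestBound f A (ENNReal.ofReal (K * t)))
    {E : Set ℂ} (hE : IsCompact E) (hEA : E ⊆ A) {ω : ℂ} (hω : ‖ω‖ = 1)
    (hEQ : ∀ x ∈ E, t ≤ (ω * dz (dz φ) x).re) :
    volume E ≤ ENNReal.ofReal (32 / t ^ 2) * (∫⁻ y in A, ‖dz (dzbar φ) y‖ₑ ^ 2) +
      ENNReal.ofReal (31104000 / π ^ 2 * K * (384 * π + 248832000 * K)) *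
        volume (ball (0 : ℂ) 1 \ A) := by
  have hpi := Real.pi_pos
  rcases A.eq_empty_or_nonempty with rfl | hA
  · rw [subset_empty_iff.1 hEA]
    simp
  have hED := hEA.trans hAD
  set M : ℝ := 248832000 * K with hM
  set g := dz (dzbar φ) with hg
  set V := volume E with hV
  set U := volume (ball (0 : ℂ) 1 \ A) with hU
  have hgc : ContinuousOn g (ball 0 1) :=
    (contDiffOn_dz isOpen_ball (contDiffOn_dzbar isOpen_ball hφ)).continuousOn
  have hQc : ContinuousOn (dz (dz φ)) (ball 0 1) :=
    (contDiffOn_dz isOpen_ball (contDiffOn_dz isOpen_ball hφ)).continuousOn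
  have hgi : IntegrableOn g (ball 0 1) := by
    have : IntegrableOn (fun y => (4⁻¹ : ℂ) * (f y : ℂ)) (ball 0 1) := hinteg.ofReal.const_mul _
    exact this.congr_fun (fun y hy => (hf y hy).symm) measurableSet_ball
  have hvg := integrableOn_vSet_mul hE hED hgc hgi
  have hVt : V ≠ ∞ := hE.measure_lt_top.ne
  set G := ∫⁻ y in A, ‖g y‖ₑ ^ 2 with hG
  have hsplit : ∫ y in ball 0 1 \ E, vSet E y * g y =
      (∫ y in A \ E, vSet E y * g y) + ∫ y in ball 0 1 \ A, vSet E y * g y := by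
    have e : ball (0 : ℂ) 1 \ E = (A \ E) ∪ (ball 0 1 \ A) := by
      ext y
      simp only [Set.mem_sdiff, mem_union]
      have := @hAD y
      have := @hEA y
      tauto
    have hdis : Disjoint (A \ E) (ball (0 : ℂ) 1 \ A) :=
      Set.disjoint_left.2 fun y hy hy' => hy'.2 hy.1
    rw [e] at hvg ⊢
    exact setIntegral_union hdis (measurableSet_ball.diff hAm)
      (hvg.mono_set subset_union_left) (hvg.mono_set subset_union_right)
  have hamgm {x : ℝ≥0∞} (hx : x ^ 2 ≤ ENNReal.ofReal (4 * π ^ 2) * V * G) :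
      x ≤ ENNReal.ofReal (π * t / 8) * V + ENNReal.ofReal (8 * π / t) * G := by
    refine ENNReal.le_add_of_sq_le (hx.trans_eq ?_)
    have e : ENNReal.ofReal (4 * π ^ 2) =
        4 * ENNReal.ofReal (π * t / 8) * ENNReal.ofReal (8 * π / t) := by
      rw [show (4 : ℝ≥0∞) = ENNReal.ofReal 4 by simp, ← ENNReal.ofReal_mul (by positivity),
        ← ENNReal.ofReal_mul (by positivity)]
      congr 1
      field_simp
    rw [e]
    ring
  have h1 : ‖π * (∫ y in E, dz (dz φ) y) - ∫ y in ball 0 1 \ E, vSet E y * g y‖ₑ ≤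
      ENNReal.ofReal (π * t / 8) * V + ENNReal.ofReal (8 * π / t) * G := by
    refine hamgm ((enorm_green_vSet_sq_le hE hED hφ hφc h0 hgi).trans ?_)
    exact mul_le_mul_right (lintegral_mono_set hEA) _
  have h2 : ‖∫ y in A \ E, vSet E y * g y‖ₑ ≤
      ENNReal.ofReal (π * t / 8) * V + ENNReal.ofReal (8 * π / t) * G := by
    refine (enorm_integral_le_lintegral_enorm _).trans (hamgm ?_)
    simp only [enorm_mul]
    refine (lintegral_mul_sq_le (measurable_vSet E).enorm.aemeasurable ?_).trans ?_
    · exact (hgc.mono (sdiff_subset.trans hAD)).aestronglyMeasurable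
        (hAm.diff hE.measurableSet) |>.enorm
    · refine mul_le_mul' ((lintegral_mono_set (sdiff_subset_sdiff_left hAD)).trans
        (lintegral_vSet_le hE hED)) (lintegral_mono_set sdiff_subset)
  have h3 : ‖∫ y in ball 0 1 \ A, vSet E y * g y‖ₑ ≤
      ENNReal.ofReal (15552000 / π * (K * t) * (384 * π + M)) * U +
        ENNReal.ofReal (π * t / 4) * V := by
    have e : ∫ y in ball 0 1 \ A, vSet E y * g y =
        (4⁻¹ : ℂ) * ∫ y in ball 0 1 \ A, vSet E y * (f y : ℂ) := by
      rw [← integral_const_mul]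
      refine setIntegral_congr_fun (measurableSet_ball.diff hAm) fun y hy => ?_
      beta_reduce
      rw [hf y hy.1]
      ring
    rw [e, enorm_mul]
    have key := hLip.enorm_setIntegral_vSet_mul_le hA hAD hAm (hpos hA) hfc hinteg hE hEA
      (M := M) (by positivity)
    have e4 : ‖(4⁻¹ : ℂ)‖ₑ = ENNReal.ofReal (1 / 4) := by
      rw [← ofReal_norm]
      norm_num
    rw [e4]
    refine (mul_le_mul_right key _).trans_eq ?_
    have e1 : ENNReal.ofReal (15552000 / π * (K * t) * (384 * π + M)) =
        ENNReal.ofReal (1 / 4) * (ENNReal.ofReal (62208000 / π) * ENNReal.ofReal (K * t) *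
          ENNReal.ofReal (384 * π + M)) := by
      rw [← ENNReal.ofReal_mul (by positivity), ← ENNReal.ofReal_mul (by positivity),
        ← ENNReal.ofReal_mul (by positivity)]
      ring_nf
    have e2 : ENNReal.ofReal (π * t / 4) =
        ENNReal.ofReal (1 / 4) * (ENNReal.ofReal (62208000 / π) * ENNReal.ofReal (K * t) *
          ENNReal.ofReal (4 * π ^ 2 / M)) := by
      rw [← ENNReal.ofReal_mul (by positivity), ← ENNReal.ofReal_mul (by positivity),
        ← ENNReal.ofReal_mul (by positivity), hM]
      congr 1
      field_simp
      norm_num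
    rw [e1, e2]
    ring
  have hlow : ENNReal.ofReal (π * t) * V ≤ ‖(π : ℂ) * ∫ y in E, dz (dz φ) y‖ₑ := by
    have eπ : ‖(π : ℂ)‖ₑ = ENNReal.ofReal π := by
      rw [← ofReal_norm, Complex.norm_real, Real.norm_of_nonneg hpi.le]
    rw [enorm_mul, eπ, ENNReal.ofReal_mul hpi.le, mul_assoc]
    exact mul_le_mul_right
      (ofReal_mul_volume_le_enorm_setIntegral hE (hQc.mono hED) ht.le hω hEQ) _
  have hsum : ENNReal.ofReal (π * t) * V ≤ ENNReal.ofReal (π * t / 2) * V +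
      (ENNReal.ofReal (16 * π / t) * G +
        ENNReal.ofReal (15552000 / π * (K * t) * (384 * π + M)) * U) := by
    have e : (π : ℂ) * (∫ y in E, dz (dz φ) y) =
        (π * (∫ y in E, dz (dz φ) y) - ∫ y in ball 0 1 \ E, vSet E y * g y) +
        ((∫ y in A \ E, vSet E y * g y) + ∫ y in ball 0 1 \ A, vSet E y * g y) := by
      rw [← hsplit]
      ring
    rw [e] at hlow
    refine hlow.trans ((enorm_add_le _ _).trans ((add_le_add h1 ((enorm_add_le _ _).trans
      (add_le_add h2 h3))).trans_eq ?_))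
    have e1 : ENNReal.ofReal (π * t / 2) = ENNReal.ofReal (π * t / 8) +
        ENNReal.ofReal (π * t / 8) + ENNReal.ofReal (π * t / 4) := by
      rw [← ENNReal.ofReal_add (by positivity) (by positivity),
        ← ENNReal.ofReal_add (by positivity) (by positivity)]
      ring_nf
    have e2 : ENNReal.ofReal (16 * π / t) =
        ENNReal.ofReal (8 * π / t) + ENNReal.ofReal (8 * π / t) := by
      rw [← ENNReal.ofReal_add (by positivity) (by positivity)]
      ring_nf
    rw [e1, e2]
    ring
  have hhalf : ENNReal.ofReal (π * t / 2) * V ≤ ENNReal.ofReal (16 * π / t) * G +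
      ENNReal.ofReal (15552000 / π * (K * t) * (384 * π + M)) * U := by
    have e : ENNReal.ofReal (π * t) = ENNReal.ofReal (π * t / 2) + ENNReal.ofReal (π * t / 2) := by
      rw [← ENNReal.ofReal_add (by positivity) (by positivity)]
      ring_nf
    rw [e, add_mul] at hsum
    exact (ENNReal.add_le_add_iff_left (by finiteness)).1 hsum
  calc V = ENNReal.ofReal (2 / (π * t)) * (ENNReal.ofReal (π * t / 2) * V) := by
        rw [← mul_assoc, ← ENNReal.ofReal_mul (by positivity)]
        have : 2 / (π * t) * (π * t / 2) = 1 := by field_simp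
        rw [this]
        simp
    _ ≤ ENNReal.ofReal (2 / (π * t)) * (ENNReal.ofReal (16 * π / t) * G +
      ENNReal.ofReal (15552000 / π * (K * t) * (384 * π + M)) * U) := mul_le_mul_right hhalf _
    _ = _ := by
        rw [mul_add, ← mul_assoc, ← mul_assoc, ← ENNReal.ofReal_mul (by positivity),
          ← ENNReal.ofReal_mul (by positivity)]
        congr 3
        · field_simp
          norm_num
        · field_simp
          ring

end goodLambda

theorem lintegral_eq_layer {α : Type*} [MeasurableSpace α] {μ : Measure α} [SFinite μ]
    {h : α → ℝ≥0∞} (hh : Measurable h) :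
    ∫⁻ x, h x ∂μ = ∫⁻ t in Ioi (0 : ℝ), μ {x | ENNReal.ofReal t < h x} := by
  have := lintegral_layer (μ := μ) (w := fun _ => 1) measurable_const hh (k := fun _ => 1)
    measurable_const
  simp only [one_mul, lintegral_const, Measure.restrict_apply_univ] at this
  rw [← this]
  refine lintegral_congr fun x => ?_
  have := rpow_eq_layer one_pos (h x)
  simpa using this

/-- `F² ∫_F^∞ t⁻² dt ≤ F`. -/
theorem sq_mul_lintegral_inv_sq_le (c : ℝ≥0∞) :
    c ^ 2 * ∫⁻ t in Ioi (0 : ℝ), {t | c ≤ ENNReal.ofReal t}.indicator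
      (fun t => ENNReal.ofReal (1 / t ^ 2)) t ≤ c := by
  rcases eq_or_ne c ∞ with rfl | hc
  · simp
  lift c to ℝ≥0 using hc
  rcases eq_or_ne c 0 with rfl | hc0
  · simp
  have hc' : (0 : ℝ) < c := by positivity
  have e : ∫⁻ t in Ioi (0 : ℝ), {t | (c : ℝ≥0∞) ≤ ENNReal.ofReal t}.indicator
      (fun t => ENNReal.ofReal (1 / t ^ 2)) t = ENNReal.ofReal (1 / c) := by
    have hset : {t : ℝ | (c : ℝ≥0∞) ≤ ENNReal.ofReal t} = Ici (c : ℝ) := by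
      ext t
      simp only [mem_ofPred_eq, mem_Ici]
      rw [← ENNReal.ofReal_coe_nnreal, ENNReal.ofReal_le_ofReal_iff']
      constructor
      · rintro (h | h)
        · exact h
        · linarith
      · exact Or.inl
    rw [hset, setLIntegral_indicator measurableSet_Ici, inter_eq_left.2 (Ici_subset_Ioi.2 hc'),
      setLIntegral_congr Ioi_ae_eq_Ici.symm]
    have h2 : ∀ t ∈ Ioi (c : ℝ), 1 / t ^ 2 = t ^ (-2 : ℝ) := fun t ht => by
      rw [Real.rpow_neg (hc'.trans ht).le, one_div]
      norm_cast
    rw [setLIntegral_congr_fun measurableSet_Ioi fun t ht => by rw [h2 t ht],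
      ← ofReal_integral_eq_lintegral_ofReal (integrableOn_Ioi_rpow_of_lt (by norm_num) hc')
        ((ae_restrict_iff' measurableSet_Ioi).2 (Eventually.of_forall fun t ht =>
          Real.rpow_nonneg (hc'.trans ht).le _)),
      integral_Ioi_rpow_of_lt (by norm_num) hc', show (-2 + 1 : ℝ) = -1 by norm_num,
      Real.rpow_neg_one]
    congr 1
    field_simp
  rw [e, ← ENNReal.ofReal_coe_nnreal, ← ENNReal.ofReal_pow hc'.le,
    ← ENNReal.ofReal_mul (by positivity)]
  refine ENNReal.ofReal_le_ofReal (le_of_eq ?_)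
  field_simp

theorem lintegral_inv_sq_mul_le {μ : Measure ℂ} [SFinite μ] {F : ℂ → ℝ≥0∞} (hF : Measurable F) :
    ∫⁻ t in Ioi (0 : ℝ), ENNReal.ofReal (1 / t ^ 2) *
      (∫⁻ x in {x | F x ≤ ENNReal.ofReal t}, F x ^ 2 ∂μ) ≤ ∫⁻ x, F x ∂μ := by
  have hS : MeasurableSet {p : ℝ × ℂ | F p.2 ≤ ENNReal.ofReal p.1} :=
    measurableSet_le (by fun_prop) (by fun_prop)
  set k : ℝ × ℂ → ℝ≥0∞ := {p : ℝ × ℂ | F p.2 ≤ ENNReal.ofReal p.1}.indicator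
    fun p => ENNReal.ofReal (1 / p.1 ^ 2) * F p.2 ^ 2 with hk
  have hkm : Measurable k := by
    refine Measurable.indicator ?_ hS
    have h1 : Measurable fun p : ℝ × ℂ => ENNReal.ofReal (1 / p.1 ^ 2) := by fun_prop
    have h2 : Measurable fun p : ℝ × ℂ => F p.2 ^ 2 := by fun_prop
    exact h1.mul h2
  have e1 (t : ℝ) : ENNReal.ofReal (1 / t ^ 2) *
      (∫⁻ x in {x | F x ≤ ENNReal.ofReal t}, F x ^ 2 ∂μ) = ∫⁻ x, k (t, x) ∂μ := by
    rw [← lintegral_indicator (measurableSet_le hF measurable_const),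
      ← lintegral_const_mul' _ _ (by finiteness)]
    refine lintegral_congr fun x => ?_
    by_cases h : F x ≤ ENNReal.ofReal t
    · rw [indicator_of_mem (show x ∈ {x | F x ≤ ENNReal.ofReal t} from h), hk,
        indicator_of_mem (show (t, x) ∈ {p : ℝ × ℂ | F p.2 ≤ ENNReal.ofReal p.1} from h)]
    · rw [indicator_of_notMem (show x ∉ {x | F x ≤ ENNReal.ofReal t} from h), hk,
        indicator_of_notMem (show (t, x) ∉ {p : ℝ × ℂ | F p.2 ≤ ENNReal.ofReal p.1} from h),
        mul_zero]
  simp only [e1]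
  rw [lintegral_lintegral_swap (f := fun t x => k (t, x)) hkm.aemeasurable]
  refine lintegral_mono fun x => le_trans (le_of_eq ?_) (sq_mul_lintegral_inv_sq_le (F x))
  rw [← lintegral_const_mul _ ((by fun_prop : Measurable fun t : ℝ =>
    ENNReal.ofReal (1 / t ^ 2)).indicator (measurableSet_le measurable_const (by fun_prop)))]
  refine lintegral_congr fun t => ?_
  by_cases h : F x ≤ ENNReal.ofReal t
  · rw [hk, indicator_of_mem (show t ∈ {t | F x ≤ ENNReal.ofReal t} from h),
      indicator_of_mem (show (t, x) ∈ {p : ℝ × ℂ | F p.2 ≤ ENNReal.ofReal p.1} from h), mul_comm]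
  · rw [hk, indicator_of_notMem (show t ∉ {t | F x ≤ ENNReal.ofReal t} from h),
      indicator_of_notMem (show (t, x) ∉ {p : ℝ × ℂ | F p.2 ≤ ENNReal.ofReal p.1} from h),
      mul_zero]

section goodLambda

variable {φ : ℂ → ℂ} {f : ℂ → ℝ} {F : ℂ → ℝ≥0∞} {K : ℝ}

theorem volume_superlevel_le (hK : 0 < K) {t : ℝ} (ht : 0 < t)
    (hφ : ContDiffOn ℝ (⊤ : ℕ∞) φ (ball 0 1)) (hφc : ContinuousOn φ (closedBall 0 1))
    (h0 : ∀ y ∈ sphere (0 : ℂ) 1, φ y = 0)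
    (hf : ∀ y ∈ ball (0 : ℂ) 1, dz (dzbar φ) y = (4⁻¹ : ℂ) * f y)
    (hfc : ContinuousOn f (ball 0 1)) (hinteg : IntegrableOn f (ball 0 1))
    (hFo : IsOpen {x | ENNReal.ofReal t < F x})
    (hfF : ∀ y ∈ ball (0 : ℂ) 1, ‖f y‖ₑ ≤ 2 * F y)
    (hLip : LipTestBound f (ball 0 1 ∩ {x | F x ≤ ENNReal.ofReal t}) (ENNReal.ofReal (K * t))) :
    volume.restrict (ball 0 1) {x | ENNReal.ofReal (2 * t) < ‖dz (dz φ) x‖ₑ} ≤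
      ENNReal.ofReal (1 + 4 * (31104000 / π ^ 2 * K * (384 * π + 248832000 * K))) *
        volume.restrict (ball 0 1) {x | ENNReal.ofReal t < F x} +
      32 * (ENNReal.ofReal (1 / t ^ 2) *
        ∫⁻ x in {x | F x ≤ ENNReal.ofReal t}, F x ^ 2 ∂volume.restrict (ball 0 1)) := by
  have hpi := Real.pi_pos
  set Q := dz (dz φ) with hQ
  set C : ℝ := 31104000 / π ^ 2 * K * (384 * π + 248832000 * K) with hC
  have hC0 : 0 ≤ C := by positivity
  set A : Set ℂ := ball 0 1 ∩ {x | F x ≤ ENNReal.ofReal t} with hA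
  have hcl : {x | F x ≤ ENNReal.ofReal t} = {x | ENNReal.ofReal t < F x}ᶜ := by
    ext x
    simp
  have hclosed : IsClosed {x | F x ≤ ENNReal.ofReal t} := by
    rw [hcl]
    exact hFo.isClosed_compl
  have hAm : MeasurableSet A := measurableSet_ball.inter hclosed.measurableSet
  have hΩ : ball (0 : ℂ) 1 \ A = {x | ENNReal.ofReal t < F x} ∩ ball 0 1 := by
    ext x
    simp only [hA, Set.mem_sdiff, mem_inter_iff, mem_ofPred_eq, not_and, not_le]
    tauto
  have hpos : A.Nonempty → ∀ y ∈ ball (0 : ℂ) 1 \ A, 0 < infDist y A := fun hne y hy => by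
    rw [← infDist_pos_iff_notMem_closure hne]
    intro hc
    have := closure_minimal inter_subset_right hclosed hc
    exact hy.2 ⟨hy.1, this⟩
  have hQc : ContinuousOn Q (ball 0 1) :=
    (contDiffOn_dz isOpen_ball (contDiffOn_dz isOpen_ball hφ)).continuousOn
  set G := ∫⁻ y in A, ‖dz (dzbar φ) y‖ₑ ^ 2 with hG
  set R := ENNReal.ofReal (32 / t ^ 2) * G + ENNReal.ofReal C * volume (ball (0 : ℂ) 1 \ A) with hR
  have hdir {ω : ℂ} (hω : ‖ω‖ = 1) : volume (A ∩ {x | t < (ω * Q x).re}) ≤ R := by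
    have hm : MeasurableSet (A ∩ {x | t < (ω * Q x).re}) := by
      have e : A ∩ {x | t < (ω * Q x).re} =
          A ∩ (ball 0 1 ∩ (fun x => (ω * Q x).re) ⁻¹' Ioi t) := by
        ext x
        simp only [hA, mem_inter_iff, mem_ofPred_eq, mem_preimage, mem_Ioi]
        tauto
      rw [e]
      refine hAm.inter (IsOpen.measurableSet ?_)
      refine ContinuousOn.isOpen_inter_preimage ?_ isOpen_ball isOpen_Ioi
      exact Complex.continuous_re.comp_continuousOn (continuousOn_const.mul hQc)
    rw [hm.measure_eq_iSup_isCompact]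
    refine iSup_le fun E => iSup_le fun hE => iSup_le fun hEc => ?_
    exact volume_compact_le hK ht hφ hφc h0 hf hfc hinteg inter_subset_left hAm hpos hLip hEc
      (hE.trans inter_subset_left) hω fun x hx => (hE hx).2.le
  have hGle : G ≤ 4⁻¹ * ∫⁻ x in A, F x ^ 2 := by
    rw [← lintegral_const_mul' _ _ (by simp)]
    refine setLIntegral_mono' hAm fun y hy => ?_
    rw [hf y hy.1, enorm_mul, mul_pow]
    have e4 : ‖(4⁻¹ : ℂ)‖ₑ = 4⁻¹ := by
      rw [enorm_inv (by norm_num), ← ofReal_norm]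
      norm_num
    have e5 : ‖(f y : ℂ)‖ₑ = ‖f y‖ₑ := by
      rw [← ofReal_norm, ← ofReal_norm, Complex.norm_real]
    rw [e4, e5]
    calc (4⁻¹ : ℝ≥0∞) ^ 2 * ‖f y‖ₑ ^ 2 ≤ (4⁻¹ : ℝ≥0∞) ^ 2 * (2 * F y) ^ 2 := by
          gcongr
          exact hfF y hy.1
      _ = 4⁻¹ * (4⁻¹ * 4) * F y ^ 2 := by ring
      _ = _ := by
          rw [ENNReal.inv_mul_cancel (by simp) (by simp), mul_one]
  have hcover : {x | ENNReal.ofReal (2 * t) < ‖Q x‖ₑ} ∩ ball 0 1 ⊆ (ball 0 1 \ A) ∪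
      ((A ∩ {x | t < (1 * Q x).re}) ∪ (A ∩ {x | t < (-1 * Q x).re}) ∪
      ((A ∩ {x | t < (Complex.I * Q x).re}) ∪ (A ∩ {x | t < (-Complex.I * Q x).re}))) := by
    rintro x ⟨hx, hxD⟩
    by_cases hxA : x ∈ A
    swap
    · exact Or.inl ⟨hxD, hxA⟩
    refine Or.inr ?_
    rw [mem_ofPred_eq, ← ofReal_norm, ENNReal.ofReal_lt_ofReal_iff_of_nonneg (by positivity)] at hx
    have h1 := Complex.norm_le_abs_re_add_abs_im (Q x)
    simp only [mem_union, mem_inter_iff, mem_ofPred_eq, hxA, true_and]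
    simp only [Complex.mul_re, Complex.neg_re, Complex.neg_im, Complex.I_re, Complex.I_im,
      Complex.one_re, Complex.one_im]
    by_contra! hcon
    obtain ⟨⟨h2, h3⟩, h4, h5⟩ := hcon
    have h6 : |(Q x).re| ≤ t := abs_le.2 ⟨by linarith, by linarith⟩
    have h7 : |(Q x).im| ≤ t := abs_le.2 ⟨by linarith, by linarith⟩
    linarith
  have hmain : volume ({x | ENNReal.ofReal (2 * t) < ‖Q x‖ₑ} ∩ ball 0 1) ≤
      volume (ball (0 : ℂ) 1 \ A) + (R + R + (R + R)) := by
    refine (measure_mono hcover).trans ((measure_union_le _ _).trans (add_le_add_right ?_ _))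
    refine (measure_union_le _ _).trans (add_le_add ?_ ?_) <;>
      refine (measure_union_le _ _).trans (add_le_add (hdir ?_) (hdir ?_)) <;> simp
  rw [Measure.restrict_apply' measurableSet_ball, Measure.restrict_apply' measurableSet_ball, ← hΩ,
    Measure.restrict_restrict hclosed.measurableSet,
    inter_comm {x | F x ≤ ENNReal.ofReal t} (ball (0 : ℂ) 1), ← hA]
  refine hmain.trans ?_
  set U := volume (ball (0 : ℂ) 1 \ A)
  calc U + (R + R + (R + R)) = (1 + 4 * ENNReal.ofReal C) * U +
        4 * (ENNReal.ofReal (32 / t ^ 2) * G) := by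
        rw [hR]
        ring
    _ ≤ (1 + 4 * ENNReal.ofReal C) * U +
        4 * (ENNReal.ofReal (32 / t ^ 2) * (4⁻¹ * ∫⁻ x in A, F x ^ 2)) := by gcongr
    _ = (1 + 4 * ENNReal.ofReal C) * U +
        (4⁻¹ * 4) * (ENNReal.ofReal (32 / t ^ 2) * ∫⁻ x in A, F x ^ 2) := by ring
    _ = _ := by
        rw [ENNReal.inv_mul_cancel (by simp) (by simp), one_mul,
          ENNReal.ofReal_add zero_le_one (by positivity), ENNReal.ofReal_mul (p := 4) (by norm_num),
          show (32 : ℝ) / t ^ 2 = 32 * (1 / t ^ 2) by ring,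
          ENNReal.ofReal_mul (p := 32) (by norm_num)]
        norm_num
        ring

theorem lintegral_dz_dz_le (hK : 0 < K)
    (hφ : ContDiffOn ℝ (⊤ : ℕ∞) φ (ball 0 1)) (hφc : ContinuousOn φ (closedBall 0 1))
    (h0 : ∀ y ∈ sphere (0 : ℂ) 1, φ y = 0)
    (hf : ∀ y ∈ ball (0 : ℂ) 1, dz (dzbar φ) y = (4⁻¹ : ℂ) * f y)
    (hfc : ContinuousOn f (ball 0 1)) (hinteg : IntegrableOn f (ball 0 1))
    (hFo : ∀ m, IsOpen {x | m < F x})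
    (hfF : ∀ y ∈ ball (0 : ℂ) 1, ‖f y‖ₑ ≤ 2 * F y)
    (hLip : ∀ t : ℝ, 0 < t →
      LipTestBound f (ball 0 1 ∩ {x | F x ≤ ENNReal.ofReal t}) (ENNReal.ofReal (K * t))) :
    ∫⁻ x in ball 0 1, ‖dz (dz φ) x‖ₑ ≤
      ENNReal.ofReal (66 + 8 * (31104000 / π ^ 2 * K * (384 * π + 248832000 * K))) *
        ∫⁻ x in ball 0 1, F x := by
  have hpi := Real.pi_pos
  set Q := dz (dz φ) with hQ
  set C : ℝ := 31104000 / π ^ 2 * K * (384 * π + 248832000 * K) with hC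
  have hC0 : 0 ≤ C := by positivity
  have hF : Measurable F := measurable_of_Ioi fun m => (hFo m).measurableSet
  set μ := (volume : Measure ℂ).restrict (ball 0 1) with hμ
  have hQc : ContinuousOn Q (ball 0 1) :=
    (contDiffOn_dz isOpen_ball (contDiffOn_dz isOpen_ball hφ)).continuousOn
  have hQm : AEMeasurable (fun x => ‖Q x‖ₑ) μ :=
    (hQc.aestronglyMeasurable measurableSet_ball).enorm
  have hlayer : ∫⁻ x, 2⁻¹ * ‖Q x‖ₑ ∂μ =
      ∫⁻ t in Ioi (0 : ℝ), μ {x | ENNReal.ofReal (2 * t) < ‖Q x‖ₑ} := by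
    have hmk := hQm.ae_eq_mk
    have hmkm := hQm.measurable_mk
    have e : ∫⁻ x, 2⁻¹ * ‖Q x‖ₑ ∂μ = ∫⁻ x, 2⁻¹ * hQm.mk _ x ∂μ :=
      lintegral_congr_ae (by filter_upwards [hmk] with x hx; rw [← hx])
    rw [e, lintegral_eq_layer (h := fun x => 2⁻¹ * hQm.mk _ x) (hmkm.const_mul _)]
    refine setLIntegral_congr_fun measurableSet_Ioi fun t ht => ?_
    refine measure_congr ?_
    filter_upwards [hmk] with x hx
    have : (ENNReal.ofReal t < 2⁻¹ * hQm.mk _ x) = (ENNReal.ofReal (2 * t) < ‖Q x‖ₑ) := by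
      rw [← hx, eq_iff_iff, ENNReal.ofReal_mul zero_le_two, ENNReal.ofReal_ofNat, mul_comm 2⁻¹,
        ← div_eq_mul_inv, ENNReal.lt_div_iff_mul_lt (by simp) (by simp), mul_comm]
    exact this
  have hFl := lintegral_eq_layer (μ := μ) hF
  have hF2 := lintegral_inv_sq_mul_le (μ := μ) hF
  have hhalf : ∫⁻ x, 2⁻¹ * ‖Q x‖ₑ ∂μ ≤
      ENNReal.ofReal (1 + 4 * C) * (∫⁻ x, F x ∂μ) + 32 * ∫⁻ x, F x ∂μ := by
    rw [hlayer]
    calc _ ≤ ∫⁻ t in Ioi (0 : ℝ), (ENNReal.ofReal (1 + 4 * C) * μ {x | ENNReal.ofReal t < F x} +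
          32 * (ENNReal.ofReal (1 / t ^ 2) *
            ∫⁻ x in {x | F x ≤ ENNReal.ofReal t}, F x ^ 2 ∂μ)) :=
          setLIntegral_mono' measurableSet_Ioi fun t ht =>
            volume_superlevel_le hK ht hφ hφc h0 hf hfc hinteg (hFo _) hfF (hLip t ht)
      _ = ENNReal.ofReal (1 + 4 * C) * (∫⁻ x, F x ∂μ) + 32 * ∫⁻ t in Ioi (0 : ℝ),
          (ENNReal.ofReal (1 / t ^ 2) * ∫⁻ x in {x | F x ≤ ENNReal.ofReal t}, F x ^ 2 ∂μ) := by
          have hanti : Measurable fun t : ℝ => μ {x | ENNReal.ofReal t < F x} :=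
            Antitone.measurable fun t t' htt => measure_mono fun x hx =>
              (ENNReal.ofReal_le_ofReal htt).trans_lt hx
          rw [lintegral_add_left (hanti.const_mul _), lintegral_const_mul _ hanti, ← hFl,
            lintegral_const_mul' _ _ (by simp)]
      _ ≤ _ := by gcongr
  calc ∫⁻ x, ‖Q x‖ₑ ∂μ = 2 * ∫⁻ x, 2⁻¹ * ‖Q x‖ₑ ∂μ := by
        rw [lintegral_const_mul' _ _ (by simp), ← mul_assoc,
          ENNReal.mul_inv_cancel (by simp) (by simp), one_mul]
    _ ≤ 2 * (ENNReal.ofReal (1 + 4 * C) * (∫⁻ x, F x ∂μ) + 32 * ∫⁻ x, F x ∂μ) := by gcongr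
    _ = _ := by
        rw [show (66 + 8 * C : ℝ) = 2 * (1 + 4 * C) + 64 by ring,
          ENNReal.ofReal_add (p := 2 * (1 + 4 * C)) (by positivity) (by positivity),
          ENNReal.ofReal_mul (p := 2) (by positivity), ENNReal.ofReal_ofNat, ENNReal.ofReal_ofNat]
        ring

end goodLambda

theorem fderiv_ofReal_comp {u : ℂ → ℝ} {z : ℂ} (hu : DifferentiableAt ℝ u z) (v : ℂ) :
    fderiv ℝ (fun y => (u y : ℂ)) z v = (fderiv ℝ u z v : ℂ) := by
  have h := (Complex.ofRealCLM.hasFDerivAt (x := u z)).comp z hu.hasFDerivAt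
  have h' : HasFDerivAt (fun y => (u y : ℂ)) (Complex.ofRealCLM.comp (fderiv ℝ u z)) z := h
  rw [h'.fderiv]
  rfl

theorem dz_ofReal {u : ℂ → ℝ} {z : ℂ} (hu : DifferentiableAt ℝ u z) :
    dz (fun y => (u y : ℂ)) z =
      ((fderiv ℝ u z 1 : ℂ) - Complex.I * (fderiv ℝ u z Complex.I : ℂ)) / 2 := by
  rw [dz, fderiv_ofReal_comp hu, fderiv_ofReal_comp hu]

theorem dzbar_ofReal {u : ℂ → ℝ} {z : ℂ} (hu : DifferentiableAt ℝ u z) :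
    dzbar (fun y => (u y : ℂ)) z =
      ((fderiv ℝ u z 1 : ℂ) + Complex.I * (fderiv ℝ u z Complex.I : ℂ)) / 2 := by
  rw [dzbar, fderiv_ofReal_comp hu, fderiv_ofReal_comp hu]

theorem dz_ofReal_add_mul_I {g h : ℂ → ℝ} {z κ : ℂ} (hg : DifferentiableAt ℝ g z)
    (hh : DifferentiableAt ℝ h z) :
    dz (fun y => ((g y : ℂ) + κ * (h y : ℂ)) / 2) z =
      (((fderiv ℝ g z 1 : ℂ) + κ * (fderiv ℝ h z 1 : ℂ)) -
        Complex.I * ((fderiv ℝ g z Complex.I : ℂ) + κ * (fderiv ℝ h z Complex.I : ℂ))) / 4 := by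
  have hgc : DifferentiableAt ℝ (fun y => (g y : ℂ)) z :=
    Complex.ofRealCLM.differentiableAt.comp z hg
  have hhc : DifferentiableAt ℝ (fun y => (h y : ℂ)) z :=
    Complex.ofRealCLM.differentiableAt.comp z hh
  have hd (v : ℂ) : fderiv ℝ (fun y => ((g y : ℂ) + κ * (h y : ℂ)) / 2) z v =
      ((fderiv ℝ g z v : ℂ) + κ * (fderiv ℝ h z v : ℂ)) / 2 := by
    have h1 := (hgc.hasFDerivAt.add (hhc.hasFDerivAt.const_mul κ)).mul_const (2⁻¹ : ℂ)
    have h2 : HasFDerivAt (fun y => ((g y : ℂ) + κ * (h y : ℂ)) / 2) _ z := h1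
    rw [h2.fderiv]
    simp only [_root_.smul_apply, _root_.add_apply, smul_eq_mul,
      fderiv_ofReal_comp hg, fderiv_ofReal_comp hh]
    ring
  rw [dz, hd, hd]
  ring

section hessian

variable {u : ℂ → ℝ} {z : ℂ}

theorem dz_dz_ofReal (hu : ContDiffOn ℝ (⊤ : ℕ∞) u (ball 0 1)) (hz : z ∈ ball (0 : ℂ) 1) :
    dz (dz fun y => (u y : ℂ)) z =
      (((fderiv ℝ (fun y => fderiv ℝ u y 1) z 1 -
          fderiv ℝ (fun y => fderiv ℝ u y Complex.I) z Complex.I : ℝ) : ℂ) -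
        Complex.I * ((2 * fderiv ℝ (fun y => fderiv ℝ u y 1) z Complex.I : ℝ) : ℂ)) / 4 := by
  have hnhds : ball (0 : ℂ) 1 ∈ 𝓝 z := isOpen_ball.mem_nhds hz
  have hd (v : ℂ) : DifferentiableAt ℝ (fun y => fderiv ℝ u y v) z :=
    ((contDiffOn_fderiv_apply isOpen_ball hu v).contDiffAt hnhds).differentiableAt (by simp)
  have he : (dz fun y => (u y : ℂ)) =ᶠ[𝓝 z] fun y =>
      ((fderiv ℝ u y 1 : ℂ) + -Complex.I * (fderiv ℝ u y Complex.I : ℂ)) / 2 := by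
    filter_upwards [hnhds] with y hy
    rw [dz_ofReal ((hu.contDiffAt (isOpen_ball.mem_nhds hy)).differentiableAt (by simp))]
    ring
  rw [dz_congr he, dz_ofReal_add_mul_I (hd 1) (hd Complex.I),
    fderiv_fderiv_apply_comm (hu.contDiffAt hnhds) Complex.I 1]
  push_cast
  linear_combination (1 / 4 * (fderiv ℝ (fun y => fderiv ℝ u y Complex.I) z Complex.I : ℂ)) *
    Complex.I_mul_I

theorem dz_dzbar_ofReal (hu : ContDiffOn ℝ (⊤ : ℕ∞) u (ball 0 1)) (hz : z ∈ ball (0 : ℂ) 1) :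
    dz (dzbar fun y => (u y : ℂ)) z =
      4⁻¹ * ((fderiv ℝ (fun y => fderiv ℝ u y 1) z 1 +
          fderiv ℝ (fun y => fderiv ℝ u y Complex.I) z Complex.I : ℝ) : ℂ) := by
  have hnhds : ball (0 : ℂ) 1 ∈ 𝓝 z := isOpen_ball.mem_nhds hz
  have hd (v : ℂ) : DifferentiableAt ℝ (fun y => fderiv ℝ u y v) z :=
    ((contDiffOn_fderiv_apply isOpen_ball hu v).contDiffAt hnhds).differentiableAt (by simp)
  have he : (dzbar fun y => (u y : ℂ)) =ᶠ[𝓝 z] fun y =>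
      ((fderiv ℝ u y 1 : ℂ) + Complex.I * (fderiv ℝ u y Complex.I : ℂ)) / 2 := by
    filter_upwards [hnhds] with y hy
    rw [dzbar_ofReal ((hu.contDiffAt (isOpen_ball.mem_nhds hy)).differentiableAt (by simp))]
  rw [dz_congr he, dz_ofReal_add_mul_I (hd 1) (hd Complex.I),
    fderiv_fderiv_apply_comm (hu.contDiffAt hnhds) Complex.I 1]
  push_cast
  linear_combination (-1 / 4 * (fderiv ℝ (fun y => fderiv ℝ u y Complex.I) z Complex.I : ℂ)) *
    Complex.I_mul_I

/-- The Frobenius norm of the Hessian of a real function on the plane. -/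
def hessNorm (u : ℂ → ℝ) (z : ℂ) : ℝ :=
  √(fderiv ℝ (fun y => fderiv ℝ u y 1) z 1 ^ 2 +
    fderiv ℝ (fun y => fderiv ℝ u y Complex.I) z 1 ^ 2 +
    fderiv ℝ (fun y => fderiv ℝ u y 1) z Complex.I ^ 2 +
    fderiv ℝ (fun y => fderiv ℝ u y Complex.I) z Complex.I ^ 2)

theorem hessNorm_le (hu : ContDiffOn ℝ (⊤ : ℕ∞) u (ball 0 1)) (hz : z ∈ ball (0 : ℂ) 1) :
    hessNorm u z ≤ |fderiv ℝ (fun y => fderiv ℝ u y 1) z 1 +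
        fderiv ℝ (fun y => fderiv ℝ u y Complex.I) z Complex.I| +
      4 * ‖dz (dz fun y => (u y : ℂ)) z‖ := by
  have hnhds : ball (0 : ℂ) 1 ∈ 𝓝 z := isOpen_ball.mem_nhds hz
  rw [hessNorm, dz_dz_ofReal hu hz, fderiv_fderiv_apply_comm (hu.contDiffAt hnhds) Complex.I 1]
  set x := fderiv ℝ (fun y => fderiv ℝ u y 1) z 1
  set w := fderiv ℝ (fun y => fderiv ℝ u y Complex.I) z Complex.I
  set y := fderiv ℝ (fun y => fderiv ℝ u y 1) z Complex.I
  rw [norm_div, Complex.norm_ofNat, mul_div_cancel₀ _ (by norm_num : (4 : ℝ) ≠ 0)]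
  set n := ‖((x - w : ℝ) : ℂ) - Complex.I * ((2 * y : ℝ) : ℂ)‖ with hn
  have hn2 : n ^ 2 = (x - w) ^ 2 + 4 * y ^ 2 := by
    rw [hn, ← Complex.normSq_eq_norm_sq, Complex.normSq_apply]
    simp
    ring
  have hn0 : 0 ≤ n := norm_nonneg _
  refine Real.sqrt_le_iff.2 ⟨by positivity, ?_⟩
  have := mul_nonneg (abs_nonneg (x + w)) hn0
  nlinarith [sq_abs (x + w)]

end hessian

/-- The constant in the Hessian estimate on the unit disk. -/
def hessConst (q : ℝ) : ℝ :=
  (2 + 4 * (66 + 8 * (31104000 / π ^ 2 * (384 * π * q) *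
    (384 * π + 248832000 * (384 * π * q))))) * (32 * (q + 2) * 2 ^ (q + 2) / (1 / (4 * q)))

theorem hessConst_pos {q : ℝ} (hq : 2 < q) : 0 < hessConst q := by
  have := Real.pi_pos
  unfold hessConst
  positivity

theorem lintegral_gradAbs_rpow {a : ℂ → ℝ} {p : ℝ} (hp : 0 < p) :
    ∫⁻ x, gradAbs a x ^ p = ∫⁻ x in ball 0 1, ‖fderiv ℝ a x‖ₑ ^ p := by
  rw [← lintegral_indicator measurableSet_ball]
  refine lintegral_congr fun x => ?_
  by_cases hx : x ∈ ball (0 : ℂ) 1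
  · rw [gradAbs, indicator_of_mem hx, indicator_of_mem hx]
  · rw [gradAbs, indicator_of_notMem hx, indicator_of_notMem hx, ENNReal.zero_rpow_of_pos hp]

theorem lintegral_hessNorm_le {q p p' : ℝ} (hq : 2 < q) (hp : 2 ≤ p) (hpq : p ≤ q)
    (hpp : p.HolderConjugate p') {a b u : ℂ → ℝ}
    (ha : ContDiffOn ℝ (⊤ : ℕ∞) a (ball 0 1)) (hb : ContDiffOn ℝ (⊤ : ℕ∞) b (ball 0 1))
    (hu : ContDiffOn ℝ (⊤ : ℕ∞) u (ball 0 1)) (huc : ContinuousOn u (closedBall 0 1))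
    (hA : ∫⁻ x in ball 0 1, ‖fderiv ℝ a x‖ₑ ^ p ≠ ∞)
    (hB : ∫⁻ x in ball 0 1, ‖fderiv ℝ b x‖ₑ ^ p' ≠ ∞)
    (hΔ : ∀ z ∈ ball (0 : ℂ) 1, fderiv ℝ (fun y => fderiv ℝ u y 1) z 1 +
      fderiv ℝ (fun y => fderiv ℝ u y Complex.I) z Complex.I = jac a b z)
    (h0 : ∀ z ∈ sphere (0 : ℂ) 1, u z = 0) :
    ∫⁻ x in ball 0 1, ENNReal.ofReal (hessNorm u x) ≤ ENNReal.ofReal (hessConst q) *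
      ((∫⁻ x in ball 0 1, ‖fderiv ℝ a x‖ₑ ^ p) ^ (1 / p) *
        (∫⁻ x in ball 0 1, ‖fderiv ℝ b x‖ₑ ^ p') ^ (1 / p')) := by
  have hpi := Real.pi_pos
  have hq0 : 0 < q := by linarith
  have hp0 := hpp.pos
  have hp0' := hpp.symm.pos
  have hinv : p'⁻¹ = 1 - p⁻¹ := by linarith [hpp.inv_add_inv_eq_one]
  have hpinv : p⁻¹ ≤ 1 / 2 := by
    rw [one_div]
    exact inv_anti₀ (by norm_num) hp
  have hpinv' : q⁻¹ ≤ p⁻¹ := inv_anti₀ hp0 hpq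
  have hqi : 0 < q⁻¹ := by positivity
  have hqi2 : q⁻¹ < 1 / 2 := by
    rw [one_div]
    exact inv_strictAnti₀ (by norm_num) hq
  set s : ℝ := (1 / 2 + q⁻¹ / 4)⁻¹ with hs
  set σ : ℝ := (1 - 3 * q⁻¹ / 4)⁻¹ with hσ
  set θ : ℝ := 1 / 2 - q⁻¹ / 2 with hθ
  have hs0 : 0 < s := by positivity
  have hσ0 : 0 < σ := inv_pos.2 (by linarith)
  have hs1 : 1 / s = 1 / 2 + q⁻¹ / 4 := by rw [hs, one_div, inv_inv]
  have hσ1 : 1 / σ = 1 - 3 * q⁻¹ / 4 := by rw [hσ, one_div, inv_inv]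
  have hqq : q * q⁻¹ = 1 := mul_inv_cancel₀ hq0.ne'
  set K : ℝ := 384 * π * q with hK
  have hK0 : 0 < K := by positivity
  have hKθ : 96 * (NNReal.pi : ℝ≥0∞) * ENNReal.ofReal (4 / (1 - 2 * θ)) = ENNReal.ofReal K := by
    rw [show 4 / (1 - 2 * θ) = 4 * q by rw [hθ]; field_simp; ring]
    rw [show K = 96 * π * (4 * q) by rw [hK]; ring,
      ENNReal.ofReal_mul (p := 96 * π) (by positivity),
      ENNReal.ofReal_mul (p := 96) (by norm_num), ENNReal.ofReal_ofNat]
    congr 2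
    rw [← NNReal.coe_real_pi, ENNReal.ofReal_coe_nnreal]
  set F := bimax s σ (gradAbs a) (gradAbs b) with hF
  have hFle : ∫⁻ x in ball 0 1, F x ≤ ENNReal.ofReal (32 * (q + 2) * 2 ^ (q + 2) / (1 / (4 * q))) *
      ((∫⁻ x in ball 0 1, ‖fderiv ℝ a x‖ₑ ^ p) ^ (1 / p) *
        (∫⁻ x in ball 0 1, ‖fderiv ℝ b x‖ₑ ^ p') ^ (1 / p')) := by
    refine (setLIntegral_le_lintegral _ _).trans ?_
    rw [← lintegral_gradAbs_rpow hp0, ← lintegral_gradAbs_rpow hp0']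
    have e1 : 1 / (4 * q) = q⁻¹ / 4 := by field_simp
    have hp'2 : p' ≤ 2 := by
      rw [← inv_le_inv₀ (by norm_num) hp0', hinv]
      linarith
    have hp'q : 1 ≤ p' * (1 - q⁻¹) := by
      have h1 : p' * p'⁻¹ = 1 := mul_inv_cancel₀ hp0'.ne'
      have h2 : p'⁻¹ ≤ 1 - q⁻¹ := by linarith
      linarith [mul_le_mul_of_nonneg_left h2 hp0'.le]
    have hp'1 := mul_le_mul_of_nonneg_right hpp.symm.lt.le hqi.le
    refine lintegral_bimax_le (measurable_gradAbs a) (measurable_gradAbs b) hs0 hσ0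
      (by positivity) hpp ?_ ?_ ?_ ?_
    · rw [e1, ← mul_one_div p, hs1]
      nlinarith
    · rw [← mul_one_div p, hs1]
      nlinarith
    · rw [e1, ← mul_one_div p', hσ1]
      linarith
    · rw [← mul_one_div p', hσ1]
      nlinarith
  have hfF (y : ℂ) (hy : y ∈ ball (0 : ℂ) 1) : ‖jac a b y‖ₑ ≤ 2 * F y :=
    (enorm_jac_le_gradAbs a b hy).trans
      (mul_le_mul_right (gradAbs_mul_le_bimax hs0 hσ0 ha hb hy) 2)
  have hfc : ContinuousOn (jac a b) (ball 0 1) := by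
    have hc {g : ℂ → ℝ} (hg : ContDiffOn ℝ (⊤ : ℕ∞) g (ball 0 1)) (v : ℂ) :=
      (contDiffOn_fderiv_apply isOpen_ball hg v).continuousOn
    exact ((hc ha 1).mul (hc hb Complex.I)).sub ((hc ha Complex.I).mul (hc hb 1))
  have hfint : ∫⁻ x in ball 0 1, ‖jac a b x‖ₑ ≤ 2 * ∫⁻ x in ball 0 1, F x := by
    rw [← lintegral_const_mul' _ _ (by simp)]
    exact setLIntegral_mono' measurableSet_ball hfF
  have hFfin : ∫⁻ x in ball 0 1, F x < ∞ := by
    refine hFle.trans_lt (ENNReal.mul_lt_top ENNReal.ofReal_lt_top (ENNReal.mul_lt_top ?_ ?_))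
    · exact ENNReal.rpow_lt_top_of_nonneg (by positivity) hA
    · exact ENNReal.rpow_lt_top_of_nonneg (by positivity) hB
  have hinteg : IntegrableOn (jac a b) (ball 0 1) :=
    ⟨hfc.aestronglyMeasurable measurableSet_ball,
      hfint.trans_lt (ENNReal.mul_lt_top (by simp) hFfin)⟩
  have hLip (t : ℝ) (ht : 0 < t) :
      LipTestBound (jac a b) (ball 0 1 ∩ {x | F x ≤ ENNReal.ofReal t})
        (ENNReal.ofReal (K * t)) := by
    intro x₀ hx₀ ρ hρ hρ6 Ψ L hΨ hΨ0
    refine (enorm_setIntegral_mul_jac_le (θ := θ) hs0 hσ0 (by linarith) (by rw [hs1, hσ1]; linarith)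
      (by rw [hs1]; linarith) (by rw [hσ1]; linarith) (by linarith) ha hb hinteg hx₀.1 hρ hρ6 hΨ
      hΨ0).trans ?_
    rw [hKθ, ENNReal.ofReal_mul hK0.le]
    calc _ ≤ ENNReal.ofReal K * L * ENNReal.ofReal ρ ^ 3 * ENNReal.ofReal t :=
          mul_le_mul_right hx₀.2 _
      _ = _ := by ring
  have hmain := lintegral_dz_dz_le (φ := fun y => (u y : ℂ)) (f := jac a b) (F := F) hK0
    (Complex.ofRealCLM.contDiff.comp_contDiffOn hu)
    (Complex.continuous_ofReal.comp_continuousOn huc) (fun y hy => by simp [h0 y hy])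
    (fun y hy => by rw [dz_dzbar_ofReal hu hy, hΔ y hy]) hfc hinteg
    (isOpen_lt_bimax _ _ _ _) hfF hLip
  set C : ℝ := 66 + 8 * (31104000 / π ^ 2 * K * (384 * π + 248832000 * K)) with hC
  have hC0 : 0 ≤ C := by positivity
  calc ∫⁻ x in ball 0 1, ENNReal.ofReal (hessNorm u x)
      ≤ ∫⁻ x in ball 0 1, (‖jac a b x‖ₑ + 4 * ‖dz (dz fun y => (u y : ℂ)) x‖ₑ) := by
        refine setLIntegral_mono' measurableSet_ball fun x hx => ?_
        refine (ENNReal.ofReal_le_ofReal (hessNorm_le hu hx)).trans ?_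
        rw [hΔ x hx, ENNReal.ofReal_add (abs_nonneg _) (by positivity),
          ENNReal.ofReal_mul (by norm_num), ENNReal.ofReal_ofNat, ofReal_norm, ← Real.norm_eq_abs,
          ofReal_norm]
    _ = (∫⁻ x in ball 0 1, ‖jac a b x‖ₑ) +
          4 * ∫⁻ x in ball 0 1, ‖dz (dz fun y => (u y : ℂ)) x‖ₑ := by
        rw [lintegral_add_left' (hfc.aestronglyMeasurable measurableSet_ball).enorm,
          lintegral_const_mul' _ _ (by simp)]
    _ ≤ 2 * (∫⁻ x in ball 0 1, F x) + 4 * (ENNReal.ofReal C * ∫⁻ x in ball 0 1, F x) := by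
        gcongr
    _ = ENNReal.ofReal (2 + 4 * C) * ∫⁻ x in ball 0 1, F x := by
        rw [ENNReal.ofReal_add (p := 2) (by norm_num) (by positivity),
          ENNReal.ofReal_mul (p := 4) (by norm_num), ENNReal.ofReal_ofNat, ENNReal.ofReal_ofNat]
        ring
    _ ≤ _ := by
        rw [hessConst, ENNReal.ofReal_mul (by positivity), mul_assoc]
        exact mul_le_mul_right hFle _

/-- The affine similarity from the complex plane to `ℝ²` taking the unit disk to the disk of
centre `c` and radius `r`. -/
def planeMap (c : E2) (r : ℝ) (z : ℂ) : E2 := c + r • Complex.orthonormalBasisOneI.repr z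

section planeMap

variable {c : E2} {r : ℝ}

theorem repr_one : Complex.orthonormalBasisOneI.repr 1 = EuclideanSpace.single 0 1 := by
  ext i
  fin_cases i <;> simp [Complex.orthonormalBasisOneI]

theorem repr_I : Complex.orthonormalBasisOneI.repr Complex.I = EuclideanSpace.single 1 1 := by
  ext i
  fin_cases i <;> simp [Complex.orthonormalBasisOneI]

theorem dist_planeMap_center (hr : 0 < r) (z : ℂ) : dist (planeMap c r z) c = r * ‖z‖ := by
  rw [planeMap, dist_eq_norm, add_sub_cancel_left, norm_smul, LinearIsometryEquiv.norm_map,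
    Real.norm_of_nonneg hr.le]

theorem planeMap_mem_ball_iff (hr : 0 < r) (z : ℂ) :
    planeMap c r z ∈ ball c r ↔ z ∈ ball (0 : ℂ) 1 := by
  rw [mem_ball, dist_planeMap_center hr, mem_ball_zero_iff]
  constructor <;> intro h <;> nlinarith

theorem planeMap_mem_closedBall (hr : 0 < r) {z : ℂ} (hz : z ∈ closedBall (0 : ℂ) 1) :
    planeMap c r z ∈ closedBall c r := by
  rw [mem_closedBall, dist_planeMap_center hr]
  rw [mem_closedBall_zero_iff] at hz
  nlinarith

theorem planeMap_mem_sphere (hr : 0 < r) {z : ℂ} (hz : z ∈ sphere (0 : ℂ) 1) :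
    planeMap c r z ∈ sphere c r := by
  rw [mem_sphere, dist_planeMap_center hr, mem_sphere_zero_iff_norm.1 hz, mul_one]

theorem contDiff_planeMap : ContDiff ℝ (⊤ : ℕ∞) (planeMap c r) :=
  contDiff_const.add (Complex.orthonormalBasisOneI.repr.contDiff.const_smul r)

theorem fderiv_comp_planeMap (f : E2 → ℝ) (z : ℂ) :
    fderiv ℝ (fun y => f (planeMap c r y)) z = r • (fderiv ℝ f (planeMap c r z)).comp
      (Complex.orthonormalBasisOneI.repr : ℂ →L[ℝ] E2) := by
  have h1 : fderiv ℝ ((fun x => f (c + r • x)) ∘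
      Complex.orthonormalBasisOneI.repr.toContinuousLinearEquiv) z = _ :=
    ContinuousLinearEquiv.comp_right_fderiv _
  have h2 (x : E2) : fderiv ℝ (fun x => f (c + r • x)) x = r • fderiv ℝ f (c + r • x) := by
    rw [fderiv_comp_smul (f := fun x => f (c + x)), fderiv_comp_add_left]
  rw [h2] at h1
  exact h1

theorem enorm_fderiv_comp_planeMap (hr : 0 < r) (f : E2 → ℝ) (z : ℂ) :
    ‖fderiv ℝ (fun y => f (planeMap c r y)) z‖ₑ =
      ENNReal.ofReal r * ‖fderiv ℝ f (planeMap c r z)‖ₑ := by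
  rw [fderiv_comp_planeMap, enorm_smul, Real.enorm_of_nonneg hr.le, ← ofReal_norm,
    ContinuousLinearMap.opNorm_comp_linearIsometryEquiv, ofReal_norm]

theorem fderiv_comp_planeMap_one (f : E2 → ℝ) (z : ℂ) :
    fderiv ℝ (fun y => f (planeMap c r y)) z 1 = r * pd 0 f (planeMap c r z) := by
  rw [fderiv_comp_planeMap, pd, ← repr_one]
  rfl

theorem fderiv_comp_planeMap_I (f : E2 → ℝ) (z : ℂ) :
    fderiv ℝ (fun y => f (planeMap c r y)) z Complex.I = r * pd 1 f (planeMap c r z) := by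
  rw [fderiv_comp_planeMap, pd, ← repr_I]
  rfl

theorem fderiv_const_mul_comp_planeMap_one (f : E2 → ℝ) (z : ℂ) :
    fderiv ℝ (fun y => r * f (planeMap c r y)) z 1 = r ^ 2 * pd 0 f (planeMap c r z) := by
  change fderiv ℝ (r • fun y => f (planeMap c r y)) z 1 = _
  rw [fderiv_const_smul_field]
  rw [Pi.smul_apply, _root_.smul_apply, fderiv_comp_planeMap_one, smul_eq_mul]
  ring

theorem fderiv_const_mul_comp_planeMap_I (f : E2 → ℝ) (z : ℂ) :
    fderiv ℝ (fun y => r * f (planeMap c r y)) z Complex.I = r ^ 2 * pd 1 f (planeMap c r z) := by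
  change fderiv ℝ (r • fun y => f (planeMap c r y)) z Complex.I = _
  rw [fderiv_const_smul_field]
  rw [Pi.smul_apply, _root_.smul_apply, fderiv_comp_planeMap_I, smul_eq_mul]
  ring

theorem jac_comp_planeMap (a b : E2 → ℝ) (z : ℂ) :
    jac (fun y => a (planeMap c r y)) (fun y => b (planeMap c r y)) z =
      r ^ 2 * (pd 0 a (planeMap c r z) * pd 1 b (planeMap c r z) -
        pd 1 a (planeMap c r z) * pd 0 b (planeMap c r z)) := by
  simp only [jac, fderiv_comp_planeMap_one, fderiv_comp_planeMap_I]
  ring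

theorem hessNorm_comp_planeMap (u : E2 → ℝ) (z : ℂ) :
    hessNorm (fun y => u (planeMap c r y)) z =
      r ^ 2 * √(pd 0 (pd 0 u) (planeMap c r z) ^ 2 + pd 0 (pd 1 u) (planeMap c r z) ^ 2 +
        pd 1 (pd 0 u) (planeMap c r z) ^ 2 + pd 1 (pd 1 u) (planeMap c r z) ^ 2) := by
  simp only [hessNorm, fderiv_comp_planeMap_one, fderiv_comp_planeMap_I,
    fderiv_const_mul_comp_planeMap_one, fderiv_const_mul_comp_planeMap_I]
  rw [← Real.sqrt_sq (sq_nonneg r), ← Real.sqrt_mul (by positivity), Real.sqrt_sq (sq_nonneg r)]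
  congr 1
  ring

theorem lintegral_comp_planeMap (hr : 0 < r) (g : E2 → ℝ≥0∞) :
    ∫⁻ z in ball (0 : ℂ) 1, g (planeMap c r z) =
      ENNReal.ofReal (r ^ 2)⁻¹ * ∫⁻ x in ball c r, g x := by
  set G := (ball c r).indicator g with hG
  have h1 : ∫⁻ z in ball (0 : ℂ) 1, g (planeMap c r z) = ∫⁻ z, G (planeMap c r z) := by
    rw [← lintegral_indicator measurableSet_ball]
    refine lintegral_congr fun z => ?_
    by_cases hz : z ∈ ball (0 : ℂ) 1
    · rw [indicator_of_mem hz, hG, indicator_of_mem ((planeMap_mem_ball_iff hr z).2 hz)]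
    · rw [indicator_of_notMem hz, hG,
        indicator_of_notMem (mt (planeMap_mem_ball_iff hr z).1 hz)]
  have h2 : ∫⁻ z, G (planeMap c r z) = ∫⁻ x : E2, G (c + r • x) :=
    (Complex.orthonormalBasisOneI.repr.measurePreserving.lintegral_comp_emb
      Complex.orthonormalBasisOneI.repr.toHomeomorph.measurableEmbedding
      (fun x : E2 => G (c + r • x)))
  have h3 : ∫⁻ x : E2, G (c + r • x) = ∫⁻ x, G (c + x) ∂(Measure.map (r • ·) volume) :=
    ((Homeomorph.smulOfNeZero r hr.ne').measurableEmbedding.lintegral_map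
      (fun x : E2 => G (c + x))).symm
  rw [h1, h2, h3, Measure.map_addHaar_smul _ hr.ne', lintegral_smul_measure,
    lintegral_add_left_eq_self G c, hG, lintegral_indicator measurableSet_ball, smul_eq_mul,
    finrank_euclideanSpace, Fintype.card_fin, abs_of_nonneg (by positivity)]

theorem lintegral_fderiv_comp_planeMap_rpow (hr : 0 < r) {p : ℝ} (hp : 0 < p) (f : E2 → ℝ) :
    (∫⁻ z in ball (0 : ℂ) 1, ‖fderiv ℝ (fun y => f (planeMap c r y)) z‖ₑ ^ p) ^ (1 / p) =
      ENNReal.ofReal r * ENNReal.ofReal (r ^ 2)⁻¹ ^ (1 / p) *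
        (∫⁻ x in ball c r, ‖fderiv ℝ f x‖ₑ ^ p) ^ (1 / p) := by
  simp_rw [enorm_fderiv_comp_planeMap hr, ENNReal.mul_rpow_of_nonneg _ _ hp.le]
  rw [lintegral_const_mul' _ _ (by finiteness),
    lintegral_comp_planeMap hr (fun x => ‖fderiv ℝ f x‖ₑ ^ p),
    ENNReal.mul_rpow_of_nonneg _ _ (by positivity), ENNReal.mul_rpow_of_nonneg _ _ (by positivity),
    ← ENNReal.rpow_mul, mul_one_div_cancel hp.ne', ENNReal.rpow_one, mul_assoc]

end planeMap

theorem integral_norm_fderiv_rpow {f : E2 → ℝ} {p : ℝ} (hp : 0 ≤ p) {s : Set E2} :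
    ∫ x in s, ‖fderiv ℝ f x‖ ^ p = (∫⁻ x in s, ‖fderiv ℝ f x‖ₑ ^ p).toReal := by
  rw [integral_eq_lintegral_of_nonneg_ae (Eventually.of_forall fun x => by positivity)
    ((measurable_fderiv ℝ f).norm.pow_const p).aestronglyMeasurable]
  congr 1
  refine lintegral_congr fun x => ?_
  rw [← ENNReal.ofReal_rpow_of_nonneg (norm_nonneg _) hp, ofReal_norm]

theorem lintegral_enorm_fderiv_rpow_ne_top {f : E2 → ℝ} {p : ℝ} (hp : 0 ≤ p) {s : Set E2}
    (h : IntegrableOn (fun x => ‖fderiv ℝ f x‖ ^ p) s) :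
    ∫⁻ x in s, ‖fderiv ℝ f x‖ₑ ^ p ≠ ∞ := by
  have h1 := h.2.ne
  convert h1 using 2
  funext x
  rw [Real.enorm_of_nonneg (by positivity), ← ENNReal.ofReal_rpow_of_nonneg (norm_nonneg _) hp,
    ofReal_norm]

end

/-- CLMS-type estimate: for `q ∈ (2,∞)`, `p ∈ [2,q]`, `p' = p/(p-1)`, if
`Δφ = ∇^⊥a·∇b` on a disk with zero boundary data, then
`‖∇²φ‖_{L¹} ≤ C_q ‖∇a‖_{L^p} ‖∇b‖_{L^{p'}}` with `C_q` depending only on `q`. -/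
theorem clms_hessian_L1 (q : ℝ) (hq : 2 < q) :
    ∃ C > (0:ℝ), ∀ p ∈ Set.Icc (2:ℝ) q, ∀ (c : E2) (r : ℝ), 0 < r →
      ∀ a b φ : E2 → ℝ,
      ContDiffOn ℝ (⊤ : ℕ∞) a (ball c r) → ContDiffOn ℝ (⊤ : ℕ∞) b (ball c r) →
      ContDiffOn ℝ (⊤ : ℕ∞) φ (ball c r) → ContinuousOn φ (closedBall c r) →
      IntegrableOn (fun x => ‖fderiv ℝ a x‖ ^ p) (ball c r) →
      IntegrableOn (fun x => ‖fderiv ℝ b x‖ ^ (p / (p - 1))) (ball c r) →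
      (∀ x ∈ ball c r, lap φ x = pd 0 a x * pd 1 b x - pd 1 a x * pd 0 b x) →
      (∀ x ∈ sphere c r, φ x = 0) →
      (∫ x in ball c r, Real.sqrt ((pd 0 (pd 0 φ) x) ^ 2 + (pd 0 (pd 1 φ) x) ^ 2 +
          (pd 1 (pd 0 φ) x) ^ 2 + (pd 1 (pd 1 φ) x) ^ 2)) ≤
        C * (∫ x in ball c r, ‖fderiv ℝ a x‖ ^ p) ^ (1 / p) *
          (∫ x in ball c r, ‖fderiv ℝ b x‖ ^ (p / (p - 1))) ^ ((p - 1) / p) := by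
  refine ⟨hessConst q, hessConst_pos hq, ?_⟩
  intro p hp c r hr a b φ ha hb hφ hφc hA hB hΔ h0
  set p' := p / (p - 1) with hp'
  have hpp : p.HolderConjugate p' := Real.HolderConjugate.conjExponent (by linarith [hp.1])
  have hp0 := hpp.pos
  have hp0' := hpp.symm.pos
  have hinv : (p - 1) / p = 1 / p' := by rw [hp', one_div_div]
  have hmaps : Set.MapsTo (planeMap c r) (ball 0 1) (ball c r) := fun z hz =>
    (planeMap_mem_ball_iff hr z).2 hz
  have hcomp {f : E2 → ℝ} (hf : ContDiffOn ℝ (⊤ : ℕ∞) f (ball c r)) :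
      ContDiffOn ℝ (⊤ : ℕ∞) (fun y => f (planeMap c r y)) (ball 0 1) :=
    hf.comp contDiff_planeMap.contDiffOn hmaps
  have hfin {f : E2 → ℝ} {m : ℝ} (hm : 0 < m)
      (hf : ∫⁻ x in ball c r, ‖fderiv ℝ f x‖ₑ ^ m ≠ ∞) :
      ∫⁻ z in ball (0 : ℂ) 1, ‖fderiv ℝ (fun y => f (planeMap c r y)) z‖ₑ ^ m ≠ ∞ := by
    have h1 := lintegral_fderiv_comp_planeMap_rpow (c := c) hr hm f
    intro htop
    rw [htop, ENNReal.top_rpow_of_pos (by positivity)] at h1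
    refine absurd h1.symm (ENNReal.mul_ne_top (ENNReal.mul_ne_top ENNReal.ofReal_ne_top ?_) ?_)
    · exact ENNReal.rpow_ne_top_of_nonneg (by positivity) ENNReal.ofReal_ne_top
    · exact ENNReal.rpow_ne_top_of_nonneg (by positivity) hf
  have hAfin := lintegral_enorm_fderiv_rpow_ne_top hp0.le hA
  have hBfin := lintegral_enorm_fderiv_rpow_ne_top hp0'.le hB
  have key := lintegral_hessNorm_le hq hp.1 hp.2 hpp (hcomp ha) (hcomp hb) (hcomp hφ)
    (hφc.comp contDiff_planeMap.continuous.continuousOn fun z hz => planeMap_mem_closedBall hr hz)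
    (hfin hp0 hAfin) (hfin hp0' hBfin)
    (fun z hz => by
      simp only [fderiv_comp_planeMap_one, fderiv_comp_planeMap_I,
        fderiv_const_mul_comp_planeMap_one, fderiv_const_mul_comp_planeMap_I]
      rw [jac_comp_planeMap, ← hΔ _ (hmaps hz), lap]
      ring)
    (fun z hz => h0 _ (planeMap_mem_sphere hr hz))
  rw [lintegral_fderiv_comp_planeMap_rpow hr hp0,
    lintegral_fderiv_comp_planeMap_rpow hr hp0'] at key
  simp_rw [hessNorm_comp_planeMap, ENNReal.ofReal_mul (sq_nonneg r)] at key
  set H : E2 → ℝ := fun x => √((pd 0 (pd 0 φ) x) ^ 2 + (pd 0 (pd 1 φ) x) ^ 2 +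
    (pd 1 (pd 0 φ) x) ^ 2 + (pd 1 (pd 1 φ) x) ^ 2) with hH
  set X := ∫⁻ x in ball c r, ‖fderiv ℝ a x‖ₑ ^ p
  set Y := ∫⁻ x in ball c r, ‖fderiv ℝ b x‖ₑ ^ p'
  set J := ENNReal.ofReal (r ^ 2)⁻¹ with hJ
  have hRJ : ENNReal.ofReal (r ^ 2) * J = 1 := by
    rw [hJ, ← ENNReal.ofReal_mul (by positivity), mul_inv_cancel₀ (by positivity),
      ENNReal.ofReal_one]
  have hJJ : J ^ (1 / p) * J ^ (1 / p') = J := by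
    rw [← ENNReal.rpow_add_of_nonneg _ _ (by positivity) (by positivity), one_div, one_div,
      hpp.inv_add_inv_eq_one, ENNReal.rpow_one]
  have hle : ∫⁻ x in ball c r, ENNReal.ofReal (H x) ≤
      ENNReal.ofReal (hessConst q) * (X ^ (1 / p) * Y ^ (1 / p')) := by
    rw [lintegral_const_mul' _ _ ENNReal.ofReal_ne_top,
      lintegral_comp_planeMap hr (fun x => ENNReal.ofReal (H x)), ← mul_assoc, hRJ, one_mul] at key
    refine key.trans_eq ?_
    calc _ = ENNReal.ofReal (hessConst q) * (ENNReal.ofReal r ^ 2 * (J ^ (1 / p) * J ^ (1 / p')) *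
          (X ^ (1 / p) * Y ^ (1 / p'))) := by ring
      _ = _ := by rw [hJJ, ← ENNReal.ofReal_pow hr.le, hRJ, one_mul]
  have hmeas : Measurable H := by
    have h (i j : Fin 2) : Measurable (pd i (pd j φ)) := measurable_fderiv_apply_const ℝ _ _
    exact (((((h 0 0).pow_const 2).add ((h 0 1).pow_const 2)).add ((h 1 0).pow_const 2)).add
      ((h 1 1).pow_const 2)).sqrt
  rw [integral_norm_fderiv_rpow hp0.le, integral_norm_fderiv_rpow hp0'.le, hinv,
    ENNReal.toReal_rpow, ENNReal.toReal_rpow,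
    integral_eq_lintegral_of_nonneg_ae (Filter.Eventually.of_forall fun x => Real.sqrt_nonneg _)
      hmeas.aestronglyMeasurable]
  calc _ ≤ (ENNReal.ofReal (hessConst q) * (X ^ (1 / p) * Y ^ (1 / p'))).toReal := by
        refine ENNReal.toReal_mono (ENNReal.mul_ne_top ENNReal.ofReal_ne_top
          (ENNReal.mul_ne_top ?_ ?_)) hle
        · exact ENNReal.rpow_ne_top_of_nonneg (by positivity) hAfin
        · exact ENNReal.rpow_ne_top_of_nonneg (by positivity) hBfin
    _ = _ := by
        rw [ENNReal.toReal_mul, ENNReal.toReal_mul, ENNReal.toReal_ofReal (hessConst_pos hq).le,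
          mul_assoc]

end
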